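/- Let (p_n) be the increasing enumeration of the prime numbers, let (X, ℬ, μ, T) be an invertible ergodic measure preserving system, and let g ∈ ℤ[x] with g(0) = 0. Then for every A ∈ ℬ and every ε > 0, the set {n ∈ ℕ : μ(A ∩ T^{−g(p_n−1)}A) > μ(A)² − ε} has positive lower density; moreover, the same conclusion holds with p_n + 1 in place of p_n − 1. -/

import Mathlib

open MeasureTheory Filter

/-- For an invertible map `T` with inverse `S`, `zpreimage T S n A` is the preimage of `A`
under `T^n` (allowing negative integer exponents). -/
def zpreimage {X : Type*} (T S : X → X) (n : ℤ) (A : Set X) : Set X :=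
  if 0 ≤ n then T^[n.toNat] ⁻¹' A else S^[(-n).toNat] ⁻¹' A

/-- A set of naturals has positive lower density. -/
def HasPositiveLowerDensity (E : Set ℕ) : Prop :=
  0 < Filter.liminf (fun N : ℕ => (Set.ncard (E ∩ Set.Icc 1 N) : ℝ) / N) Filter.atTop

/-- Elementary symmetric function of the values of `u` on a finite set. -/
noncomputable def elemSymm {ι : Type*} (u : ι → ℝ) (P : Finset ι) (k : ℕ) : ℝ :=
  ∑ D ∈ P.powersetCard k, ∏ p ∈ D, u p

/-- Truncated inclusion–exclusion sum. -/
noncomputable def truncSieve {ι : Type*} (u : ι → ℝ) (P : Finset ι) (m : ℕ) : ℝ :=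
  ∑ k ∈ Finset.range (m + 1), (-1) ^ k * elemSymm u P k

section ElemSymm

variable {ι : Type*}

lemma elemSymm_zero (u : ι → ℝ) (P : Finset ι) : elemSymm u P 0 = 1 := by
  simp [elemSymm]

lemma elemSymm_empty_succ (u : ι → ℝ) (k : ℕ) : elemSymm u ∅ (k + 1) = 0 := by
  unfold elemSymm
  rw [Finset.powersetCard_eq_empty.2 (by simp), Finset.sum_empty]

lemma elemSymm_nonneg {u : ι → ℝ} {P : Finset ι} (hu : ∀ p ∈ P, 0 ≤ u p) (k : ℕ) :
    0 ≤ elemSymm u P k := by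
  refine Finset.sum_nonneg fun D hD => Finset.prod_nonneg fun p hp => hu p ?_
  exact (Finset.mem_powersetCard.1 hD).1 hp

lemma elemSymm_insert [DecidableEq ι] (u : ι → ℝ) {P : Finset ι} {a : ι} (ha : a ∉ P) (k : ℕ) :
    elemSymm u (insert a P) (k + 1) = elemSymm u P (k + 1) + u a * elemSymm u P k := by
  unfold elemSymm
  rw [Finset.powersetCard_succ_insert ha, Finset.sum_union, Finset.sum_image, Finset.mul_sum]
  · congr 1
    refine Finset.sum_congr rfl fun D hD => ?_
    rw [Finset.prod_insert]
    exact fun h => ha ((Finset.mem_powersetCard.1 hD).1 h)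
  · intro D hD E hE h
    have hD' : a ∉ D := fun h => ha ((Finset.mem_powersetCard.1 hD).1 h)
    have hE' : a ∉ E := fun h => ha ((Finset.mem_powersetCard.1 hE).1 h)
    rw [← Finset.erase_insert hD', ← Finset.erase_insert hE']
    exact congrArg (fun E => Finset.erase E a) h
  · rw [Finset.disjoint_left]
    intro D hD h
    obtain ⟨E, -, rfl⟩ := Finset.mem_image.1 h
    exact ha ((Finset.mem_powersetCard.1 hD).1 (Finset.mem_insert_self a E))

lemma truncSieve_insert [DecidableEq ι] (u : ι → ℝ) {P : Finset ι} {a : ι} (ha : a ∉ P) (m : ℕ) :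
    truncSieve u (insert a P) (m + 1) = truncSieve u P (m + 1) - u a * truncSieve u P m := by
  unfold truncSieve
  rw [Finset.sum_range_succ' _ (m + 1), Finset.sum_range_succ' _ (m + 1), Finset.mul_sum]
  simp only [elemSymm_zero, elemSymm_insert u ha]
  have : ∑ k ∈ Finset.range (m + 1), (-1 : ℝ) ^ (k + 1) * (elemSymm u P (k + 1) + u a * elemSymm u P k)
      = ∑ k ∈ Finset.range (m + 1), (-1 : ℝ) ^ (k + 1) * elemSymm u P (k + 1)
        - ∑ k ∈ Finset.range (m + 1), u a * ((-1 : ℝ) ^ k * elemSymm u P k) := by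
    rw [← Finset.sum_sub_distrib]
    exact Finset.sum_congr rfl fun k _ => by ring
  rw [this]; ring

lemma truncSieve_zero (u : ι → ℝ) (P : Finset ι) : truncSieve u P 0 = 1 := by
  simp [truncSieve, elemSymm_zero]

/-- Bonferroni inequalities in weighted form. -/
lemma truncSieve_bounds {u : ι → ℝ} {P : Finset ι} (h0 : ∀ p ∈ P, 0 ≤ u p)
    (h1 : ∀ p ∈ P, u p ≤ 1) (m : ℕ) :
    0 ≤ (-1) ^ m * (truncSieve u P m - ∏ p ∈ P, (1 - u p)) ∧
      (-1) ^ m * (truncSieve u P m - ∏ p ∈ P, (1 - u p)) ≤ elemSymm u P (m + 1) := by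
  classical
  induction P using Finset.induction_on generalizing m with
  | empty =>
    have : truncSieve u ∅ m = 1 := by
      unfold truncSieve
      rw [Finset.sum_range_succ']
      simp [elemSymm_zero, elemSymm_empty_succ]
    rw [this, elemSymm_empty_succ]
    simp
  | insert a P ha ih =>
    have ih' := ih (fun p hp => h0 p (Finset.mem_insert_of_mem hp))
      (fun p hp => h1 p (Finset.mem_insert_of_mem hp))
    have ha0 := h0 a (Finset.mem_insert_self a P)
    have ha1 := h1 a (Finset.mem_insert_self a P)
    rw [Finset.prod_insert ha, elemSymm_insert u ha]
    cases m with
    | zero =>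
      have h := ih' 0
      simp only [pow_zero, one_mul, truncSieve_zero, zero_add, elemSymm_zero] at h ⊢
      have hP : 0 ≤ ∏ p ∈ P, (1 - u p) := Finset.prod_nonneg fun p hp => by
        have := h1 p (Finset.mem_insert_of_mem hp); linarith
      constructor <;> nlinarith
    | succ m =>
      rw [truncSieve_insert u ha]
      have e1 := ih' (m + 1)
      have e0 := ih' m
      have key : (-1 : ℝ) ^ (m + 1) * (truncSieve u P (m + 1) - u a * truncSieve u P m
          - (1 - u a) * ∏ p ∈ P, (1 - u p))
          = (-1) ^ (m + 1) * (truncSieve u P (m + 1) - ∏ p ∈ P, (1 - u p))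
            + u a * ((-1) ^ m * (truncSieve u P m - ∏ p ∈ P, (1 - u p))) := by
        ring
      rw [key]
      constructor
      · have := mul_nonneg ha0 e0.1; linarith [e1.1]
      · have := mul_le_mul_of_nonneg_left e0.2 ha0; linarith [e1.2]

lemma elemSymm_le_pow_div {u : ι → ℝ} {P : Finset ι} (hu : ∀ p ∈ P, 0 ≤ u p) (k : ℕ) :
    elemSymm u P k ≤ (∑ p ∈ P, u p) ^ k / k.factorial := by
  classical
  induction P using Finset.induction_on generalizing k with
  | empty =>
    cases k with
    | zero => simp [elemSymm_zero]
    | succ k => simp [elemSymm_empty_succ]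
  | insert a P ha ih =>
    have hP : ∀ p ∈ P, 0 ≤ u p := fun p hp => hu p (Finset.mem_insert_of_mem hp)
    have ha0 := hu a (Finset.mem_insert_self a P)
    have hs : 0 ≤ ∑ p ∈ P, u p := Finset.sum_nonneg hP
    cases k with
    | zero => simp [elemSymm_zero]
    | succ k =>
      rw [elemSymm_insert u ha, Finset.sum_insert ha]
      have h1 := ih hP (k + 1)
      have h2 := mul_le_mul_of_nonneg_left (ih hP k) ha0
      have hf : (0 : ℝ) < k.factorial := by positivity
      have h3 : (∑ p ∈ P, u p) ^ (k + 1) + (k + 1) * u a * (∑ p ∈ P, u p) ^ k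
          ≤ (u a + ∑ p ∈ P, u p) ^ (k + 1) := by
        set S := ∑ p ∈ P, u p
        rcases eq_or_lt_of_le hs with h0 | h0
        · rw [← h0]
          cases k with
          | zero => simp
          | succ k => simp; positivity
        · have := one_add_mul_le_pow (a := u a / S) (by have : 0 ≤ u a / S := by positivity
                                                        linarith) (k + 1)
          have e : (u a + S) ^ (k + 1) = S ^ (k + 1) * (1 + u a / S) ^ (k + 1) := by
            rw [← mul_pow]; congr 1; field_simp; ring
          rw [e]
          calc _ = S ^ (k + 1) * (1 + ((k + 1 : ℕ) : ℝ) * (u a / S)) := by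
                push_cast; field_simp; ring
            _ ≤ _ := by gcongr
      calc _ ≤ (∑ p ∈ P, u p) ^ (k + 1) / (k + 1).factorial
            + u a * ((∑ p ∈ P, u p) ^ k / k.factorial) := add_le_add h1 h2
        _ = ((∑ p ∈ P, u p) ^ (k + 1) + (k + 1) * u a * (∑ p ∈ P, u p) ^ k) / (k + 1).factorial := by
          rw [Nat.factorial_succ]; push_cast; field_simp
        _ ≤ _ := by gcongr

end ElemSymm

/-- Telescoping bound for the product of upper sieves. -/
lemma prod_le_prod_add_sum_erase {ι : Type*} [DecidableEq ι] (s : Finset ι) {f σ τ : ι → ℝ}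
    (hf : ∀ i ∈ s, 0 ≤ f i) (hfσ : ∀ i ∈ s, f i ≤ σ i) (hσ : ∀ i ∈ s, σ i ≤ f i + τ i) :
    ∏ i ∈ s, σ i ≤ ∏ i ∈ s, f i + ∑ i ∈ s, τ i * ∏ j ∈ s.erase i, σ j := by
  induction s using Finset.induction_on with
  | empty => simp
  | insert a s ha ih =>
    have ih' := ih (fun i hi => hf i (Finset.mem_insert_of_mem hi))
      (fun i hi => hfσ i (Finset.mem_insert_of_mem hi))
      (fun i hi => hσ i (Finset.mem_insert_of_mem hi))
    have haf := hf a (Finset.mem_insert_self a s)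
    have haσ := hfσ a (Finset.mem_insert_self a s)
    have haτ := hσ a (Finset.mem_insert_self a s)
    rw [Finset.prod_insert ha, Finset.prod_insert ha, Finset.sum_insert ha,
      Finset.erase_insert ha]
    have hsum : ∑ i ∈ s, τ i * ∏ j ∈ (insert a s).erase i, σ j
        = σ a * ∑ i ∈ s, τ i * ∏ j ∈ s.erase i, σ j := by
      rw [Finset.mul_sum]
      refine Finset.sum_congr rfl fun i hi => ?_
      have hia : a ≠ i := fun h => ha (h ▸ hi)
      rw [Finset.erase_insert_of_ne hia, Finset.prod_insert (by simp [ha])]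
      ring
    rw [hsum]
    have hp : ∏ i ∈ s, f i ≤ ∏ i ∈ s, σ i :=
      Finset.prod_le_prod (fun i hi => hf i (Finset.mem_insert_of_mem hi))
        (fun i hi => hfσ i (Finset.mem_insert_of_mem hi))
    have hp0 : 0 ≤ ∏ i ∈ s, f i :=
      Finset.prod_nonneg (fun i hi => hf i (Finset.mem_insert_of_mem hi))
    have h1 := mul_le_mul_of_nonneg_left ih' (haf.trans haσ)
    have h2 : σ a * ∏ i ∈ s, f i ≤ f a * ∏ i ∈ s, f i + τ a * ∏ i ∈ s, σ i := by
      have hτ : 0 ≤ τ a := by linarith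
      nlinarith
    nlinarith

lemma truncSieve_eq_sum_filter {ι : Type*} (u : ι → ℝ) (P : Finset ι) (m : ℕ) :
    truncSieve u P m
      = ∑ D ∈ P.powerset.filter (fun D => D.card ≤ m), (-1) ^ D.card * ∏ p ∈ D, u p := by
  classical
  unfold truncSieve elemSymm
  rw [← Finset.sum_fiberwise_of_maps_to (t := Finset.range (m + 1)) (g := Finset.card)]
  · refine Finset.sum_congr rfl fun k hk => ?_
    rw [Finset.mul_sum]
    refine Finset.sum_congr ?_ fun D hD => ?_
    · ext D
      simp only [Finset.mem_powersetCard, Finset.mem_filter, Finset.mem_powerset]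
      have := Finset.mem_range.1 hk
      constructor
      · rintro ⟨h, rfl⟩; exact ⟨⟨h, by omega⟩, rfl⟩
      · rintro ⟨⟨h, -⟩, h'⟩; exact ⟨h, h'⟩
    · rw [(Finset.mem_filter.1 hD).2]
  · intro D hD
    have := (Finset.mem_filter.1 hD).2
    exact Finset.mem_range.2 (by omega)

/-- Averages of products of polynomials in approximately independent events. -/
lemma abs_average_prod_sub_le {ι Ξ : Type*} [DecidableEq ι] {m : ℕ} (X : Finset Ξ)
    (a : ι → Ξ → ℝ) (g : ι → ℝ) (t : Fin m → Finset (Finset ι)) (c : Fin m → Finset ι → ℝ)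
    (hc : ∀ i, ∀ D ∈ t i, |c i D| ≤ 1) {E : ℝ}
    (hE : ∀ D : Fin m → Finset ι, (∀ i, D i ∈ t i) →
      |(∑ x ∈ X, ∏ i, ∏ p ∈ D i, a p x) / X.card - ∏ i, ∏ p ∈ D i, g p| ≤ E) :
    |(∑ x ∈ X, ∏ i, ∑ D ∈ t i, c i D * ∏ p ∈ D, a p x) / X.card
        - ∏ i, ∑ D ∈ t i, c i D * ∏ p ∈ D, g p| ≤ (∏ i, ((t i).card : ℝ)) * E := by
  simp only [Finset.prod_univ_sum]
  rw [Finset.sum_comm, Finset.sum_div, ← Finset.sum_sub_distrib]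
  refine (Finset.abs_sum_le_sum_abs _ _).trans ?_
  have : ∀ D ∈ Fintype.piFinset t,
      |(∑ x ∈ X, ∏ i, (c i (D i) * ∏ p ∈ D i, a p x)) / X.card
        - ∏ i, (c i (D i) * ∏ p ∈ D i, g p)| ≤ E := by
    intro D hD
    rw [Fintype.mem_piFinset] at hD
    simp only [Finset.prod_mul_distrib, ← Finset.mul_sum]
    rw [mul_div_assoc, ← mul_sub, abs_mul]
    have h1 : |∏ i, c i (D i)| ≤ 1 := by
      rw [Finset.abs_prod]
      exact Finset.prod_le_one (fun _ _ => abs_nonneg _) (fun i _ => hc i _ (hD i))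
    calc _ ≤ 1 * E := mul_le_mul h1 (hE D hD) (abs_nonneg _) zero_le_one
      _ = E := one_mul E
  refine (Finset.sum_le_sum this).trans ?_
  rw [Finset.sum_const, Fintype.card_piFinset, nsmul_eq_mul]
  push_cast
  exact le_rfl

/-- A Brun–Hooley type fundamental lemma for approximately independent weights. -/
lemma brun_hooley {ι Ξ : Type*} [DecidableEq ι] {m : ℕ} (X : Finset Ξ)
    (P : Fin m → Finset ι) (b : Fin m → ℕ)
    (a : ι → Ξ → ℝ) (ha0 : ∀ p x, 0 ≤ a p x) (ha1 : ∀ p x, a p x ≤ 1)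
    (g : ι → ℝ) (hg0 : ∀ i, ∀ p ∈ P i, 0 ≤ g p) (hg1 : ∀ i, ∀ p ∈ P i, g p ≤ 1)
    (θ : Fin m → ℝ) (hθ0 : ∀ i, 0 ≤ θ i)
    (hθ : ∀ i, elemSymm g (P i) (2 * b i + 1) ≤ θ i * ∏ p ∈ P i, (1 - g p))
    {E N : ℝ} (hE0 : 0 ≤ E)
    (hN : ∏ i, (((P i).powerset.filter (fun D => D.card ≤ 2 * b i + 1)).card : ℝ) ≤ N)
    (hE : ∀ D : Fin m → Finset ι, (∀ i, D i ⊆ P i ∧ (D i).card ≤ 2 * b i + 1) →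
      |(∑ x ∈ X, ∏ i, ∏ p ∈ D i, a p x) / X.card - ∏ i, ∏ p ∈ D i, g p| ≤ E) :
    |(∑ x ∈ X, ∏ i, ∏ p ∈ P i, (1 - a p x)) / X.card - ∏ i, ∏ p ∈ P i, (1 - g p)|
      ≤ (∑ i, θ i) * Real.exp (∑ i, θ i) * (∏ i, ∏ p ∈ P i, (1 - g p)) + (m + 1) * (N * E) := by
  classical
  set σ : (ι → ℝ) → Fin m → ℝ := fun u i => truncSieve u (P i) (2 * b i) with hσ
  set τ : (ι → ℝ) → Fin m → ℝ := fun u i => elemSymm u (P i) (2 * b i + 1) with hτ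
  set f : (ι → ℝ) → Fin m → ℝ := fun u i => ∏ p ∈ P i, (1 - u p) with hf
  set T : Fin m → Finset (Finset ι) :=
    fun i => (P i).powerset.filter (fun D => D.card ≤ 2 * b i + 1) with hT
  have basic : ∀ u : ι → ℝ, (∀ i, ∀ p ∈ P i, 0 ≤ u p) → (∀ i, ∀ p ∈ P i, u p ≤ 1) →
      (∀ i, 0 ≤ f u i ∧ f u i ≤ σ u i ∧ σ u i ≤ f u i + τ u i ∧ 0 ≤ τ u i) := by
    intro u h0 h1 i
    have := truncSieve_bounds (h0 i) (h1 i) (2 * b i)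
    rw [pow_mul] at this
    norm_num at this
    refine ⟨Finset.prod_nonneg fun p hp => by linarith [h1 i p hp], this.1, ?_,
      elemSymm_nonneg (h0 i) _⟩
    simp only [hσ, hf, hτ]
    linarith [this.2]
  have bg := basic g hg0 hg1
  have ba := fun x => basic (fun p => a p x) (fun _ p _ => ha0 p x) (fun _ p _ => ha1 p x)
  have approx : ∀ j : Option (Fin m),
      |(∑ x ∈ X, ∏ i, (if j = some i then τ (fun p => a p x) i else σ (fun p => a p x) i)) / X.card
        - ∏ i, (if j = some i then τ g i else σ g i)| ≤ N * E := by
    intro j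
    set t : Fin m → Finset (Finset ι) := fun i => if j = some i then (P i).powersetCard (2 * b i + 1)
      else (P i).powerset.filter (fun D => D.card ≤ 2 * b i) with ht
    set c : Fin m → Finset ι → ℝ := fun i D => if j = some i then 1 else (-1) ^ D.card with hc
    have hsub : ∀ i, t i ⊆ T i := by
      intro i D hD
      simp only [ht, hT] at hD ⊢
      split_ifs at hD with h
      · rw [Finset.mem_powersetCard] at hD
        exact Finset.mem_filter.2 ⟨Finset.mem_powerset.2 hD.1, hD.2.le⟩
      · rw [Finset.mem_filter] at hD
        exact Finset.mem_filter.2 ⟨hD.1, by omega⟩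
    have e : ∀ (u : ι → ℝ) (i : Fin m), (if j = some i then τ u i else σ u i)
        = ∑ D ∈ t i, c i D * ∏ p ∈ D, u p := by
      intro u i
      simp only [ht, hc, hτ, hσ]
      split_ifs with h
      · simp [elemSymm]
      · rw [truncSieve_eq_sum_filter]
    simp only [e]
    have h1 := abs_average_prod_sub_le X a g t c (E := E) (by
      intro i D _
      simp only [hc]
      split_ifs <;> simp) (by
      intro D hD
      refine hE D fun i => ?_
      have := hsub i (hD i)
      simp only [hT, Finset.mem_filter, Finset.mem_powerset] at this
      exact this)
    refine h1.trans ?_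
    refine mul_le_mul_of_nonneg_right (le_trans ?_ hN) hE0
    exact Finset.prod_le_prod (fun _ _ => by positivity)
      (fun i _ => by exact_mod_cast Finset.card_le_card (hsub i))
  have hprodif : ∀ (u : ι → ℝ) (j : Fin m),
      ∏ i, (if some j = some i then τ u i else σ u i) = τ u j * ∏ i ∈ Finset.univ.erase j, σ u i := by
    intro u j
    rw [← Finset.mul_prod_erase Finset.univ _ (Finset.mem_univ j)]
    simp only [if_true]
    congr 1
    refine Finset.prod_congr rfl fun i hi => ?_
    rw [if_neg]
    intro h
    exact (Finset.mem_erase.1 hi).1 (Option.some_injective _ h).symm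
  have tele := fun (u : ι → ℝ) (h : ∀ i, 0 ≤ f u i ∧ f u i ≤ σ u i ∧ σ u i ≤ f u i + τ u i ∧ 0 ≤ τ u i) =>
    prod_le_prod_add_sum_erase (Finset.univ : Finset (Fin m)) (f := f u) (σ := σ u) (τ := τ u)
      (fun i _ => (h i).1) (fun i _ => (h i).2.1) (fun i _ => (h i).2.2.1)
  set F := (∑ x ∈ X, ∏ i, f (fun p => a p x) i) / X.card with hF
  set S := (∑ x ∈ X, ∏ i, σ (fun p => a p x) i) / X.card with hS
  set U := fun j => (∑ x ∈ X, τ (fun p => a p x) j *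
    ∏ i ∈ Finset.univ.erase j, σ (fun p => a p x) i) / X.card with hU
  set v := ∏ i, f g i with hv
  have hFS : F ≤ S := by
    refine div_le_div_of_nonneg_right (Finset.sum_le_sum fun x _ => ?_) (by positivity)
    exact Finset.prod_le_prod (fun i _ => (ba x i).1) (fun i _ => (ba x i).2.1)
  have hSF : S ≤ F + ∑ j, U j := by
    simp only [hS, hF, hU]
    rw [← Finset.sum_div, ← add_div, Finset.sum_comm, ← Finset.sum_add_distrib]
    refine div_le_div_of_nonneg_right (Finset.sum_le_sum fun x _ => ?_) (by positivity)
    exact tele _ (ba x)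
  have hSa : |S - ∏ i, σ g i| ≤ N * E := by simpa using approx none
  have hUa : ∀ j, |U j - τ g j * ∏ i ∈ Finset.univ.erase j, σ g i| ≤ N * E := by
    intro j
    have := approx (some j)
    simp only [hprodif] at this
    exact this
  have hgv : v ≤ ∏ i, σ g i := Finset.prod_le_prod (fun i _ => (bg i).1) (fun i _ => (bg i).2.1)
  have hgt := tele g bg
  have hterm : ∑ j, τ g j * ∏ i ∈ Finset.univ.erase j, σ g i
      ≤ (∑ i, θ i) * Real.exp (∑ i, θ i) * v := by
    rw [Finset.sum_mul, Finset.sum_mul]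
    refine Finset.sum_le_sum fun j _ => ?_
    have h1 : ∏ i ∈ Finset.univ.erase j, σ g i
        ≤ ∏ i ∈ Finset.univ.erase j, (Real.exp (θ i) * f g i) := by
      refine Finset.prod_le_prod (fun i _ => (bg i).1.trans (bg i).2.1) fun i _ => ?_
      have h2 := (bg i).2.2.1
      have h3 := hθ i
      have h4 := Real.add_one_le_exp (θ i)
      have h5 := (bg i).1
      calc σ g i ≤ f g i + θ i * f g i := h2.trans (by simpa [hf, hτ] using h3)
        _ = (θ i + 1) * f g i := by ring
        _ ≤ _ := mul_le_mul_of_nonneg_right h4 h5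
    rw [Finset.prod_mul_distrib, ← Real.exp_sum] at h1
    have h6 : Real.exp (∑ i ∈ Finset.univ.erase j, θ i) ≤ Real.exp (∑ i, θ i) :=
      Real.exp_le_exp.2 (Finset.sum_le_sum_of_subset_of_nonneg (Finset.erase_subset _ _)
        fun i _ _ => hθ0 i)
    have h7 : 0 ≤ ∏ i ∈ Finset.univ.erase j, f g i := Finset.prod_nonneg fun i _ => (bg i).1
    have h8 : v = f g j * ∏ i ∈ Finset.univ.erase j, f g i :=
      (Finset.mul_prod_erase Finset.univ _ (Finset.mem_univ j)).symm
    have hθj : τ g j ≤ θ j * f g j := hθ j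
    calc τ g j * ∏ i ∈ Finset.univ.erase j, σ g i
        ≤ (θ j * f g j) * (Real.exp (∑ i, θ i) * ∏ i ∈ Finset.univ.erase j, f g i) := by
          refine mul_le_mul hθj (h1.trans (mul_le_mul_of_nonneg_right h6 h7)) ?_
            (mul_nonneg (hθ0 j) (bg j).1)
          exact Finset.prod_nonneg fun i _ => (bg i).1.trans (bg i).2.1
      _ = _ := by rw [h8]; ring
  have hUs : ∑ j, U j ≤ ∑ j, τ g j * ∏ i ∈ Finset.univ.erase j, σ g i + m * (N * E) := by
    have : ∀ j ∈ Finset.univ, U j ≤ τ g j * ∏ i ∈ Finset.univ.erase j, σ g i + N * E := by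
      intro j _
      have := (abs_le.1 (hUa j)).2
      linarith
    refine (Finset.sum_le_sum this).trans ?_
    rw [Finset.sum_add_distrib]
    simp
  have hSa' := abs_le.1 hSa
  rw [abs_le]
  have hNE : 0 ≤ N * E := (abs_nonneg _).trans hSa
  have hm : 0 ≤ (m : ℝ) * (N * E) := by positivity
  constructor <;> linarith

section BoxCount

open Classical in
/-- Number of points of the box `[0, H)^I` satisfying `B`. -/
noncomputable def boxCount {I : Type*} [Fintype I] (H : ℕ) (B : (I → ℕ) → Prop) : ℕ :=
  ((Fintype.piFinset fun _ : I => Finset.range H).filter B).card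

/-- `B` depends only on residues modulo `M`. -/
def PeriodicMod {I : Type*} (M : ℕ) (B : (I → ℕ) → Prop) : Prop :=
  ∀ x x' : I → ℕ, (∀ i, x i ≡ x' i [MOD M]) → (B x ↔ B x')

variable {I : Type*} [Fintype I]

lemma boxCount_mul {M N : ℕ} (hMN : M.Coprime N) (hM : 0 < M) (hN : 0 < N)
    {B C : (I → ℕ) → Prop} (hB : PeriodicMod M B) (hC : PeriodicMod N C) :
    boxCount (M * N) (fun x => B x ∧ C x) = boxCount M B * boxCount N C := by
  classical
  unfold boxCount
  rw [← Finset.card_product]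
  refine Finset.card_nbij' (fun x => (fun i => x i % M, fun i => x i % N))
    (fun y i => (Nat.chineseRemainder hMN (y.1 i) (y.2 i) : ℕ)) ?_ ?_ ?_ ?_
  · intro x hx
    simp only [Finset.coe_filter, Fintype.mem_piFinset, Finset.mem_range, Set.mem_ofPred_eq] at hx
    simp only [Finset.coe_product, Set.mem_prod, Finset.coe_filter, Fintype.mem_piFinset,
      Finset.mem_range, Set.mem_ofPred_eq]
    exact ⟨⟨fun i => Nat.mod_lt _ hM, (hB _ x fun i => Nat.mod_modEq _ _).2 hx.2.1⟩,
      ⟨fun i => Nat.mod_lt _ hN, (hC _ x fun i => Nat.mod_modEq _ _).2 hx.2.2⟩⟩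
  · intro y hy
    simp only [Finset.coe_product, Set.mem_prod, Finset.coe_filter, Fintype.mem_piFinset,
      Finset.mem_range, Set.mem_ofPred_eq] at hy
    simp only [Finset.coe_filter, Fintype.mem_piFinset, Finset.mem_range, Set.mem_ofPred_eq]
    exact ⟨fun i => Nat.chineseRemainder_lt_mul hMN _ _ hM.ne' hN.ne',
      (hB _ y.1 fun i => (Nat.chineseRemainder hMN (y.1 i) (y.2 i)).2.1).2 hy.1.2,
      (hC _ y.2 fun i => (Nat.chineseRemainder hMN (y.1 i) (y.2 i)).2.2).2 hy.2.2⟩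
  · intro x hx
    simp only [Finset.coe_filter, Fintype.mem_piFinset, Finset.mem_range, Set.mem_ofPred_eq] at hx
    funext i
    have h := (Nat.chineseRemainder hMN (x i % M) (x i % N)).2
    have h1 : (Nat.chineseRemainder hMN (x i % M) (x i % N) : ℕ) ≡ x i [MOD M * N] :=
      (Nat.modEq_and_modEq_iff_modEq_mul hMN).1
        ⟨h.1.trans (Nat.mod_modEq _ _), h.2.trans (Nat.mod_modEq _ _)⟩
    exact Nat.ModEq.eq_of_lt_of_lt h1 (Nat.chineseRemainder_lt_mul hMN _ _ hM.ne' hN.ne') (hx.1 i)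
  · intro y hy
    simp only [Finset.coe_product, Set.mem_prod, Finset.coe_filter, Fintype.mem_piFinset,
      Finset.mem_range, Set.mem_ofPred_eq] at hy
    refine Prod.ext (funext fun i => ?_) (funext fun i => ?_)
    · have h := (Nat.chineseRemainder hMN (y.1 i) (y.2 i)).2.1
      exact Eq.trans h (Nat.mod_eq_of_lt (hy.1.1 i))
    · have h := (Nat.chineseRemainder hMN (y.1 i) (y.2 i)).2.2
      exact Eq.trans h (Nat.mod_eq_of_lt (hy.2.1 i))

lemma boxCount_prod (D : Finset ℕ) (hD : ∀ p ∈ D, p.Prime) {B : ℕ → (I → ℕ) → Prop}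
    (hB : ∀ p ∈ D, PeriodicMod p (B p)) :
    boxCount (∏ p ∈ D, p) (fun x => ∀ p ∈ D, B p x) = ∏ p ∈ D, boxCount p (B p) ∧
      PeriodicMod (∏ p ∈ D, p) (fun x => ∀ p ∈ D, B p x) := by
  classical
  induction D using Finset.induction_on with
  | empty =>
    refine ⟨?_, fun x x' _ => by simp⟩
    simp [boxCount]
  | insert a D ha ih =>
    have ih' := ih (fun p hp => hD p (Finset.mem_insert_of_mem hp))
      (fun p hp => hB p (Finset.mem_insert_of_mem hp))
    have hap := hD a (Finset.mem_insert_self a D)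
    have hpos : 0 < ∏ p ∈ D, p :=
      Finset.prod_pos fun p hp => (hD p (Finset.mem_insert_of_mem hp)).pos
    have hcop : a.Coprime (∏ p ∈ D, p) := Nat.Coprime.prod_right fun p hp =>
      (Nat.coprime_primes hap (hD p (Finset.mem_insert_of_mem hp))).2 fun h => ha (h ▸ hp)
    have hBa := hB a (Finset.mem_insert_self a D)
    rw [Finset.prod_insert ha, Finset.prod_insert ha]
    simp only [Finset.forall_mem_insert]
    refine ⟨?_, fun x x' h => and_congr (hBa x x' fun i => (h i).of_mul_right _)
      (ih'.2 x x' fun i => (h i).of_mul_left _)⟩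
    rw [boxCount_mul hcop hap.pos hpos hBa ih'.2, ih'.1]

lemma card_filter_range_mod {M : ℕ} (hM : 0 < M) (H v : ℕ) :
    |(((Finset.range H).filter fun k => k % M = v % M).card : ℝ) - H / M| ≤ 1 := by
  have h := Nat.count_modEq_card H hM v
  rw [Nat.count_eq_card_filter_range] at h
  have h' : ((Finset.range H).filter fun k => k % M = v % M)
      = ((Finset.range H).filter fun k => k ≡ v [MOD M]) := rfl
  have e : (H : ℝ) = M * (H / M : ℕ) + (H % M : ℕ) := by exact_mod_cast (Nat.div_add_mod H M).symm
  have hlt : ((H % M : ℕ) : ℝ) < M := by exact_mod_cast Nat.mod_lt H hM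
  have hM' : (0 : ℝ) < M := by exact_mod_cast hM
  have e2 : (H : ℝ) / M = (H / M : ℕ) + ((H % M : ℕ) : ℝ) / M := by
    field_simp
    linarith
  have h3 : 0 ≤ ((H % M : ℕ) : ℝ) / M := by positivity
  have h4 : ((H % M : ℕ) : ℝ) / M ≤ 1 := by rw [div_le_one hM']; exact hlt.le
  rw [h', h, e2, abs_le]
  split_ifs <;> constructor <;> push_cast <;> linarith

open Classical in
lemma boxCount_eq_sum_fibers {M : ℕ} (hM : 0 < M) (H : ℕ) {B : (I → ℕ) → Prop}
    (hB : PeriodicMod M B) :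
    boxCount H B = ∑ y ∈ (Fintype.piFinset fun _ : I => Finset.range M).filter B,
      ∏ i, ((Finset.range H).filter fun k => k % M = y i % M).card := by
  have h1 := Finset.card_eq_sum_card_fiberwise
    (s := (Fintype.piFinset fun _ : I => Finset.range H).filter B)
    (t := (Fintype.piFinset fun _ : I => Finset.range M).filter B) (f := fun x i => x i % M) (by
      intro x hx
      simp only [Finset.coe_filter, Fintype.mem_piFinset, Finset.mem_range, Set.mem_ofPred_eq] at hx
      rw [Finset.mem_coe, Finset.mem_filter, Fintype.mem_piFinset]
      exact ⟨fun i => Finset.mem_range.2 (Nat.mod_lt _ hM),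
        (hB _ x fun i => Nat.mod_modEq _ _).2 hx.2⟩)
  unfold boxCount
  rw [h1]
  refine Finset.sum_congr rfl fun y hy => ?_
  rw [← Fintype.card_piFinset]
  congr 1
  simp only [Finset.mem_filter, Fintype.mem_piFinset, Finset.mem_range] at hy
  ext x
  simp only [Finset.mem_filter, Fintype.mem_piFinset, Finset.mem_range]
  constructor
  · rintro ⟨⟨h1, -⟩, rfl⟩
    exact fun i => ⟨h1 i, (Nat.mod_mod _ _).symm⟩
  · intro h
    have hxy : ∀ i, x i % M = y i := fun i => (h i).2.trans (Nat.mod_eq_of_lt (hy.1 i))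
    exact ⟨⟨fun i => (h i).1, (hB x y fun i => (h i).2).2 hy.2⟩, funext hxy⟩

lemma boxCount_approx {M H : ℕ} (hM : 0 < M) (hMH : M ≤ H) {B : (I → ℕ) → Prop}
    (hB : PeriodicMod M B) :
    |(boxCount H B : ℝ) / (H : ℝ) ^ Fintype.card I - boxCount M B / (M : ℝ) ^ Fintype.card I|
      ≤ 2 ^ Fintype.card I * (M / H) := by
  classical
  set n := Fintype.card I
  set Z := (Fintype.piFinset fun _ : I => Finset.range M).filter B with hZ
  have hM' : (0 : ℝ) < M := by exact_mod_cast hM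
  have hH' : (0 : ℝ) < H := by exact_mod_cast hM.trans_le hMH
  have hfib : (boxCount H B : ℝ)
      = ∑ y ∈ Z, ∏ i, (((Finset.range H).filter fun k => k % M = y i % M).card : ℝ) := by
    rw [boxCount_eq_sum_fibers hM H hB]
    push_cast
    rfl
  have hcardZ : (Z.card : ℝ) ≤ (M : ℝ) ^ n := by
    have : Z.card ≤ M ^ n := by
      refine (Finset.card_filter_le _ _).trans ?_
      rw [Fintype.card_piFinset]
      simp [n]
    exact_mod_cast this
  set r : ℝ := M / H with hr
  have hr0 : 0 ≤ r := by positivity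
  have hr1 : r ≤ 1 := by rw [hr, div_le_one hH']; exact_mod_cast hMH
  have hHM : (H : ℝ) / M * r = 1 := by rw [hr]; field_simp
  have hup : (boxCount H B : ℝ) ≤ Z.card * ((H : ℝ) / M) ^ n * (1 + r) ^ n := by
    rw [hfib, mul_assoc, ← mul_pow, ← nsmul_eq_mul]
    refine Finset.sum_le_card_nsmul _ _ _ fun y _ => ?_
    rw [show n = (Finset.univ : Finset I).card from rfl, ← Finset.prod_const]
    refine Finset.prod_le_prod (fun _ _ => by positivity) fun i _ => ?_
    have := (abs_le.1 (card_filter_range_mod hM H (y i))).2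
    linarith
  have hlo : Z.card * ((H : ℝ) / M) ^ n * (1 - r) ^ n ≤ (boxCount H B : ℝ) := by
    rw [hfib, mul_assoc, ← mul_pow, ← nsmul_eq_mul]
    refine Finset.card_nsmul_le_sum _ _ _ fun y _ => ?_
    rw [show n = (Finset.univ : Finset I).card from rfl, ← Finset.prod_const]
    have h0 : 0 ≤ (H : ℝ) / M * (1 - r) := mul_nonneg (by positivity) (by linarith)
    refine Finset.prod_le_prod (fun _ _ => h0) fun i _ => ?_
    have := (abs_le.1 (card_filter_range_mod hM H (y i))).1
    linarith
  have hpow : (1 + r) ^ n ≤ 1 + 2 ^ n * r := by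
    have : ∀ k : ℕ, (1 + r) ^ k ≤ 1 + (2 ^ k - 1) * r := by
      intro k
      induction k with
      | zero => simp
      | succ k ih =>
        have h2 : (1 : ℝ) ≤ 2 ^ k := one_le_pow₀ (by norm_num)
        rw [pow_succ, pow_succ]
        nlinarith [mul_nonneg hr0 (sub_nonneg.2 hr1), mul_nonneg (sub_nonneg.2 h2)
          (mul_nonneg hr0 (sub_nonneg.2 hr1))]
    nlinarith [this n]
  have hpow2 : 1 - 2 ^ n * r ≤ (1 - r) ^ n := by
    have h1 := one_add_mul_le_pow (a := -r) (by linarith) n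
    have h2 : (n : ℝ) ≤ 2 ^ n := by exact_mod_cast Nat.lt_two_pow_self.le
    have : (1 - r) ^ n = (1 + -r) ^ n := by ring
    rw [this]
    nlinarith
  have hZM : (boxCount M B : ℝ) = Z.card := by rw [hZ]; unfold boxCount; rfl
  rw [hZM]
  have hq0 : 0 ≤ (Z.card : ℝ) / (M : ℝ) ^ n := by positivity
  have hq1 : (Z.card : ℝ) / (M : ℝ) ^ n ≤ 1 := by rw [div_le_one (by positivity)]; exact hcardZ
  have hHn : (0 : ℝ) < (H : ℝ) ^ n := by positivity
  have e1 : Z.card * ((H : ℝ) / M) ^ n = (Z.card : ℝ) / (M : ℝ) ^ n * (H : ℝ) ^ n := by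
    rw [div_pow]; ring
  rw [e1] at hup hlo
  have hup' : (boxCount H B : ℝ) / (H : ℝ) ^ n ≤ (Z.card : ℝ) / (M : ℝ) ^ n * (1 + r) ^ n := by
    rw [div_le_iff₀ hHn]; linarith
  have hlo' : (Z.card : ℝ) / (M : ℝ) ^ n * (1 - r) ^ n ≤ (boxCount H B : ℝ) / (H : ℝ) ^ n := by
    rw [le_div_iff₀ hHn]; linarith
  have h5 : 0 ≤ 2 ^ n * r := by positivity
  rw [abs_le]
  constructor <;> nlinarith
end BoxCount

section CubeForms

open Classical in
lemma boxCount_eq_card_zmod {I : Type*} [Fintype I] {p : ℕ} [NeZero p] (C : (I → ZMod p) → Prop) :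
    boxCount p (fun x : I → ℕ => C fun i => (x i : ZMod p)) = (Finset.univ.filter C).card := by
  unfold boxCount
  refine Finset.card_nbij' (fun x i => (x i : ZMod p)) (fun y i => (y i).val) ?_ ?_ ?_ ?_
  · intro x hx
    simp only [Finset.coe_filter, Set.mem_ofPred_eq] at hx
    simp [hx.2]
  · intro y hy
    simp only [Finset.coe_filter, Finset.mem_univ, true_and, Set.mem_ofPred_eq] at hy
    simp only [Finset.coe_filter, Fintype.mem_piFinset, Finset.mem_range, Set.mem_ofPred_eq]
    refine ⟨fun i => ZMod.val_lt _, ?_⟩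
    simpa using hy
  · intro x hx
    simp only [Finset.coe_filter, Fintype.mem_piFinset, Finset.mem_range, Set.mem_ofPred_eq] at hx
    funext i
    exact ZMod.val_cast_of_lt (hx.1 i)
  · intro y _
    funext i
    simp

open Classical in
lemma card_fiber_mul_card {G K : Type*} [AddCommGroup G] [AddCommGroup K] [Fintype G] [Fintype K]
    (f : G → K) (hf : ∀ k, ∃ t, ∀ y, f (y + t) = f y + k) :
    (Finset.univ.filter fun y => f y = 0).card * Fintype.card K = Fintype.card G := by
  have h := Finset.card_eq_sum_card_fiberwise (s := (Finset.univ : Finset G))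
    (t := (Finset.univ : Finset K)) (f := f) (by intro x _; simp)
  have h2 : ∀ k ∈ (Finset.univ : Finset K), (Finset.univ.filter fun y => f y = k).card
      = (Finset.univ.filter fun y => f y = 0).card := by
    intro k _
    obtain ⟨t, ht⟩ := hf k
    symm
    refine Finset.card_bij (fun y _ => y + t) ?_ ?_ ?_
    · intro y hy
      simp only [Finset.mem_filter, Finset.mem_univ, true_and] at hy ⊢
      rw [ht, hy, zero_add]
    · intro y _ y' _ h
      exact add_right_cancel h
    · intro z hz
      simp only [Finset.mem_filter, Finset.mem_univ, true_and] at hz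
      refine ⟨z - t, ?_, sub_add_cancel z t⟩
      simp only [Finset.mem_filter, Finset.mem_univ, true_and]
      have := ht (z - t)
      rw [sub_add_cancel, hz] at this
      simpa using this.symm
  rw [Finset.sum_congr rfl h2, Finset.sum_const, smul_eq_mul] at h
  rw [← Finset.card_univ (α := G), h, Finset.card_univ, mul_comm]

/-- The linear form on the cube attached to a vertex `ω`. -/
def cubeForm {s : ℕ} {R : Type*} [AddCommMonoid R] (ω : Fin s → Bool) (x : Fin s × Bool → R) : R :=
  ∑ i, x (i, ω i)

/-- Some vertex in `S` of the cube based at `n`, with steps multiplied by `W`, is divisible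
by `p`. -/
def cubeDvd {s : ℕ} (n W : ℕ) (S : Finset (Fin s → Bool)) (p : ℕ) (x : Fin s × Bool → ℕ) : Prop :=
  ∃ ω ∈ S, p ∣ n + W * cubeForm ω x

lemma periodicMod_cubeDvd {s : ℕ} (n W : ℕ) (S : Finset (Fin s → Bool)) (p : ℕ) :
    PeriodicMod p (cubeDvd n W S p) := by
  intro x x' h
  unfold cubeDvd
  refine exists_congr fun ω => and_congr Iff.rfl ?_
  have h1 : n + W * cubeForm ω x ≡ n + W * cubeForm ω x' [MOD p] := by
    refine Nat.ModEq.add_left _ (Nat.ModEq.mul_left _ ?_)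
    unfold cubeForm
    exact Nat.ModEq.sum fun i _ => h (i, ω i)
  exact h1.dvd_iff dvd_rfl

lemma cubeForm_add {s : ℕ} {R : Type*} [AddCommMonoid R] (ω : Fin s → Bool)
    (x y : Fin s × Bool → R) : cubeForm ω (x + y) = cubeForm ω x + cubeForm ω y := by
  simp [cubeForm, Finset.sum_add_distrib]

lemma cubeForm_single {s : ℕ} {R : Type*} [AddCommMonoid R] (ω : Fin s → Bool) (i : Fin s) (b : Bool)
    (c : R) : cubeForm ω (Pi.single (i, b) c) = if ω i = b then c else 0 := by
  unfold cubeForm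
  rw [Finset.sum_eq_single i]
  · by_cases h : ω i = b
    · simp [h]
    · rw [if_neg h, Pi.single_eq_of_ne]
      exact fun h' => h (Prod.ext_iff.1 h').2
  · intro j _ hj
    rw [Pi.single_eq_of_ne]
    exact fun h' => hj (Prod.ext_iff.1 h').1
  · simp

variable {s p : ℕ} [Fact p.Prime]

open Classical in
lemma card_cube_zero (hs : 0 < s) {n W : ZMod p} (hW : W ≠ 0) (ω : Fin s → Bool) :
    ((Finset.univ.filter fun y : Fin s × Bool → ZMod p => n + W * cubeForm ω y = 0).card : ℝ)
      = (p : ℝ) ^ Fintype.card (Fin s × Bool) * (1 / p) := by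
  have h := card_fiber_mul_card (fun y : Fin s × Bool → ZMod p => n + W * cubeForm ω y) (by
    intro k
    refine ⟨Pi.single (⟨0, hs⟩, ω ⟨0, hs⟩) (W⁻¹ * k), fun y => ?_⟩
    rw [cubeForm_add, cubeForm_single, if_pos rfl]
    field_simp
    ring)
  have hp : (0 : ℝ) < p := by exact_mod_cast (Fact.out : p.Prime).pos
  rw [ZMod.card, Fintype.card_fun, ZMod.card] at h
  field_simp
  exact_mod_cast h

open Classical in
lemma card_cube_zero_pair {n W : ZMod p} (hW : W ≠ 0) {ω ω' : Fin s → Bool} (hω : ω ≠ ω') :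
    ((Finset.univ.filter fun y : Fin s × Bool → ZMod p =>
      n + W * cubeForm ω y = 0 ∧ n + W * cubeForm ω' y = 0).card : ℝ)
      = (p : ℝ) ^ Fintype.card (Fin s × Bool) * (1 / p ^ 2) := by
  obtain ⟨i, hi⟩ := Function.ne_iff.1 hω
  have h := card_fiber_mul_card (fun y : Fin s × Bool → ZMod p =>
    (n + W * cubeForm ω y, n + W * cubeForm ω' y)) (by
    rintro ⟨k, l⟩
    refine ⟨Pi.single (i, ω i) (W⁻¹ * k) + Pi.single (i, ω' i) (W⁻¹ * l), fun y => ?_⟩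
    simp only [cubeForm_add, cubeForm_single, if_true, if_neg hi, if_neg (Ne.symm hi)]
    simp only [Prod.mk_add_mk, Prod.mk.injEq]
    constructor <;> field_simp <;> ring)
  have hp : (0 : ℝ) < p := by exact_mod_cast (Fact.out : p.Prime).pos
  rw [Fintype.card_prod, ZMod.card, Fintype.card_fun, ZMod.card] at h
  have e0 : ∀ a b : ZMod p, (a, b) = (0 : ZMod p × ZMod p) ↔ a = 0 ∧ b = 0 := fun a b => Prod.mk_eq_zero
  simp only [e0] at h
  field_simp
  rw [sq]
  exact_mod_cast h

/-- Local density of `cubeDvd` at a prime. -/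
noncomputable def cubeDensity {s : ℕ} (n W : ℕ) (S : Finset (Fin s → Bool)) (p : ℕ) : ℝ :=
  boxCount p (cubeDvd n W S p) / (p : ℝ) ^ Fintype.card (Fin s × Bool)

lemma cubeDensity_bounds (hs : 0 < s) {n W : ℕ} (hW : ¬ p ∣ W) (S : Finset (Fin s → Bool)) :
    (S.card : ℝ) / p - (S.card : ℝ) ^ 2 / p ^ 2 ≤ cubeDensity n W S p ∧
      cubeDensity n W S p ≤ (S.card : ℝ) / p := by
  classical
  have hp : (0 : ℝ) < p := by exact_mod_cast (Fact.out : p.Prime).pos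
  have hW' : (W : ZMod p) ≠ 0 := fun h => hW ((ZMod.natCast_eq_zero_iff W p).1 h)
  set Q : (Fin s → Bool) → (Fin s × Bool → ZMod p) → Prop :=
    fun ω y => (n : ZMod p) + W * cubeForm ω y = 0 with hQ
  have hcount : boxCount p (cubeDvd n W S p) = (Finset.univ.filter fun y => ∃ ω ∈ S, Q ω y).card := by
    have h0 := boxCount_eq_card_zmod (fun y => ∃ ω ∈ S, Q ω y)
    refine Eq.trans ?_ (h0.trans (by congr!))
    congr 1
    funext x
    unfold cubeDvd
    refine propext (exists_congr fun ω => and_congr Iff.rfl ?_)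
    rw [← ZMod.natCast_eq_zero_iff]
    simp [hQ, cubeForm]
  have hone : ∀ ω, ∑ y, (if Q ω y then (1 : ℝ) else 0)
      = (p : ℝ) ^ Fintype.card (Fin s × Bool) * (1 / p) := by
    intro ω
    rw [Finset.sum_boole]
    exact card_cube_zero hs hW' ω
  have htwo : ∀ ω ω', ω ≠ ω' → ∑ y, (if Q ω y ∧ Q ω' y then (1 : ℝ) else 0)
      = (p : ℝ) ^ Fintype.card (Fin s × Bool) * (1 / p ^ 2) := by
    intro ω ω' h
    rw [Finset.sum_boole]
    exact card_cube_zero_pair hW' h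
  have hc : (boxCount p (cubeDvd n W S p) : ℝ) = ∑ y, if ∃ ω ∈ S, Q ω y then (1 : ℝ) else 0 := by
    rw [hcount, Finset.sum_boole]
  have hpn : (0 : ℝ) < (p : ℝ) ^ Fintype.card (Fin s × Bool) := by positivity
  unfold cubeDensity
  rw [le_div_iff₀ hpn, div_le_iff₀ hpn, hc]
  constructor
  · have key : ∑ y, (∑ ω ∈ S, (if Q ω y then (1 : ℝ) else 0)
        - ∑ q ∈ S.offDiag, if Q q.1 y ∧ Q q.2 y then (1 : ℝ) else 0)
        ≤ ∑ y, if ∃ ω ∈ S, Q ω y then (1 : ℝ) else 0 := by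
      refine Finset.sum_le_sum fun y _ => ?_
      have h1 : ∑ ω ∈ S, (if Q ω y then (1 : ℝ) else 0) = (S.filter fun ω => Q ω y).card := by
        rw [Finset.sum_boole]
      have h2 : ∑ q ∈ S.offDiag, (if Q q.1 y ∧ Q q.2 y then (1 : ℝ) else 0)
          = ((S.filter fun ω => Q ω y).offDiag.card : ℝ) := by
        rw [Finset.sum_boole]
        congr 2
        ext q
        simp only [Finset.mem_filter, Finset.mem_offDiag]
        tauto
      rw [h1, h2, Finset.offDiag_card]
      set k := (S.filter fun ω => Q ω y).card with hk
      rw [Nat.cast_sub (Nat.le_mul_self k)]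
      push_cast
      rcases Nat.eq_zero_or_pos k with h0 | h0
      · rw [h0]; split_ifs <;> simp
      · have hex : ∃ ω ∈ S, Q ω y := by
          obtain ⟨ω, hω⟩ := Finset.card_pos.1 h0
          exact ⟨ω, (Finset.mem_filter.1 hω).1, (Finset.mem_filter.1 hω).2⟩
        rw [if_pos hex]
        nlinarith [sq_nonneg ((k : ℝ) - 1)]
    refine le_trans ?_ key
    rw [Finset.sum_sub_distrib, Finset.sum_comm, Finset.sum_comm (t := S.offDiag)]
    simp only [hone, Finset.sum_const]
    rw [Finset.sum_congr rfl (fun q hq => htwo q.1 q.2 (Finset.mem_offDiag.1 hq).2.2)]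
    simp only [Finset.sum_const, nsmul_eq_mul]
    have h3 : (S.offDiag.card : ℝ) ≤ (S.card : ℝ) ^ 2 := by
      rw [Finset.offDiag_card, sq]
      exact_mod_cast Nat.sub_le _ _
    have h4 := mul_le_mul_of_nonneg_right h3
      (show 0 ≤ (p : ℝ) ^ Fintype.card (Fin s × Bool) * (1 / p ^ 2) by positivity)
    have e : ((S.card : ℝ) / p - (S.card : ℝ) ^ 2 / p ^ 2) * (p : ℝ) ^ Fintype.card (Fin s × Bool)
      = S.card * ((p : ℝ) ^ Fintype.card (Fin s × Bool) * (1 / p))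
        - (S.card : ℝ) ^ 2 * ((p : ℝ) ^ Fintype.card (Fin s × Bool) * (1 / p ^ 2)) := by ring
    rw [e]
    linarith
  · have key : ∑ y, (if ∃ ω ∈ S, Q ω y then (1 : ℝ) else 0)
        ≤ ∑ y, ∑ ω ∈ S, (if Q ω y then (1 : ℝ) else 0) := by
      refine Finset.sum_le_sum fun y _ => ?_
      split_ifs with h
      · obtain ⟨ω, hω, hQω⟩ := h
        calc (1 : ℝ) = if Q ω y then (1 : ℝ) else 0 := by rw [if_pos hQω]
          _ ≤ _ := Finset.single_le_sum (f := fun ω => if Q ω y then (1 : ℝ) else 0)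
            (fun _ _ => by split_ifs <;> simp) hω
      · exact Finset.sum_nonneg fun _ _ => by split_ifs <;> simp
    refine key.trans ?_
    rw [Finset.sum_comm]
    simp only [hone, Finset.sum_const, nsmul_eq_mul]
    apply le_of_eq
    ring

end CubeForms

/-- The Mertens product over the primes up to `z`. -/
noncomputable def mertensProd (z : ℕ) : ℝ := ∏ p ∈ (z + 1).primesBelow, (1 - (p : ℝ)⁻¹)

/-- The primes `p` with `2 ^ 2 ^ i < p ≤ 2 ^ 2 ^ (i + 1)`. -/
def primeBlock (i : ℕ) : Finset ℕ := (Finset.Ioc (2 ^ 2 ^ i) (2 ^ 2 ^ (i + 1))).filter Nat.Prime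

section PrimeSums

lemma inv_prime_le_half {p : ℕ} (hp : p.Prime) : (p : ℝ)⁻¹ ≤ 1 / 2 := by
  rw [inv_eq_one_div]
  exact one_div_le_one_div_of_le (by norm_num) (by exact_mod_cast hp.two_le)

lemma mertensProd_pos (z : ℕ) : 0 < mertensProd z :=
  Finset.prod_pos fun p hp => by
    have := inv_prime_le_half (Nat.prime_of_mem_primesBelow hp); linarith

lemma mertensProd_le_one (z : ℕ) : mertensProd z ≤ 1 :=
  Finset.prod_le_one (fun p hp => by
    have := inv_prime_le_half (Nat.prime_of_mem_primesBelow hp); linarith) fun p _ => by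
    have : (0 : ℝ) ≤ (p : ℝ)⁻¹ := by positivity
    linarith

lemma one_div_le_mertensProd {z : ℕ} (hz : 1 ≤ z) : 1 / (z : ℝ) ≤ mertensProd z := by
  induction z, hz using Nat.le_induction with
  | base => simp [mertensProd, Nat.primesBelow_succ, Nat.not_prime_one, Nat.not_prime_zero]
  | succ n hn ih =>
    have hn' : (0 : ℝ) < n := by exact_mod_cast hn
    unfold mertensProd at ih ⊢
    rw [Nat.primesBelow_succ]
    have e : 1 / ((n + 1 : ℕ) : ℝ) = (1 - ((n + 1 : ℕ) : ℝ)⁻¹) * (1 / n) := by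
      push_cast; field_simp; ring
    have h1 : (0 : ℝ) ≤ 1 - ((n + 1 : ℕ) : ℝ)⁻¹ := by
      rw [sub_nonneg]
      exact inv_le_one_of_one_le₀ (by push_cast; linarith)
    split_ifs with h
    · rw [Finset.prod_insert fun h => lt_irrefl _ (Nat.lt_of_mem_primesBelow h), e]
      exact mul_le_mul_of_nonneg_left ih h1
    · refine le_trans ?_ ih
      exact one_div_le_one_div_of_le hn' (by push_cast; linarith)

lemma mertensProd_mul_log_le (z : ℕ) : mertensProd z * Real.log (z + 1) ≤ 1 := by
  let f : ℕ →* ℝ :=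
    { toFun := fun n => (n : ℝ)⁻¹
      map_one' := by simp
      map_mul' := fun a b => by push_cast; rw [mul_inv] }
  have h := EulerProduct.summable_and_hasSum_smoothNumbers_prod_primesBelow_geometric (f := f)
    (by
      intro p hp
      have h1 := inv_prime_le_half hp
      have h2 : (0 : ℝ) ≤ (p : ℝ)⁻¹ := by positivity
      change ‖(p : ℝ)⁻¹‖ < 1
      rw [Real.norm_of_nonneg h2]
      linarith) (z + 1)
  have hS := h.2
  change HasSum (fun m : (z + 1).smoothNumbers => ((m : ℕ) : ℝ)⁻¹)
    (∏ p ∈ (z + 1).primesBelow, (1 - (p : ℝ)⁻¹)⁻¹) at hS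
  rw [Finset.prod_inv_distrib] at hS
  let e : {n // n ∈ Finset.Icc 1 z} ↪ (z + 1).smoothNumbers :=
    ⟨fun n => ⟨n.1, Nat.mem_smoothNumbers_of_lt (by have := Finset.mem_Icc.1 n.2; omega)
      (by have := Finset.mem_Icc.1 n.2; omega)⟩, fun a b hab => by
        exact Subtype.ext (congrArg (fun t : (z + 1).smoothNumbers => (t : ℕ)) hab)⟩
  have h1 : ∑ n ∈ Finset.Icc 1 z, (n : ℝ)⁻¹ ≤ (mertensProd z)⁻¹ := by
    have h2 := sum_le_hasSum (Finset.univ.map e) (fun i _ => by positivity) hS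
    rw [Finset.sum_map] at h2
    refine le_trans (le_of_eq ?_) h2
    rw [Finset.univ_eq_attach, ← Finset.sum_attach]
    rfl
  have h2 := log_add_one_le_harmonic z
  rw [harmonic_eq_sum_Icc] at h2
  push_cast at h2
  have h3 := h2.trans h1
  have h4 := mertensProd_pos z
  calc _ ≤ mertensProd z * (mertensProd z)⁻¹ := mul_le_mul_of_nonneg_left h3 h4.le
    _ = 1 := mul_inv_cancel₀ h4.ne'

lemma sum_inv_primes_Ioc_two_pow_succ {j : ℕ} (hj : 1 ≤ j) :
    ∑ p ∈ (Finset.Ioc (2 ^ j) (2 ^ (j + 1))).filter Nat.Prime, (p : ℝ)⁻¹ ≤ 4 / j := by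
  have hj' : (0 : ℝ) < j := by exact_mod_cast hj
  have hlog : 0 < Real.log 2 := Real.log_pos (by norm_num)
  have hth := Chebyshev.theta_le_log4_mul_x (x := ((2 ^ (j + 1) : ℕ) : ℝ)) (by positivity)
  unfold Chebyshev.theta at hth
  rw [Nat.floor_natCast] at hth
  have h1 : ∑ p ∈ (Finset.Ioc (2 ^ j) (2 ^ (j + 1))).filter Nat.Prime, (j * Real.log 2)
      ≤ Real.log 4 * ((2 ^ (j + 1) : ℕ) : ℝ) := by
    refine le_trans ?_ hth
    refine le_trans (Finset.sum_le_sum (g := fun p : ℕ => Real.log p) fun p hp => ?_)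
      (Finset.sum_le_sum_of_subset_of_nonneg
        (Finset.filter_subset_filter _ (Finset.Ioc_subset_Ioc_left (by positivity))) ?_)
    · rw [← Real.log_pow]
      refine Real.log_le_log (by positivity) ?_
      have := (Finset.mem_Ioc.1 (Finset.mem_filter.1 hp).1).1
      exact_mod_cast this.le
    · intro p _ _
      exact Real.log_natCast_nonneg p
  have h4 : Real.log 4 = 2 * Real.log 2 := by
    rw [show (4 : ℝ) = 2 ^ 2 by norm_num, Real.log_pow]; norm_num
  rw [Finset.sum_const, nsmul_eq_mul, h4] at h1
  set c := (((Finset.Ioc (2 ^ j) (2 ^ (j + 1))).filter Nat.Prime).card : ℝ)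
  have h5 : c * j ≤ 4 * 2 ^ j := by
    have : (c * j) * Real.log 2 ≤ (4 * 2 ^ j) * Real.log 2 := by
      calc _ = c * (j * Real.log 2) := by ring
        _ ≤ _ := h1
        _ = _ := by push_cast; ring
    exact le_of_mul_le_mul_right this hlog
  have h6 : ∑ p ∈ (Finset.Ioc (2 ^ j) (2 ^ (j + 1))).filter Nat.Prime, (p : ℝ)⁻¹
      ≤ c * ((2 : ℝ) ^ j)⁻¹ := by
    rw [← nsmul_eq_mul]
    refine Finset.sum_le_card_nsmul _ _ _ fun p hp => ?_
    have := (Finset.mem_Ioc.1 (Finset.mem_filter.1 hp).1).1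
    exact inv_anti₀ (by positivity) (by exact_mod_cast this.le)
  refine h6.trans ?_
  rw [le_div_iff₀ hj', ← div_eq_mul_inv, div_mul_eq_mul_div, div_le_iff₀ (by positivity)]
  exact h5

lemma sum_inv_primes_Ioc_two_pow {a : ℕ} (ha : 1 ≤ a) (k : ℕ) :
    ∑ p ∈ (Finset.Ioc (2 ^ a) (2 ^ (a + k))).filter Nat.Prime, (p : ℝ)⁻¹ ≤ k * (4 / a) := by
  induction k with
  | zero => simp
  | succ k ih =>
    have hsplit : Finset.Ioc (2 ^ a) (2 ^ (a + (k + 1)))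
        = Finset.Ioc (2 ^ a) (2 ^ (a + k)) ∪ Finset.Ioc (2 ^ (a + k)) (2 ^ (a + k + 1)) := by
      rw [Finset.Ioc_union_Ioc_eq_Ioc (Nat.pow_le_pow_right (by norm_num) (by omega))
        (Nat.pow_le_pow_right (by norm_num) (by omega)), add_assoc]
    have hdisj : Disjoint (Finset.Ioc (2 ^ a) (2 ^ (a + k)))
        (Finset.Ioc (2 ^ (a + k)) (2 ^ (a + k + 1))) := Finset.Ioc_disjoint_Ioc_of_le le_rfl
    rw [hsplit, Finset.filter_union, Finset.sum_union
      (Finset.disjoint_filter_filter hdisj)]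
    have h1 := sum_inv_primes_Ioc_two_pow_succ (j := a + k) (by omega)
    have ha' : (0 : ℝ) < a := by exact_mod_cast ha
    have h2 : (4 : ℝ) / (a + k : ℕ) ≤ 4 / a :=
      div_le_div_of_nonneg_left (by norm_num) ha' (by push_cast; linarith [Nat.cast_nonneg (α := ℝ) k])
    push_cast at *
    linarith

lemma sum_inv_primeBlock_le (i : ℕ) : ∑ p ∈ primeBlock i, (p : ℝ)⁻¹ ≤ 4 := by
  have h := sum_inv_primes_Ioc_two_pow (a := 2 ^ i) Nat.one_le_two_pow (2 ^ i)
  unfold primeBlock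
  rw [show 2 ^ (i + 1) = 2 ^ i + 2 ^ i by ring]
  refine h.trans (le_of_eq ?_)
  push_cast
  field_simp

lemma prime_of_mem_primeBlock {i p : ℕ} (h : p ∈ primeBlock i) : p.Prime :=
  (Finset.mem_filter.1 h).2

lemma primeBlock_disjoint {i j : ℕ} (h : i ≠ j) : Disjoint (primeBlock i) (primeBlock j) := by
  rcases lt_or_gt_of_ne h with h | h
  · exact Finset.disjoint_filter_filter (Finset.Ioc_disjoint_Ioc_of_le
      (Nat.pow_le_pow_right (by norm_num) (Nat.pow_le_pow_right (by norm_num) h)))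
  · exact (Finset.disjoint_filter_filter (Finset.Ioc_disjoint_Ioc_of_le
      (Nat.pow_le_pow_right (by norm_num) (Nat.pow_le_pow_right (by norm_num) h)))).symm

lemma card_primeBlock_lt (i : ℕ) : (primeBlock i).card + 1 ≤ 2 ^ 2 ^ (i + 1) := by
  have h1 : (primeBlock i).card ≤ 2 ^ 2 ^ (i + 1) - 2 ^ 2 ^ i := by
    refine (Finset.card_filter_le _ _).trans ?_
    rw [Nat.card_Ioc]
  have h2 : 2 ^ 2 ^ i ≤ 2 ^ 2 ^ (i + 1) :=
    Nat.pow_le_pow_right (by norm_num) (Nat.pow_le_pow_right (by norm_num) (by omega))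
  have h3 : 1 ≤ 2 ^ 2 ^ i := Nat.one_le_two_pow
  omega

lemma card_filter_card_le {ι : Type*} (P : Finset ι) (k : ℕ) :
    (P.powerset.filter (fun D => D.card ≤ k)).card ≤ (P.card + 1) ^ k := by
  classical
  have h : P.powerset.filter (fun D => D.card ≤ k) ⊆
      (Fintype.piFinset fun _ : Fin k => P.map Function.Embedding.some ∪ {none}).image
        (fun f => (Finset.univ.image f).eraseNone) := by
    intro D hD
    simp only [Finset.mem_filter, Finset.mem_powerset] at hD
    rw [Finset.mem_image]
    let e := D.equivFin.symm
    refine ⟨fun j => if h : (j : ℕ) < D.card then some (e ⟨j, h⟩ : ι) else none, ?_, ?_⟩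
    · rw [Fintype.mem_piFinset]
      intro j
      split_ifs with h
      · simp [hD.1 (e ⟨j, h⟩).2]
      · simp
    · ext a
      simp only [Finset.mem_eraseNone, Finset.mem_image, Finset.mem_univ, true_and]
      constructor
      · rintro ⟨j, hj⟩
        split_ifs at hj with h
        · rw [← Option.some_injective _ hj]
          exact (e ⟨j, h⟩).2
      · intro ha
        refine ⟨⟨D.equivFin ⟨a, ha⟩, (D.equivFin ⟨a, ha⟩).2.trans_le hD.2⟩, ?_⟩
        simp [e]
  refine (Finset.card_le_card h).trans (Finset.card_image_le.trans ?_)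
  rw [Fintype.card_piFinset]
  simp only [Finset.prod_const, Finset.card_univ, Fintype.card_fin]
  gcongr
  refine (Finset.card_union_le _ _).trans ?_
  simp

end PrimeSums

lemma abs_prod_sub_prod_le {ι : Type*} (s : Finset ι) {a b δ : ι → ℝ} (hb : ∀ i ∈ s, 0 ≤ b i)
    (hδ : ∀ i ∈ s, 0 ≤ δ i) (h : ∀ i ∈ s, |a i - b i| ≤ δ i * b i) :
    |∏ i ∈ s, a i - ∏ i ∈ s, b i| ≤ (∏ i ∈ s, b i) * (Real.exp (∑ i ∈ s, δ i) - 1) := by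
  classical
  induction s using Finset.induction_on with
  | empty => simp
  | insert c s hc ih =>
    have ih' := ih (fun i hi => hb i (Finset.mem_insert_of_mem hi))
      (fun i hi => hδ i (Finset.mem_insert_of_mem hi))
      (fun i hi => h i (Finset.mem_insert_of_mem hi))
    have hbc := hb c (Finset.mem_insert_self c s)
    have hδc := hδ c (Finset.mem_insert_self c s)
    have hc' := h c (Finset.mem_insert_self c s)
    rw [Finset.prod_insert hc, Finset.prod_insert hc, Finset.sum_insert hc, Real.exp_add]
    set A := ∏ i ∈ s, a i
    set B := ∏ i ∈ s, b i
    have hB : 0 ≤ B := Finset.prod_nonneg fun i hi => hb i (Finset.mem_insert_of_mem hi)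
    have ha : |a c| ≤ (1 + δ c) * b c := by
      have : |a c| ≤ |a c - b c| + |b c| := by
        have := abs_add_le (a c - b c) (b c); simpa using this
      rw [abs_of_nonneg hbc] at this
      linarith
    have hE := Real.add_one_le_exp (δ c)
    have hE0 := Real.exp_pos (∑ i ∈ s, δ i)
    have e : a c * A - b c * B = a c * (A - B) + (a c - b c) * B := by ring
    calc |a c * A - b c * B| ≤ |a c| * |A - B| + |a c - b c| * B := by
          rw [e]
          refine (abs_add_le _ _).trans ?_
          rw [abs_mul, abs_mul, abs_of_nonneg hB]
      _ ≤ ((1 + δ c) * b c) * (B * (Real.exp (∑ i ∈ s, δ i) - 1)) + (δ c * b c) * B := by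
          gcongr
      _ = b c * B * ((1 + δ c) * Real.exp (∑ i ∈ s, δ i) - 1) := by ring
      _ ≤ b c * B * (Real.exp (δ c) * Real.exp (∑ i ∈ s, δ i) - 1) := by
          have : (1 + δ c) * Real.exp (∑ i ∈ s, δ i) ≤ Real.exp (δ c) * Real.exp (∑ i ∈ s, δ i) :=
            mul_le_mul_of_nonneg_right (by linarith) hE0.le
          exact mul_le_mul_of_nonneg_left (by linarith) (mul_nonneg hbc hB)

lemma exp_neg_two_mul_le {g : ℝ} (h0 : 0 ≤ g) (h1 : g ≤ 1 / 2) : Real.exp (-(2 * g)) ≤ 1 - g := by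
  rw [Real.exp_neg]
  have h := Real.add_one_le_exp (2 * g)
  have h2 : 1 ≤ (1 - g) * Real.exp (2 * g) := by nlinarith
  rw [inv_le_iff_one_le_mul₀ (Real.exp_pos _)]
  linarith

/-- Proportion of integers without prime factors in the blocks `m₀, …, m₀ + r - 1`. -/
noncomputable def blockProd (m₀ r : ℕ) : ℝ :=
  ∏ j : Fin r, ∏ p ∈ primeBlock (m₀ + j), (1 - (p : ℝ)⁻¹)

/-- No vertex in `S` of the cube has a prime factor in the blocks `m₀, …, m₀ + r - 1`. -/
def cubeRough {s : ℕ} (m₀ r n W : ℕ) (S : Finset (Fin s → Bool)) (x : Fin s × Bool → ℕ) : Prop :=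
  ∀ ω ∈ S, ∀ j : Fin r, ∀ p ∈ primeBlock (m₀ + j), ¬ p ∣ n + W * cubeForm ω x

lemma sum_level_le (b m₀ r : ℕ) :
    ∑ j : Fin r, 2 ^ (m₀ + j + 1) * (2 * (b + (r - 1 - j)) + 1) ≤ 2 ^ (m₀ + r) * (4 * b + 6) := by
  rw [Fin.sum_univ_eq_sum_range (fun j => 2 ^ (m₀ + j + 1) * (2 * (b + (r - 1 - j)) + 1))]
  have hgeo : ∀ r, ∑ j ∈ Finset.range r, 2 ^ (m₀ + j + 1) ≤ 2 ^ (m₀ + r + 1) := by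
    intro r
    induction r with
    | zero => simp
    | succ r ih =>
      rw [Finset.sum_range_succ]
      have : 2 ^ (m₀ + (r + 1) + 1) = 2 * 2 ^ (m₀ + r + 1) := by ring
      omega
  induction r with
  | zero => simp
  | succ r ih =>
    rw [Finset.sum_range_succ]
    have h1 : ∑ j ∈ Finset.range r, 2 ^ (m₀ + j + 1) * (2 * (b + (r + 1 - 1 - j)) + 1)
        = ∑ j ∈ Finset.range r, (2 ^ (m₀ + j + 1) * (2 * (b + (r - 1 - j)) + 1)
          + 2 * 2 ^ (m₀ + j + 1)) := by
      refine Finset.sum_congr rfl fun j hj => ?_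
      have := Finset.mem_range.1 hj
      have e : r + 1 - 1 - j = (r - 1 - j) + 1 := by omega
      rw [e]; ring
    rw [h1, Finset.sum_add_distrib, ← Finset.mul_sum]
    have h2 := hgeo r
    have e1 : 2 ^ (m₀ + r + 1) = 2 * 2 ^ (m₀ + r) := by ring
    have e2 : 2 ^ (m₀ + (r + 1)) = 2 * 2 ^ (m₀ + r) := by ring
    have e3 : r + 1 - 1 - r = 0 := by omega
    rw [e1, e2, e3]
    rw [e1] at h2
    nlinarith

lemma sum_pow_div_factorial_le {c : ℝ} (hc : 0 ≤ c) (b r : ℕ) :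
    ∑ j : Fin r, c ^ (2 * (b + (r - 1 - j)) + 1) / (2 * (b + (r - 1 - j)) + 1).factorial
      ≤ c ^ (2 * b + 1) / (2 * b + 1).factorial * Real.exp c := by
  rw [Fin.sum_univ_eq_sum_range
    (fun j => c ^ (2 * (b + (r - 1 - j)) + 1) / (2 * (b + (r - 1 - j)) + 1).factorial),
    Finset.sum_range_reflect (fun l => c ^ (2 * (b + l) + 1) / ((2 * (b + l) + 1).factorial : ℝ))]
  have h1 : ∀ l ∈ Finset.range r, c ^ (2 * (b + l) + 1) / ((2 * (b + l) + 1).factorial : ℝ)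
      ≤ c ^ (2 * b + 1) / (2 * b + 1).factorial * (c ^ (2 * l) / (2 * l).factorial) := by
    intro l _
    have h2 : ((2 * b + 1).factorial : ℝ) * (2 * l).factorial ≤ (2 * (b + l) + 1).factorial := by
      have := Nat.factorial_mul_factorial_dvd_factorial_add (2 * b + 1) (2 * l)
      have h3 := Nat.le_of_dvd (Nat.factorial_pos _) this
      rw [show 2 * (b + l) + 1 = 2 * b + 1 + 2 * l by ring]
      exact_mod_cast h3
    rw [div_mul_div_comm, ← pow_add, show 2 * (b + l) + 1 = 2 * b + 1 + 2 * l by ring]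
    rw [show 2 * (b + l) + 1 = 2 * b + 1 + 2 * l by ring] at h2
    exact div_le_div_of_nonneg_left (by positivity) (by positivity) h2
  refine (Finset.sum_le_sum h1).trans ?_
  rw [← Finset.mul_sum]
  refine mul_le_mul_of_nonneg_left ?_ (by positivity)
  refine le_trans ?_ (Real.sum_le_exp_of_nonneg hc (2 * r))
  have himg := Finset.sum_image (s := Finset.range r) (f := fun n : ℕ => c ^ n / (n.factorial : ℝ))
    (g := fun l => 2 * l) (fun a _ b _ h => by simpa using h)
  rw [← himg]
  refine Finset.sum_le_sum_of_subset_of_nonneg ?_ fun _ _ _ => by positivity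
  intro k hk
  obtain ⟨l, hl, rfl⟩ := Finset.mem_image.1 hk
  have := Finset.mem_range.1 hl
  exact Finset.mem_range.2 (by omega)

lemma prod_blocks_le (b m₀ r : ℕ) (k : Fin r → ℕ) (hk : ∀ j, k j ≤ 2 * (b + (r - 1 - j)) + 1) :
    ∏ j : Fin r, (2 ^ 2 ^ (m₀ + j + 1)) ^ k j ≤ (2 ^ 2 ^ (m₀ + r)) ^ (4 * b + 6) := by
  simp only [← pow_mul]
  rw [Finset.prod_pow_eq_pow_sum]
  refine Nat.pow_le_pow_right (by norm_num) (le_trans ?_ (sum_level_le b m₀ r))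
  exact Finset.sum_le_sum fun j _ => Nat.mul_le_mul_left _ (hk j)

open Classical in
lemma cube_sieve_density {s : ℕ} (hs : 0 < s) {m₀ : ℕ} (hm₀ : 2 * 2 ^ s ≤ 2 ^ 2 ^ m₀) (r b H n W : ℕ)
    (hW : ∀ p : ℕ, p.Prime → 2 ^ 2 ^ m₀ < p → ¬ p ∣ W) (hH : (2 ^ 2 ^ (m₀ + r)) ^ (4 * b + 6) ≤ H)
    (S : Finset (Fin s → Bool)) :
    |(boxCount H (cubeRough m₀ r n W S) : ℝ) / (H : ℝ) ^ Fintype.card (Fin s × Bool)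
        - ∏ j : Fin r, ∏ p ∈ primeBlock (m₀ + j), (1 - cubeDensity n W S p)|
      ≤ (Real.exp (12 * 2 ^ s) * ((4 * 2 ^ s) ^ (2 * b + 1) / (2 * b + 1).factorial))
          * Real.exp (Real.exp (12 * 2 ^ s) * ((4 * 2 ^ s) ^ (2 * b + 1) / (2 * b + 1).factorial))
          * (∏ j : Fin r, ∏ p ∈ primeBlock (m₀ + j), (1 - cubeDensity n W S p))
        + (r + 1) * (((2 ^ 2 ^ (m₀ + r)) ^ (4 * b + 6) : ℕ) *
          (2 ^ Fintype.card (Fin s × Bool) * (((2 ^ 2 ^ (m₀ + r)) ^ (4 * b + 6) : ℕ) / H))) := by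
  set κ : ℝ := 2 ^ s with hκ
  set c : ℝ := 4 * κ with hc
  set g := cubeDensity n W S with hg
  set L : ℕ := (2 ^ 2 ^ (m₀ + r)) ^ (4 * b + 6) with hL
  have hκ0 : 0 < κ := by positivity
  have hlarge : ∀ i, ∀ p ∈ primeBlock (m₀ + i), p.Prime ∧ 2 ^ 2 ^ m₀ < p ∧ p ≤ 2 ^ 2 ^ (m₀ + i + 1) := by
    intro i p hp
    have h := Finset.mem_filter.1 hp
    have h1 := Finset.mem_Ioc.1 h.1
    refine ⟨h.2, lt_of_le_of_lt ?_ h1.1, h1.2⟩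
    exact Nat.pow_le_pow_right (by norm_num) (Nat.pow_le_pow_right (by norm_num) (by omega))
  have hScard : (S.card : ℝ) ≤ κ := by
    have : S.card ≤ 2 ^ s := (Finset.card_le_univ S).trans (by simp)
    rw [hκ]; exact_mod_cast this
  have hgb : ∀ i, ∀ p ∈ primeBlock (m₀ + i), 0 ≤ g p ∧ g p ≤ κ * (p : ℝ)⁻¹ ∧ g p ≤ 1 / 2 := by
    intro i p hp
    obtain ⟨hp1, hp2, -⟩ := hlarge i p hp
    have := Fact.mk hp1
    have h := (cubeDensity_bounds hs (n := n) (hW p hp1 hp2) S).2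
    have hp0 : (0 : ℝ) < p := by exact_mod_cast hp1.pos
    have h1 : g p ≤ κ * (p : ℝ)⁻¹ := by
      refine h.trans ?_
      rw [div_eq_mul_inv]
      exact mul_le_mul_of_nonneg_right hScard (by positivity)
    refine ⟨by rw [hg]; unfold cubeDensity; positivity, h1, h1.trans ?_⟩
    rw [← div_eq_mul_inv, div_le_iff₀ hp0]
    have : (2 * 2 ^ s : ℕ) ≤ p := hm₀.trans hp2.le
    have : ((2 * 2 ^ s : ℕ) : ℝ) ≤ p := by exact_mod_cast this
    push_cast at this
    linarith
  have hsumg : ∀ i, ∑ p ∈ primeBlock (m₀ + i), g p ≤ c := by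
    intro i
    refine (Finset.sum_le_sum fun p hp => (hgb i p hp).2.1).trans ?_
    rw [← Finset.mul_sum, hc, mul_comm 4]
    exact mul_le_mul_of_nonneg_left (sum_inv_primeBlock_le _) hκ0.le
  have hv : ∀ i, Real.exp (-(8 * κ)) ≤ ∏ p ∈ primeBlock (m₀ + i), (1 - g p) := by
    intro i
    calc Real.exp (-(8 * κ)) ≤ Real.exp (∑ p ∈ primeBlock (m₀ + i), -(2 * g p)) := by
          refine Real.exp_le_exp.2 ?_
          rw [Finset.sum_neg_distrib, ← Finset.mul_sum]
          have := hsumg i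
          linarith
      _ = ∏ p ∈ primeBlock (m₀ + i), Real.exp (-(2 * g p)) := Real.exp_sum _ _
      _ ≤ _ := Finset.prod_le_prod (fun _ _ => (Real.exp_pos _).le) fun p hp =>
          exp_neg_two_mul_le (hgb i p hp).1 (hgb i p hp).2.2
  set B : Fin r → ℕ := fun j => b + (r - 1 - j) with hB
  set θ : Fin r → ℝ := fun j => Real.exp (8 * κ) * (c ^ (2 * B j + 1) / (2 * B j + 1).factorial)
    with hθ
  set Θ : ℝ := Real.exp (12 * κ) * (c ^ (2 * b + 1) / (2 * b + 1).factorial) with hΘ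
  have hθsum : ∑ j, θ j ≤ Θ := by
    simp only [hθ]
    rw [← Finset.mul_sum]
    have h := mul_le_mul_of_nonneg_left (sum_pow_div_factorial_le (c := c) (by positivity) b r)
      (Real.exp_pos (8 * κ)).le
    refine h.trans (le_of_eq ?_)
    rw [hΘ, show 12 * κ = 8 * κ + c by rw [hc]; ring, Real.exp_add]
    ring
  have hθ0 : ∀ j, 0 ≤ θ j := fun j => by positivity
  have hH0 : 0 < H := lt_of_lt_of_le (by positivity) hH
  set X : Finset (Fin s × Bool → ℕ) := Fintype.piFinset fun _ => Finset.range H with hX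
  have hXcard : (X.card : ℝ) = (H : ℝ) ^ Fintype.card (Fin s × Bool) := by
    rw [hX, Fintype.card_piFinset]; simp
  have key := brun_hooley X (fun j : Fin r => primeBlock (m₀ + j)) B
    (fun p x => if cubeDvd n W S p x then (1 : ℝ) else 0)
    (fun p x => by split_ifs <;> simp) (fun p x => by split_ifs <;> simp) g
    (fun j p hp => (hgb j p hp).1) (fun j p hp => (hgb j p hp).2.2.trans (by norm_num)) θ hθ0
    (fun j => by
      have h1 := elemSymm_le_pow_div (fun p hp => (hgb j p hp).1) (2 * B j + 1)
      have h2 : (∑ p ∈ primeBlock (m₀ + j), g p) ^ (2 * B j + 1) / (2 * B j + 1).factorial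
          ≤ c ^ (2 * B j + 1) / (2 * B j + 1).factorial := by
        have := hsumg j
        have h0 : 0 ≤ ∑ p ∈ primeBlock (m₀ + j), g p :=
          Finset.sum_nonneg fun p hp => (hgb j p hp).1
        gcongr
      refine (h1.trans h2).trans ?_
      have h3 := hv j
      have h4 : 1 ≤ Real.exp (8 * κ) * ∏ p ∈ primeBlock (m₀ + j), (1 - g p) := by
        have := mul_le_mul_of_nonneg_left h3 (Real.exp_pos (8 * κ)).le
        rwa [← Real.exp_add, add_neg_cancel, Real.exp_zero] at this
      have h5 : 0 ≤ c ^ (2 * B j + 1) / ((2 * B j + 1).factorial : ℝ) := by positivity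
      simp only [hθ]
      nlinarith)
    (E := 2 ^ Fintype.card (Fin s × Bool) * ((L : ℝ) / H)) (N := (L : ℝ)) (by positivity)
    (by
      have h : ∏ j : Fin r, ((primeBlock (m₀ + j)).powerset.filter
          (fun D => D.card ≤ 2 * B j + 1)).card ≤ L := by
        refine le_trans ?_ (prod_blocks_le b m₀ r (fun j => 2 * B j + 1) fun j => le_rfl)
        exact Finset.prod_le_prod (fun _ _ => Nat.zero_le _) fun j _ =>
          (card_filter_card_le _ _).trans (Nat.pow_le_pow_left (card_primeBlock_lt _) _)
      exact_mod_cast h)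
    (by
      intro D hD
      have hdisj : Set.PairwiseDisjoint (↑(Finset.univ : Finset (Fin r))) D := by
        intro i _ j _ hij
        exact Finset.disjoint_of_subset_left (hD i).1 (Finset.disjoint_of_subset_right (hD j).1
          (primeBlock_disjoint fun h => hij (Fin.ext (by omega))))
      have hprime : ∀ p ∈ Finset.univ.biUnion D, p.Prime := by
        intro p hp
        obtain ⟨j, -, hj⟩ := Finset.mem_biUnion.1 hp
        exact prime_of_mem_primeBlock ((hD j).1 hj)
      simp only [← Finset.prod_biUnion hdisj]
      set D' := Finset.univ.biUnion D with hD'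
      have hM0 : 0 < ∏ p ∈ D', p := Finset.prod_pos fun p hp => (hprime p hp).pos
      have hML : ∏ p ∈ D', p ≤ L := by
        rw [hD', Finset.prod_biUnion hdisj]
        refine le_trans ?_ (prod_blocks_le b m₀ r (fun j => (D j).card) fun j => (hD j).2)
        refine Finset.prod_le_prod (fun _ _ => Nat.zero_le _) fun j _ => ?_
        exact Finset.prod_le_pow_card _ _ _ fun p hp => (hlarge j p ((hD j).1 hp)).2.2
      have hbp := boxCount_prod D' hprime (B := cubeDvd n W S)
        (fun p _ => periodicMod_cubeDvd n W S p)
      have happ := boxCount_approx hM0 (hML.trans hH) hbp.2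
      have e1 : ∑ x ∈ X, ∏ p ∈ D', (if cubeDvd n W S p x then (1 : ℝ) else 0)
          = boxCount H (fun x => ∀ p ∈ D', cubeDvd n W S p x) := by
        simp only [Finset.prod_boole]
        rw [Finset.sum_boole]
        unfold boxCount
        congr!
      have e2 : ∏ p ∈ D', g p = (boxCount (∏ p ∈ D', p) (fun x => ∀ p ∈ D', cubeDvd n W S p x) : ℝ)
          / ((∏ p ∈ D', p : ℕ) : ℝ) ^ Fintype.card (Fin s × Bool) := by
        rw [hbp.1]
        simp only [hg, cubeDensity]
        rw [Finset.prod_div_distrib, Finset.prod_pow]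
        push_cast
        rfl
      rw [e1, e2, hXcard]
      refine happ.trans ?_
      have : ((∏ p ∈ D', p : ℕ) : ℝ) ≤ L := by exact_mod_cast hML
      gcongr)
  have eN : ∑ x ∈ X, ∏ j : Fin r, ∏ p ∈ primeBlock (m₀ + j),
      (1 - if cubeDvd n W S p x then (1 : ℝ) else 0) = boxCount H (cubeRough m₀ r n W S) := by
    have h1 : ∀ x, ∏ j : Fin r, ∏ p ∈ primeBlock (m₀ + j),
        (1 - if cubeDvd n W S p x then (1 : ℝ) else 0) = if cubeRough m₀ r n W S x then 1 else 0 := by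
      intro x
      have h2 : ∀ p, (1 - if cubeDvd n W S p x then (1 : ℝ) else 0)
          = if ¬ cubeDvd n W S p x then 1 else 0 := by
        intro p; split_ifs <;> simp
      simp only [h2, Finset.prod_boole, Finset.mem_univ, true_implies]
      congr 1
      refine propext ?_
      unfold cubeRough cubeDvd
      push Not
      exact ⟨fun h ω hω j p hp => h j p hp ω hω, fun h j p hp ω hω => h ω hω j p hp⟩
    simp only [h1]
    rw [Finset.sum_boole]
    unfold boxCount
    congr!
  rw [eN, hXcard] at key
  refine key.trans ?_
  have hPv : 0 ≤ ∏ j : Fin r, ∏ p ∈ primeBlock (m₀ + j), (1 - g p) :=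
    Finset.prod_nonneg fun j _ => (Real.exp_pos _).le.trans (hv j)
  have hsθ : 0 ≤ ∑ j, θ j := Finset.sum_nonneg fun j _ => hθ0 j
  gcongr

/-- The primes in the blocks `m₀, …, m₀ + r - 1`. -/
def blockPrimes (m₀ r : ℕ) : Finset ℕ :=
  (Finset.Ioc (2 ^ 2 ^ m₀) (2 ^ 2 ^ (m₀ + r))).filter Nat.Prime

lemma two_pow_two_pow_mono {a b : ℕ} (h : a ≤ b) : 2 ^ 2 ^ a ≤ 2 ^ 2 ^ b :=
  Nat.pow_le_pow_right (by norm_num) (Nat.pow_le_pow_right (by norm_num) h)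

lemma blockPrimes_succ (m₀ r : ℕ) :
    blockPrimes m₀ (r + 1) = blockPrimes m₀ r ∪ primeBlock (m₀ + r) := by
  unfold blockPrimes primeBlock
  rw [← Finset.filter_union, ← add_assoc, Finset.Ioc_union_Ioc_eq_Ioc
    (two_pow_two_pow_mono (by omega)) (two_pow_two_pow_mono (by omega))]

lemma disjoint_blockPrimes_primeBlock (m₀ r : ℕ) :
    Disjoint (blockPrimes m₀ r) (primeBlock (m₀ + r)) :=
  Finset.disjoint_filter_filter (Finset.Ioc_disjoint_Ioc_of_le le_rfl)

lemma prod_primeBlock (m₀ r : ℕ) (f : ℕ → ℝ) :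
    ∏ j : Fin r, ∏ p ∈ primeBlock (m₀ + j), f p = ∏ p ∈ blockPrimes m₀ r, f p := by
  induction r with
  | zero => simp [blockPrimes]
  | succ r ih =>
    rw [Fin.prod_univ_castSucc, blockPrimes_succ,
      Finset.prod_union (disjoint_blockPrimes_primeBlock m₀ r), ← ih]
    rfl

lemma mem_blockPrimes {m₀ r p : ℕ} :
    p ∈ blockPrimes m₀ r ↔ p.Prime ∧ 2 ^ 2 ^ m₀ < p ∧ p ≤ 2 ^ 2 ^ (m₀ + r) := by
  simp [blockPrimes, and_comm]

lemma forall_primeBlock {m₀ r : ℕ} {P : ℕ → Prop} :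
    (∀ j : Fin r, ∀ p ∈ primeBlock (m₀ + j), P p) ↔ ∀ p ∈ blockPrimes m₀ r, P p := by
  induction r with
  | zero => simp [blockPrimes]
  | succ r ih =>
    rw [Fin.forall_fin_succ', blockPrimes_succ]
    simp only [Fin.val_castSucc, Fin.val_last, ih, Finset.mem_union]
    exact ⟨fun h p hp => hp.elim (h.1 p) (h.2 p), fun h => ⟨fun p hp => h p (Or.inl hp),
      fun p hp => h p (Or.inr hp)⟩⟩

lemma blockProd_eq (m₀ r : ℕ) : blockProd m₀ r = ∏ p ∈ blockPrimes m₀ r, (1 - (p : ℝ)⁻¹) :=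
  prod_primeBlock m₀ r fun p => 1 - (p : ℝ)⁻¹

lemma mertensProd_eq (m₀ r : ℕ) :
    mertensProd (2 ^ 2 ^ (m₀ + r)) = mertensProd (2 ^ 2 ^ m₀) * blockProd m₀ r := by
  rw [blockProd_eq]
  unfold mertensProd
  rw [← Finset.prod_union]
  · congr 1
    ext p
    have := two_pow_two_pow_mono (Nat.le_add_right m₀ r)
    simp only [Nat.mem_primesBelow, Finset.mem_union, mem_blockPrimes]
    constructor
    · rintro ⟨h1, h2⟩
      rcases le_or_gt p (2 ^ 2 ^ m₀) with h | h
      · exact Or.inl ⟨by omega, h2⟩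
      · exact Or.inr ⟨h2, h, by omega⟩
    · rintro (⟨h1, h2⟩ | ⟨h1, h2, h3⟩)
      · exact ⟨by omega, h2⟩
      · exact ⟨by omega, h1⟩
  · rw [Finset.disjoint_left]
    intro p hp hp'
    have h1 := (Nat.mem_primesBelow.1 hp).1
    have h2 := (mem_blockPrimes.1 hp').2.1
    omega

lemma mertensProd_le_blockProd (m₀ r : ℕ) : mertensProd (2 ^ 2 ^ (m₀ + r)) ≤ blockProd m₀ r := by
  have h1 := mertensProd_eq m₀ r
  have h2 := mertensProd_pos (2 ^ 2 ^ (m₀ + r))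
  have h3 := mertensProd_pos (2 ^ 2 ^ m₀)
  have h4 := mertensProd_le_one (2 ^ 2 ^ m₀)
  have h5 : 0 < blockProd m₀ r := by
    rw [h1] at h2; exact (pos_iff_pos_of_mul_pos h2).1 h3
  rw [h1]
  nlinarith

lemma blockProd_pos (m₀ r : ℕ) : 0 < blockProd m₀ r :=
  (mertensProd_pos _).trans_le (mertensProd_le_blockProd m₀ r)

lemma blockProd_le_one (m₀ r : ℕ) : blockProd m₀ r ≤ 1 := by
  rw [blockProd_eq]
  refine Finset.prod_le_one (fun p hp => ?_) fun p hp => ?_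
  · have := inv_prime_le_half (mem_blockPrimes.1 hp).1; linarith
  · have : (0 : ℝ) ≤ (p : ℝ)⁻¹ := by positivity
    linarith

lemma sum_inv_sq_blockPrimes_le (m₀ r : ℕ) :
    ∑ p ∈ blockPrimes m₀ r, ((p : ℝ) ^ 2)⁻¹ ≤ 1 / 2 ^ 2 ^ m₀ := by
  refine (Finset.sum_le_sum_of_subset_of_nonneg (Finset.filter_subset _ _)
    fun _ _ _ => by positivity).trans ?_
  refine (sum_Ioc_inv_sq_le_sub (by positivity)
    (two_pow_two_pow_mono (Nat.le_add_right m₀ r))).trans ?_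
  push_cast
  have : (0 : ℝ) ≤ (2 ^ 2 ^ (m₀ + r))⁻¹ := by positivity
  rw [one_div]
  linarith

lemma one_sub_pow_le {t : ℝ} (h0 : 0 ≤ t) (h1 : t ≤ 1) (k : ℕ) :
    (1 - t) ^ k ≤ 1 - k * t + (k : ℝ) ^ 2 * t ^ 2 := by
  induction k with
  | zero => simp
  | succ k ih =>
    rw [pow_succ]
    have h2 := mul_le_mul_of_nonneg_right ih (sub_nonneg.2 h1)
    refine h2.trans ?_
    push_cast
    have : 0 ≤ (k : ℝ) ^ 2 * t ^ 3 := by positivity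
    have : 0 ≤ (k : ℝ) * t ^ 2 := by positivity
    nlinarith [sq_nonneg t]

lemma abs_one_sub_cubeDensity_sub_le {s : ℕ} (hs : 0 < s) {p : ℕ} (hp : p.Prime)
    (hp2 : 2 * 2 ^ s ≤ p) {n W : ℕ} (hW : ¬ p ∣ W) (S : Finset (Fin s → Bool)) :
    |(1 - cubeDensity n W S p) - (1 - (p : ℝ)⁻¹) ^ S.card|
      ≤ 2 * (2 ^ s) ^ 2 * ((p : ℝ) ^ 2)⁻¹ * (1 - (p : ℝ)⁻¹) ^ S.card := by
  have := Fact.mk hp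
  have hd := cubeDensity_bounds hs (n := n) hW S
  have hp0 : (0 : ℝ) < p := by exact_mod_cast hp.pos
  have hScard : (S.card : ℝ) ≤ 2 ^ s := by
    have : S.card ≤ 2 ^ s := (Finset.card_le_univ S).trans (by simp)
    exact_mod_cast this
  have hp2' : (2 : ℝ) * 2 ^ s ≤ p := by exact_mod_cast hp2
  set t := (p : ℝ)⁻¹ with ht
  have ht0 : 0 ≤ t := by positivity
  have ht1 : t ≤ 1 := (inv_prime_le_half hp).trans (by norm_num)
  have e1 : (S.card : ℝ) / p = S.card * t := by rw [ht]; ring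
  have e2 : (S.card : ℝ) ^ 2 / p ^ 2 = S.card ^ 2 * t ^ 2 := by rw [ht, inv_pow]; ring
  rw [e1, e2] at hd
  have hu := one_sub_pow_le ht0 ht1 S.card
  have hl := one_add_mul_le_pow (a := -t) (by linarith) S.card
  rw [← sub_eq_add_neg] at hl
  have hkt : (S.card : ℝ) * t ≤ 1 / 2 := by
    rw [ht, ← div_eq_mul_inv, div_le_iff₀ hp0]; linarith
  have hhalf : 1 / 2 ≤ (1 - t) ^ S.card := by linarith
  have hsq : (S.card : ℝ) ^ 2 * t ^ 2 ≤ (2 ^ s) ^ 2 * t ^ 2 := by gcongr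
  rw [← inv_pow, ← ht]
  have h3 : (2 ^ s) ^ 2 * t ^ 2 ≤ 2 * (2 ^ s) ^ 2 * t ^ 2 * (1 - t) ^ S.card := by
    have : (0 : ℝ) ≤ (2 ^ s) ^ 2 * t ^ 2 := by positivity
    nlinarith
  rw [abs_le]
  constructor <;> linarith

lemma cube_sieve_bound {s : ℕ} (hs : 0 < s) {m₀ : ℕ} (hm₀ : 2 * 2 ^ s ≤ 2 ^ 2 ^ m₀)
    {r b H n W : ℕ} (hW : ∀ p : ℕ, p.Prime → 2 ^ 2 ^ m₀ < p → ¬ p ∣ W)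
    (hH : (2 ^ 2 ^ (m₀ + r)) ^ (8 * b + 14 + 2 ^ s) ≤ H) (S : Finset (Fin s → Bool))
    {Θ ζ : ℝ} (hΘ : Θ = Real.exp (12 * 2 ^ s) * ((4 * 2 ^ s) ^ (2 * b + 1) / (2 * b + 1).factorial))
    (hζ : ζ = 2 * (2 ^ s) ^ 2 * (1 / 2 ^ 2 ^ m₀)) :
    |(boxCount H (cubeRough m₀ r n W S) : ℝ) / (H : ℝ) ^ (2 * s) - blockProd m₀ r ^ S.card|
      ≤ blockProd m₀ r ^ S.card * (Θ * Real.exp Θ * Real.exp ζ + (Real.exp ζ - 1)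
        + 4 ^ s / 2 ^ 2 ^ (m₀ + r)) := by
  classical
  set z : ℕ := 2 ^ 2 ^ (m₀ + r) with hz
  have hz1 : 1 ≤ z := Nat.one_le_two_pow
  have hcard : Fintype.card (Fin s × Bool) = 2 * s := by simp [mul_comm]
  have h1 := cube_sieve_density hs hm₀ r b H n W hW
    ((Nat.pow_le_pow_right hz1 (by omega)).trans hH) S
  rw [← hΘ, hcard, prod_primeBlock] at h1
  set G := ∏ p ∈ blockPrimes m₀ r, (1 - cubeDensity n W S p) with hG
  have h2 : |G - blockProd m₀ r ^ S.card| ≤ blockProd m₀ r ^ S.card * (Real.exp ζ - 1) := by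
    rw [blockProd_eq, ← Finset.prod_pow, hG]
    refine (abs_prod_sub_prod_le _ (δ := fun p : ℕ => 2 * (2 ^ s) ^ 2 * ((p : ℝ) ^ 2)⁻¹) ?_ ?_ ?_).trans ?_
    · intro p hp
      have := inv_prime_le_half (mem_blockPrimes.1 hp).1
      exact pow_nonneg (by linarith) _
    · intro p hp; positivity
    · intro p hp
      obtain ⟨ha, hb, hc⟩ := mem_blockPrimes.1 hp
      exact abs_one_sub_cubeDensity_sub_le hs ha (hm₀.trans hb.le) (hW p ha hb) S
    · refine mul_le_mul_of_nonneg_left ?_ (Finset.prod_nonneg fun p hp => ?_)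
      · rw [← Finset.mul_sum, hζ]
        have := sum_inv_sq_blockPrimes_le m₀ r
        gcongr
      · have := inv_prime_le_half (mem_blockPrimes.1 hp).1
        exact pow_nonneg (by linarith) _
  set V := blockProd m₀ r with hV
  have hV0 : 0 < V := blockProd_pos m₀ r
  have hV1 : V ≤ 1 := blockProd_le_one m₀ r
  have hΘ0 : 0 ≤ Θ := by rw [hΘ]; positivity
  have hzR : (1 : ℝ) ≤ z := by exact_mod_cast hz1
  have hr : (r : ℝ) + 1 ≤ z := by
    have a1 : r < 2 ^ r := Nat.lt_two_pow_self
    have a2 : 2 ^ r ≤ 2 ^ (m₀ + r) := Nat.pow_le_pow_right (by norm_num) (by omega)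
    have a3 : 2 ^ (m₀ + r) < z := Nat.lt_two_pow_self
    exact_mod_cast (show r + 1 ≤ z by omega)
  have hE : ((r : ℝ) + 1) * (((z ^ (4 * b + 6) : ℕ) : ℝ) *
      (2 ^ (2 * s) * (((z ^ (4 * b + 6) : ℕ) : ℝ) / H))) ≤ V ^ S.card * (4 ^ s / z) := by
    have hScard : S.card ≤ 2 ^ s := (Finset.card_le_univ S).trans (by simp)
    have b1 : (1 / (z : ℝ)) ^ 2 ^ s ≤ V ^ S.card := by
      have : 1 / (z : ℝ) ≤ V := (one_div_le_mertensProd hz1).trans (mertensProd_le_blockProd m₀ r)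
      calc (1 / (z : ℝ)) ^ 2 ^ s ≤ V ^ 2 ^ s := by gcongr
        _ ≤ V ^ S.card := pow_le_pow_of_le_one hV0.le hV1 hScard
    have hH' : (z : ℝ) ^ (8 * b + 14 + 2 ^ s) ≤ H := by exact_mod_cast hH
    have hHpos : (0 : ℝ) < H := lt_of_lt_of_le (by positivity) hH'
    calc _ ≤ (z : ℝ) * ((z : ℝ) ^ (4 * b + 6) * (2 ^ (2 * s) * ((z : ℝ) ^ (4 * b + 6)
            / (z : ℝ) ^ (8 * b + 14 + 2 ^ s)))) := by
          push_cast; gcongr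
      _ = (1 / (z : ℝ)) ^ 2 ^ s * (4 ^ s / z) := by
          have : (z : ℝ) ≠ 0 := by positivity
          rw [pow_mul]
          norm_num
          field_simp
          ring
      _ ≤ _ := by gcongr
  push_cast at h1 hE ⊢
  have hG1 : G ≤ V ^ S.card * Real.exp ζ := by
    have := (abs_le.1 h2).2; nlinarith
  have h3 : Θ * Real.exp Θ * G ≤ Θ * Real.exp Θ * (V ^ S.card * Real.exp ζ) :=
    mul_le_mul_of_nonneg_left hG1 (by positivity)
  have h4 := abs_sub_le ((boxCount H (cubeRough m₀ r n W S) : ℝ) / (H : ℝ) ^ (2 * s)) G (V ^ S.card)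
  have hzc : (z : ℝ) = 2 ^ 2 ^ (m₀ + r) := by rw [hz]; push_cast; rfl
  rw [hzc] at hE
  nlinarith

/-- Uniform sieve estimate: the frequency of cubes all of whose vertices in `S` avoid the primes in
the blocks is close to what independence predicts. -/
lemma cube_sieve {s : ℕ} (hs : 0 < s) (A : ℕ) :
    ∀ᶠ b : ℕ in atTop, ∃ m₀ r₀ : ℕ, ∀ r ≥ r₀, ∀ H n W : ℕ,
      (∀ p : ℕ, p.Prime → 2 ^ 2 ^ m₀ < p → ¬ p ∣ W) →
      (2 ^ 2 ^ (m₀ + r)) ^ (8 * b + 14 + 2 ^ s) ≤ H → ∀ S : Finset (Fin s → Bool),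
      |(boxCount H (cubeRough m₀ r n W S) : ℝ) / (H : ℝ) ^ (2 * s) - blockProd m₀ r ^ S.card|
        ≤ blockProd m₀ r ^ S.card * (1 / (b : ℝ) ^ A) := by
  set E := Real.exp (12 * 2 ^ s)
  set c : ℝ := 4 * 2 ^ s with hc
  set Θ : ℕ → ℝ := fun b => E * (c ^ (2 * b + 1) / (2 * b + 1).factorial) with hΘ
  have hΘ0 : ∀ b, 0 < Θ b := fun b => by positivity
  have hlim : Tendsto (fun b : ℕ => (b : ℝ) ^ A * Θ b) atTop (nhds 0) := by
    have h1 : Tendsto (fun k : ℕ => (2 ^ A * c) ^ k / (k.factorial : ℝ)) atTop (nhds 0) :=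
      FloorSemiring.tendsto_pow_div_factorial_atTop _
    have h2 : Tendsto (fun b : ℕ => 2 * b + 1) atTop atTop :=
      tendsto_atTop_mono (fun b => show b ≤ 2 * b + 1 by omega) tendsto_id
    have h3 := (h1.comp h2).const_mul E
    rw [mul_zero] at h3
    refine squeeze_zero (fun b => by positivity) (fun b => ?_) h3
    have h4 : (b : ℝ) ^ A ≤ (2 ^ A) ^ (2 * b + 1) := by
      have : (b : ℝ) ≤ 2 ^ (2 * b + 1) := by
        have h5 : 2 * b + 1 < 2 ^ (2 * b + 1) := Nat.lt_two_pow_self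
        exact_mod_cast (show b ≤ 2 ^ (2 * b + 1) by omega)
      calc (b : ℝ) ^ A ≤ (2 ^ (2 * b + 1)) ^ A := by gcongr
        _ = _ := by rw [← pow_mul, ← pow_mul, mul_comm]
    calc (b : ℝ) ^ A * Θ b ≤ (2 ^ A) ^ (2 * b + 1) * Θ b := by
          have := hΘ0 b; gcongr
      _ = _ := by simp only [hΘ, Function.comp, mul_pow]; ring
  have hev : ∀ᶠ b : ℕ in atTop, (b : ℝ) ^ A * Θ b < 1 / 27 := hlim.eventually_lt_const (by norm_num)
  filter_upwards [hev, eventually_ge_atTop 1] with b hb hb1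
  have hbR : (1 : ℝ) ≤ b := by exact_mod_cast hb1
  have hbA : (1 : ℝ) ≤ (b : ℝ) ^ A := one_le_pow₀ hbR
  have hbA0 : (0 : ℝ) < (b : ℝ) ^ A := by positivity
  have hlim2 : Tendsto (fun m : ℕ => (1 : ℝ) / 2 ^ 2 ^ m) atTop (nhds 0) := by
    have h1 : Tendsto (fun k : ℕ => ((1 : ℝ) / 2) ^ k) atTop (nhds 0) :=
      tendsto_pow_atTop_nhds_zero_of_lt_one (by norm_num) (by norm_num)
    have h2 : Tendsto (fun m : ℕ => 2 ^ m) atTop atTop := tendsto_pow_atTop_atTop_of_one_lt (by norm_num)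
    have := h1.comp h2
    simpa [Function.comp_def] using this
  have hev1 : ∀ᶠ m : ℕ in atTop, 2 * (2 ^ s) ^ 2 * (1 / 2 ^ 2 ^ m) < 1 / (6 * (b : ℝ) ^ A) := by
    have := hlim2.const_mul (2 * (2 ^ s) ^ 2)
    rw [mul_zero] at this
    exact this.eventually_lt_const (by positivity)
  have hev2 : ∀ᶠ m : ℕ in atTop, 4 ^ s * (1 / 2 ^ 2 ^ m) < 1 / (3 * (b : ℝ) ^ A) := by
    have := hlim2.const_mul (4 ^ s)
    rw [mul_zero] at this
    exact this.eventually_lt_const (by positivity)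
  have hev3 : ∀ᶠ m : ℕ in atTop, 2 * 2 ^ s ≤ 2 ^ 2 ^ m := by
    filter_upwards [eventually_ge_atTop (s + 1)] with m hm
    rw [← pow_succ']
    exact Nat.pow_le_pow_right (by norm_num) (hm.trans Nat.lt_two_pow_self.le)
  obtain ⟨m₀, hm1, hm3⟩ := (hev1.and hev3).exists
  obtain ⟨r₀, hr₀⟩ := eventually_atTop.1 hev2
  refine ⟨m₀, r₀, fun r hr H n W hW hH S => ?_⟩
  have key := cube_sieve_bound hs hm3 (n := n) hW hH S (Θ := Θ b) rfl rfl
  refine key.trans (mul_le_mul_of_nonneg_left ?_ (pow_nonneg (blockProd_pos m₀ r).le _))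
  set ζ : ℝ := 2 * (2 ^ s) ^ 2 * (1 / 2 ^ 2 ^ m₀) with hζ
  have hζ0 : 0 ≤ ζ := by positivity
  have hζ1 : ζ ≤ 1 := by
    refine hm1.le.trans ?_
    rw [div_le_one (by positivity)]; linarith
  have hΘ1 : Θ b ≤ 1 := by
    have := hΘ0 b
    nlinarith
  have he := Real.exp_one_lt_d9
  have f1 : Real.exp ζ - 1 ≤ 2 * ζ := by
    have := Real.abs_exp_sub_one_le (x := ζ) (by rwa [abs_of_nonneg hζ0])
    rw [abs_of_nonneg hζ0] at this
    exact (le_abs_self _).trans this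
  have f2 : Real.exp ζ ≤ 3 := by
    have := Real.exp_le_exp.2 hζ1; linarith
  have f3 : Real.exp (Θ b) ≤ 3 := by
    have := Real.exp_le_exp.2 hΘ1; linarith
  have f4 : Θ b ≤ 1 / (27 * (b : ℝ) ^ A) := by
    rw [le_div_iff₀ (by positivity)]
    nlinarith
  have f5 : Θ b * Real.exp (Θ b) * Real.exp ζ ≤ Θ b * 3 * 3 := by
    have := hΘ0 b
    gcongr
  have f6 := hr₀ (m₀ + r) (by omega)
  have g1 : 1 / (27 * (b : ℝ) ^ A) = 1 / 27 * (1 / (b : ℝ) ^ A) := by field_simp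
  have g2 : 1 / (6 * (b : ℝ) ^ A) = 1 / 6 * (1 / (b : ℝ) ^ A) := by field_simp
  have g3 : 1 / (3 * (b : ℝ) ^ A) = 1 / 3 * (1 / (b : ℝ) ^ A) := by field_simp
  rw [g1] at f4
  rw [g2] at hm1
  rw [g3] at f6
  have g4 : (4 : ℝ) ^ s / 2 ^ 2 ^ (m₀ + r) = 4 ^ s * (1 / 2 ^ 2 ^ (m₀ + r)) := by ring
  rw [g4]
  linarith

/-- The additive character `x ↦ exp (2πix)`. -/
noncomputable def expi (x : ℝ) : ℂ := Complex.exp (2 * Real.pi * x * Complex.I)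

lemma expi_zero : expi 0 = 1 := by simp [expi]

lemma expi_add (x y : ℝ) : expi (x + y) = expi x * expi y := by
  unfold expi
  rw [← Complex.exp_add]
  congr 1
  push_cast
  ring

lemma conj_expi (x : ℝ) : starRingEnd ℂ (expi x) = expi (-x) := by
  unfold expi
  rw [← Complex.exp_conj]
  congr 1
  have h : (starRingEnd ℂ) 2 = 2 := Complex.conj_ofNat 2
  simp [h]

lemma norm_expi (x : ℝ) : ‖expi x‖ = 1 := by
  unfold expi
  rw [show (2 * Real.pi * x * Complex.I : ℂ) = ((2 * Real.pi * x : ℝ) : ℂ) * Complex.I by push_cast; ring]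
  exact Complex.norm_exp_ofReal_mul_I _

/-- The average of `G (y₁ + ⋯ + yₛ)` over `0 ≤ yᵢ < H`. -/
noncomputable def lineAverage (H : ℕ) : ℕ → (ℕ → ℂ) → ℂ
  | 0, G => G 0
  | s + 1, G => (H : ℂ)⁻¹ * ∑ a ∈ Finset.range H, lineAverage H s fun t => G (t + a)

/-- The Gowers-type box average of `G` over `s`-dimensional cubes. -/
noncomputable def boxAverage (H : ℕ) : ℕ → (ℕ → ℂ) → ℂ
  | 0, G => G 0
  | s + 1, G => (H : ℂ)⁻¹ * ∑ a ∈ Finset.range H, (H : ℂ)⁻¹ * ∑ b ∈ Finset.range H,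
      boxAverage H s fun t => G (t + a) * starRingEnd ℂ (G (t + b))

lemma lineAverage_sum {ι : Type*} (H s : ℕ) (S : Finset ι) (G : ι → ℕ → ℂ) :
    lineAverage H s (fun t => ∑ i ∈ S, G i t) = ∑ i ∈ S, lineAverage H s (G i) := by
  induction s generalizing G with
  | zero => rfl
  | succ s ih =>
    simp only [lineAverage, ih]
    rw [Finset.sum_comm, Finset.mul_sum]

lemma lineAverage_mul (H s : ℕ) (c : ℂ) (G : ℕ → ℂ) :
    lineAverage H s (fun t => c * G t) = c * lineAverage H s G := by
  induction s generalizing G with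
  | zero => rfl
  | succ s ih =>
    simp only [lineAverage, ih]
    rw [← Finset.mul_sum]
    ring

lemma norm_average_pow_le {ι : Type*} (S : Finset ι) (k : ℕ) (f : ι → ℂ) :
    ‖(S.card : ℂ)⁻¹ * ∑ i ∈ S, f i‖ ^ (k + 1) ≤ (S.card : ℝ)⁻¹ * ∑ i ∈ S, ‖f i‖ ^ (k + 1) := by
  rcases S.eq_empty_or_nonempty with rfl | hS
  · simp
  have hc : (0 : ℝ) < S.card := by exact_mod_cast hS.card_pos
  have h1 : ‖(S.card : ℂ)⁻¹ * ∑ i ∈ S, f i‖ ≤ ∑ i ∈ S, (S.card : ℝ)⁻¹ * ‖f i‖ := by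
    rw [norm_mul, norm_inv, Complex.norm_natCast, ← Finset.mul_sum]
    exact mul_le_mul_of_nonneg_left (norm_sum_le _ _) (by positivity)
  refine (pow_le_pow_left₀ (norm_nonneg _) h1 _).trans ?_
  rw [Finset.mul_sum]
  refine Real.pow_arith_mean_le_arith_mean_pow S _ _ (fun _ _ => by positivity) ?_
    (fun _ _ => norm_nonneg _) _
  rw [Finset.sum_const, nsmul_eq_mul]
  field_simp

lemma norm_lineAverage_sq_le (H s : ℕ) (F : ℕ → ℂ) :
    ‖lineAverage H s F‖ ^ 2 ≤ (lineAverage H s fun t => F t * starRingEnd ℂ (F t)).re := by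
  induction s generalizing F with
  | zero =>
    simp only [lineAverage]
    rw [Complex.mul_conj, Complex.ofReal_re, Complex.normSq_eq_norm_sq]
  | succ s ih =>
    simp only [lineAverage]
    have h := norm_average_pow_le (Finset.range H) 1 (fun a => lineAverage H s fun t => F (t + a))
    rw [Finset.card_range] at h
    refine h.trans ?_
    rw [← Complex.ofReal_natCast, ← Complex.ofReal_inv, Complex.re_ofReal_mul, Complex.re_sum]
    exact mul_le_mul_of_nonneg_left (Finset.sum_le_sum fun a _ => ih _) (by positivity)

lemma norm_lineAverage_pow_le (H s : ℕ) (G : ℕ → ℂ) :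
    ‖lineAverage H (s + 1) G‖ ^ 2 ^ (s + 1) ≤ (boxAverage H (s + 1) G).re := by
  have key : ∀ s, ∀ G : ℕ → ℂ, ‖lineAverage H (s + 1) G‖ ^ 2 ≤
      ‖(H : ℂ)⁻¹ * ∑ a ∈ Finset.range H, (H : ℂ)⁻¹ * ∑ b ∈ Finset.range H,
      lineAverage H s fun t => G (t + a) * starRingEnd ℂ (G (t + b))‖ := by
    intro s G
    have h1 : lineAverage H (s + 1) G
        = lineAverage H s fun t => (H : ℂ)⁻¹ * ∑ a ∈ Finset.range H, G (t + a) := by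
      rw [lineAverage_mul, lineAverage_sum]; rfl
    rw [h1]
    refine (norm_lineAverage_sq_le H s _).trans ((Complex.re_le_norm _).trans (le_of_eq ?_))
    congr 1
    have h2 : ∀ t, ((H : ℂ)⁻¹ * ∑ a ∈ Finset.range H, G (t + a)) *
        starRingEnd ℂ ((H : ℂ)⁻¹ * ∑ a ∈ Finset.range H, G (t + a))
        = (H : ℂ)⁻¹ * ∑ a ∈ Finset.range H, (H : ℂ)⁻¹ * ∑ b ∈ Finset.range H,
          G (t + a) * starRingEnd ℂ (G (t + b)) := by
      intro t
      simp only [map_mul, map_inv₀, Complex.conj_natCast, map_sum]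
      rw [mul_mul_mul_comm, Finset.sum_mul_sum, ← Finset.mul_sum, mul_assoc]
    simp only [h2, lineAverage_mul, lineAverage_sum]
  induction s generalizing G with
  | zero =>
    have h := key 0 G
    simp only [zero_add, pow_one]
    refine h.trans (le_of_eq ?_)
    have h0 : ∀ G, boxAverage H (0 + 1) G = (lineAverage H 1 G) * starRingEnd ℂ (lineAverage H 1 G) := by
      intro G
      simp only [boxAverage, lineAverage, zero_add, map_mul, map_inv₀, Complex.conj_natCast, map_sum]
      rw [mul_mul_mul_comm, Finset.sum_mul_sum, ← Finset.mul_sum, mul_assoc]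
    have h3 := h0 G
    have h4 : boxAverage H (0 + 1) G = (H : ℂ)⁻¹ * ∑ a ∈ Finset.range H, (H : ℂ)⁻¹ *
      ∑ b ∈ Finset.range H, lineAverage H 0 fun t => G (t + a) * starRingEnd ℂ (G (t + b)) := rfl
    rw [← h4]
    have h5 : boxAverage H 1 G = ((‖lineAverage H 1 G‖ ^ 2 : ℝ) : ℂ) := by
      rw [h0, Complex.mul_conj, Complex.normSq_eq_norm_sq]
    rw [zero_add, h5, Complex.ofReal_re, Complex.norm_real, Real.norm_eq_abs, abs_of_nonneg (by positivity)]
  | succ s ih =>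
    rw [pow_succ' 2 (s + 1), pow_mul]
    refine (pow_le_pow_left₀ (by positivity) (key (s + 1) G) _).trans ?_
    obtain ⟨k, hk⟩ : ∃ k, 2 ^ (s + 1) = k + 1 := ⟨2 ^ (s + 1) - 1, by
      have := Nat.one_le_two_pow (n := s + 1); omega⟩
    rw [hk]
    have h1 := norm_average_pow_le (Finset.range H) k (fun a => (H : ℂ)⁻¹ *
      ∑ b ∈ Finset.range H, lineAverage H (s + 1) fun t => G (t + a) * starRingEnd ℂ (G (t + b)))
    rw [Finset.card_range] at h1
    refine h1.trans ?_
    conv_rhs => rw [boxAverage]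
    rw [← Complex.ofReal_natCast, ← Complex.ofReal_inv, Complex.re_ofReal_mul, Complex.re_sum]
    refine mul_le_mul_of_nonneg_left (Finset.sum_le_sum fun a _ => ?_) (by positivity)
    have h2 := norm_average_pow_le (Finset.range H) k (fun b =>
      lineAverage H (s + 1) fun t => G (t + a) * starRingEnd ℂ (G (t + b)))
    rw [Finset.card_range, ← Complex.ofReal_natCast, ← Complex.ofReal_inv] at h2
    refine h2.trans ?_
    rw [Complex.re_ofReal_mul, Complex.re_sum]
    refine mul_le_mul_of_nonneg_left (Finset.sum_le_sum fun b _ => ?_) (by positivity)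
    rw [← hk]
    exact ih _

/-- The difference `φ (X + a) - φ (X + b)`. -/
noncomputable def shiftDiff (φ : Polynomial ℝ) (a b : ℝ) : Polynomial ℝ :=
  Polynomial.taylor a φ - Polynomial.taylor b φ

lemma eval_shiftDiff (φ : Polynomial ℝ) (a b t : ℝ) :
    (shiftDiff φ a b).eval t = φ.eval (t + a) - φ.eval (t + b) := by
  simp [shiftDiff, Polynomial.taylor_eval]

lemma natDegree_shiftDiff_le {φ : Polynomial ℝ} {s : ℕ} (h : φ.natDegree ≤ s + 1) (a b : ℝ) :
    (shiftDiff φ a b).natDegree ≤ s := by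
  rw [Polynomial.natDegree_le_iff_coeff_eq_zero]
  intro n hn
  rw [shiftDiff, Polynomial.coeff_sub, Polynomial.taylor_coeff, Polynomial.taylor_coeff]
  have h1 : (Polynomial.hasseDeriv n φ).natDegree = 0 := by
    have := Polynomial.natDegree_hasseDeriv_le φ n
    omega
  rw [Polynomial.eq_C_of_natDegree_eq_zero h1]
  simp

lemma coeff_shiftDiff {φ : Polynomial ℝ} {s : ℕ} (h : φ.natDegree ≤ s + 1) (a b : ℝ) :
    (shiftDiff φ a b).coeff s = (s + 1) * φ.coeff (s + 1) * (a - b) := by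
  rw [shiftDiff, Polynomial.coeff_sub, Polynomial.taylor_coeff, Polynomial.taylor_coeff]
  have h1 : (Polynomial.hasseDeriv s φ).natDegree ≤ 1 := by
    have := Polynomial.natDegree_hasseDeriv_le φ s
    omega
  rw [Polynomial.eq_X_add_C_of_natDegree_le_one h1]
  simp only [Polynomial.eval_add, Polynomial.eval_mul, Polynomial.eval_C, Polynomial.eval_X,
    Polynomial.hasseDeriv_coeff]
  rw [show 1 + s = s + 1 by ring, Nat.choose_succ_self_right]
  push_cast
  ring

/-- Average over cubes of the product of `F` over the vertices, twisted by a multilinear phase. -/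
noncomputable def twistedBoxAverage (H : ℕ) : ℕ → (ℕ → ℝ) → ℝ → ℂ
  | 0, F, c => F 0 * expi c
  | s + 1, F, c => (H : ℂ)⁻¹ * ∑ a ∈ Finset.range H, (H : ℂ)⁻¹ * ∑ b ∈ Finset.range H,
      twistedBoxAverage H s (fun t => F (t + a) * F (t + b)) ((s + 1) * c * (a - b))

lemma boxAverage_phase (H : ℕ) {s : ℕ} (F : ℕ → ℝ) {φ : Polynomial ℝ} (hφ : φ.natDegree ≤ s) :
    boxAverage H s (fun t => F t * expi (φ.eval (t : ℝ))) = twistedBoxAverage H s F (φ.coeff s) := by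
  induction s generalizing F φ with
  | zero =>
    have h0 := Polynomial.eq_C_of_natDegree_eq_zero (Nat.le_zero.1 hφ)
    rw [h0]
    simp [boxAverage, twistedBoxAverage]
  | succ s ih =>
    simp only [boxAverage, twistedBoxAverage]
    congr 1
    refine Finset.sum_congr rfl fun a _ => ?_
    congr 1
    refine Finset.sum_congr rfl fun b _ => ?_
    rw [← coeff_shiftDiff hφ, ← ih _ (natDegree_shiftDiff_le hφ a b)]
    congr 1
    funext t
    rw [eval_shiftDiff, sub_eq_add_neg, expi_add, ← conj_expi, map_mul, Complex.conj_ofReal]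
    push_cast
    ring

lemma sum_piFinset_cube_succ {s : ℕ} (H : ℕ) (f : (Fin (s + 1) × Bool → ℕ) → ℂ) :
    ∑ x ∈ Fintype.piFinset (fun _ : Fin (s + 1) × Bool => Finset.range H), f x
      = ∑ a ∈ Finset.range H, ∑ b ∈ Finset.range H,
        ∑ x ∈ Fintype.piFinset (fun _ : Fin s × Bool => Finset.range H),
          f (fun i => (Fin.cons (bif i.2 then a else b) fun j => x (j, i.2) : Fin (s + 1) → ℕ) i.1) := by
  rw [← Finset.sum_product', ← Finset.sum_product']
  symm
  refine Finset.sum_bij' (fun y _ => fun i => (Fin.cons (bif i.2 then y.1.1 else y.1.2)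
      fun j => y.2 (j, i.2) : Fin (s + 1) → ℕ) i.1)
    (fun x _ => ((x (0, true), x (0, false)), fun i => x (i.1.succ, i.2))) ?_ ?_ ?_ ?_ ?_
  · rintro ⟨⟨a, b⟩, x⟩ h
    simp only [Finset.mem_product, Fintype.mem_piFinset] at h ⊢
    rintro ⟨i, t⟩
    refine Fin.cases ?_ (fun j => ?_) i
    · cases t
      · exact h.1.2
      · exact h.1.1
    · exact h.2 (j, t)
  · intro x h
    simp only [Finset.mem_product, Fintype.mem_piFinset] at h ⊢
    exact ⟨⟨h _, h _⟩, fun i => h _⟩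
  · rintro ⟨⟨a, b⟩, x⟩ h
    simp
  · intro x h
    funext ⟨i, t⟩
    refine Fin.cases ?_ (fun j => ?_) i
    · cases t <;> rfl
    · rfl
  · intro y h
    rfl

lemma prod_cubeForm_succ {s : ℕ} (F : ℕ → ℝ) (a b : ℕ) (x : Fin s × Bool → ℕ) :
    ∏ ω : Fin (s + 1) → Bool, F (cubeForm ω
        (fun i => (Fin.cons (bif i.2 then a else b) fun j => x (j, i.2) : Fin (s + 1) → ℕ) i.1))
      = ∏ ω : Fin s → Bool, (F (cubeForm ω x + a) * F (cubeForm ω x + b)) := by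
  rw [← Fintype.prod_equiv (Fin.consEquiv fun _ => Bool) (fun y => F (cubeForm (Fin.cons y.1 y.2)
    (fun i => (Fin.cons (bif i.2 then a else b) fun j => x (j, i.2) : Fin (s + 1) → ℕ) i.1))) _
    (fun _ => rfl), Fintype.prod_prod_type, Fintype.prod_bool, ← Finset.prod_mul_distrib]
  refine Finset.prod_congr rfl fun ω _ => ?_
  unfold cubeForm
  simp [Fin.sum_univ_succ, add_comm]

lemma twistedBoxAverage_eq (H s : ℕ) (F : ℕ → ℝ) (c : ℝ) :
    twistedBoxAverage H s F c = ((H : ℂ) ^ (2 * s))⁻¹ *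
      ∑ x ∈ Fintype.piFinset (fun _ : Fin s × Bool => Finset.range H),
        ((∏ ω, F (cubeForm ω x) : ℝ) : ℂ) *
          expi (s.factorial * c * ∏ i, ((x (i, true) : ℝ) - x (i, false))) := by
  induction s generalizing F c with
  | zero =>
    rw [Finset.sum_eq_single_of_mem (fun i => i.1.elim0) (Fintype.mem_piFinset.2 fun i => i.1.elim0)
      (fun y _ h => (h (funext fun i => i.1.elim0)).elim)]
    simp [twistedBoxAverage, cubeForm]
  | succ s ih =>
    rw [sum_piFinset_cube_succ]
    simp only [twistedBoxAverage, ih, prod_cubeForm_succ]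
    simp only [Finset.mul_sum]
    refine Finset.sum_congr rfl fun a _ => Finset.sum_congr rfl fun b _ =>
      Finset.sum_congr rfl fun x _ => ?_
    have h1 : ∏ i : Fin (s + 1), (((Fin.cons (bif true then a else b) fun j => x (j, true) :
          Fin (s + 1) → ℕ) i : ℝ) - ((Fin.cons (bif false then a else b) fun j => x (j, false) :
          Fin (s + 1) → ℕ) i : ℝ))
        = ((a : ℝ) - b) * ∏ i, ((x (i, true) : ℝ) - x (i, false)) := by
      simp [Fin.prod_univ_succ]
    rw [h1, Nat.factorial_succ]
    have h2 : (s.factorial : ℝ) * ((s + 1) * c * (a - b)) * ∏ i, ((x (i, true) : ℝ) - x (i, false))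
        = ((s + 1) * s.factorial : ℕ) * c * (((a : ℝ) - b) * ∏ i, ((x (i, true) : ℝ) - x (i, false))) := by
      push_cast; ring
    rw [h2, show 2 * (s + 1) = 2 * s + 1 + 1 by ring, pow_succ, pow_succ]
    rw [mul_inv, mul_inv]
    ring

/-- `n` has no prime factor in the blocks `m₀, …, m₀ + r - 1`. -/
def blockRough (m₀ r n : ℕ) : Prop := ∀ p ∈ blockPrimes m₀ r, ¬ p ∣ n

lemma cubeRough_iff {s : ℕ} (m₀ r n W : ℕ) (S : Finset (Fin s → Bool)) (x : Fin s × Bool → ℕ) :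
    cubeRough m₀ r n W S x ↔ ∀ ω ∈ S, blockRough m₀ r (n + W * cubeForm ω x) :=
  forall₂_congr fun _ _ => forall_primeBlock

open Classical in
lemma abs_boxAverage_blockRough_le {s m₀ r n W H : ℕ} {V δ : ℝ} (hV : 0 ≤ V)
    (h : ∀ S : Finset (Fin s → Bool),
      |(boxCount H (cubeRough m₀ r n W S) : ℝ) / (H : ℝ) ^ (2 * s) - V ^ S.card| ≤ V ^ S.card * δ) :
    |((H : ℝ) ^ (2 * s))⁻¹ * ∑ x ∈ Fintype.piFinset (fun _ : Fin s × Bool => Finset.range H),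
      ∏ ω : Fin s → Bool, ((if blockRough m₀ r (n + W * cubeForm ω x) then (1 : ℝ) else 0) - V)|
      ≤ 2 ^ 2 ^ s * V ^ 2 ^ s * δ := by
  have hcard : (Finset.univ : Finset (Fin s → Bool)).card = 2 ^ s := by simp
  have h1 : ((H : ℝ) ^ (2 * s))⁻¹ * ∑ x ∈ Fintype.piFinset (fun _ : Fin s × Bool => Finset.range H),
      ∏ ω : Fin s → Bool, ((if blockRough m₀ r (n + W * cubeForm ω x) then (1 : ℝ) else 0) - V)
      = ∑ S ∈ (Finset.univ : Finset (Fin s → Bool)).powerset,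
        ((boxCount H (cubeRough m₀ r n W S) : ℝ) / (H : ℝ) ^ (2 * s))
          * (-V) ^ (Finset.univ \ S).card := by
    simp only [sub_eq_add_neg, Finset.prod_add, Finset.prod_const]
    rw [Finset.sum_comm, Finset.mul_sum]
    refine Finset.sum_congr rfl fun S _ => ?_
    rw [← Finset.sum_mul]
    have hb : ∀ x : Fin s × Bool → ℕ,
        ∏ ω ∈ S, (if blockRough m₀ r (n + W * cubeForm ω x) then (1 : ℝ) else 0)
        = if cubeRough m₀ r n W S x then 1 else 0 := by
      intro x
      rw [Finset.prod_boole]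
      simp only [cubeRough_iff]
      congr
    simp only [hb]
    rw [Finset.sum_boole, ← mul_assoc]
    congr 1
    rw [div_eq_inv_mul]
    unfold boxCount
    congr!
  have h2 : ∑ S ∈ (Finset.univ : Finset (Fin s → Bool)).powerset,
      V ^ S.card * (-V) ^ (Finset.univ \ S).card = 0 := by
    have := Finset.prod_add (fun _ : Fin s → Bool => V) (fun _ => -V) Finset.univ
    simp only [Finset.prod_const, add_neg_cancel] at this
    rw [← this, hcard]
    exact zero_pow (by positivity)
  rw [h1, ← sub_zero (∑ S ∈ _, _), ← h2, ← Finset.sum_sub_distrib]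
  refine (Finset.abs_sum_le_sum_abs _ _).trans ?_
  have h3 : ∀ S ∈ (Finset.univ : Finset (Fin s → Bool)).powerset,
      |((boxCount H (cubeRough m₀ r n W S) : ℝ) / (H : ℝ) ^ (2 * s))
          * (-V) ^ (Finset.univ \ S).card - V ^ S.card * (-V) ^ (Finset.univ \ S).card|
      ≤ V ^ 2 ^ s * δ := by
    intro S _
    rw [← sub_mul, abs_mul, abs_pow, abs_neg, abs_of_nonneg hV]
    have : S.card + (Finset.univ \ S).card = 2 ^ s := by
      rw [← hcard, add_comm]; exact Finset.card_sdiff_add_card_eq_card (Finset.subset_univ S)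
    calc _ ≤ V ^ S.card * δ * V ^ (Finset.univ \ S).card :=
          mul_le_mul_of_nonneg_right (h S) (by positivity)
      _ = _ := by rw [← this, pow_add]; ring
  refine (Finset.sum_le_sum h3).trans (le_of_eq ?_)
  rw [Finset.sum_const, Finset.card_powerset, hcard]
  push_cast [nsmul_eq_mul]
  ring

lemma norm_lineAverage_sub_le {H : ℕ} (hH : 0 < H) (s : ℕ) {S : ℕ → ℂ} {S₀ : ℂ} {c e : ℝ}
    (hc : 0 ≤ c) (h : ∀ t, ‖S t - S₀‖ ≤ c * t + e) : ‖lineAverage H s S - S₀‖ ≤ c * (s * H) + e := by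
  induction s generalizing S e with
  | zero => simpa [lineAverage] using h 0
  | succ s ih =>
    have hH' : (H : ℂ) ≠ 0 := by exact_mod_cast hH.ne'
    have hH0 : (0 : ℝ) < H := by exact_mod_cast hH
    have h1 : ∀ a ∈ Finset.range H, ‖lineAverage H s (fun t => S (t + a)) - S₀‖
        ≤ c * (s * H) + (c * H + e) := by
      intro a ha
      refine ih fun t => (h (t + a)).trans ?_
      have : (a : ℝ) ≤ H := by exact_mod_cast (Finset.mem_range.1 ha).le
      push_cast
      nlinarith
    have h2 : lineAverage H (s + 1) S - S₀
        = (H : ℂ)⁻¹ * ∑ a ∈ Finset.range H, (lineAverage H s (fun t => S (t + a)) - S₀) := by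
      rw [Finset.sum_sub_distrib, Finset.sum_const, Finset.card_range, nsmul_eq_mul, mul_sub,
        inv_mul_cancel_left₀ hH']
      rfl
    rw [h2, norm_mul, norm_inv, Complex.norm_natCast]
    have h3 := (norm_sum_le _ _).trans (Finset.sum_le_sum h1)
    rw [Finset.sum_const, Finset.card_range, nsmul_eq_mul] at h3
    rw [inv_mul_le_iff₀ hH0]
    refine h3.trans (le_of_eq ?_)
    push_cast
    ring

lemma norm_sum_shift_sub_le {f : ℕ → ℂ} (hf : ∀ n, ‖f n‖ ≤ 1) (a b h : ℕ) :
    ‖∑ n ∈ Finset.Ico a b, f (n + h) - ∑ n ∈ Finset.Ico a b, f n‖ ≤ 2 * h := by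
  induction h with
  | zero => simp
  | succ h ih =>
    have h1 : ‖∑ n ∈ Finset.Ico a b, f (n + (h + 1)) - ∑ n ∈ Finset.Ico a b, f (n + h)‖ ≤ 2 := by
      rw [← Finset.sum_sub_distrib]
      rcases le_or_gt a b with hab | hab
      · have : ∀ n, f (n + (h + 1)) - f (n + h) = (fun m => f (m + h)) (n + 1) - (fun m => f (m + h)) n := by
          intro n; simp only []; rw [show n + (h + 1) = n + 1 + h by ring]
        rw [Finset.sum_congr rfl fun n _ => this n, Finset.sum_Ico_sub (fun m => f (m + h)) hab]
        refine (norm_sub_le _ _).trans ?_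
        have := hf (b + h); have := hf (a + h)
        linarith
      · rw [Finset.Ico_eq_empty (by omega)]; simp
    have := norm_sub_le_norm_sub_add_norm_sub (∑ n ∈ Finset.Ico a b, f (n + (h + 1)))
      (∑ n ∈ Finset.Ico a b, f (n + h)) (∑ n ∈ Finset.Ico a b, f n)
    push_cast
    linarith

lemma norm_sum_sub_sum_lineAverage_le {f : ℕ → ℂ} (hf : ∀ n, ‖f n‖ ≤ 1) {H : ℕ} (hH : 0 < H)
    (a b s W : ℕ) :
    ‖∑ n ∈ Finset.Ico a b, lineAverage H s (fun t => f (n + W * t)) - ∑ n ∈ Finset.Ico a b, f n‖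
      ≤ 2 * W * (s * H) := by
  rw [← lineAverage_sum]
  have := norm_lineAverage_sub_le hH s (S := fun t => ∑ n ∈ Finset.Ico a b, f (n + W * t))
    (S₀ := ∑ n ∈ Finset.Ico a b, f n) (c := 2 * W) (e := 0) (by positivity) (fun t => by
      refine (norm_sum_shift_sub_le hf a b (W * t)).trans (le_of_eq ?_)
      push_cast; ring)
  linarith

/-- `n` has no prime factor `p ≤ z`. -/
def Rough (z n : ℕ) : Prop := ∀ p : ℕ, p.Prime → p ≤ z → ¬ p ∣ n

open Classical in
/-- Indicator of the integers without prime factors `p ≤ z`. -/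
noncomputable def roughInd (z n : ℕ) : ℝ := if Rough z n then 1 else 0

open Classical in
/-- Indicator of `blockRough`. -/
noncomputable def blockInd (m₀ r n : ℕ) : ℝ := if blockRough m₀ r n then 1 else 0

lemma roughInd_nonneg (z n : ℕ) : 0 ≤ roughInd z n := by unfold roughInd; split_ifs <;> simp

lemma roughInd_le_one (z n : ℕ) : roughInd z n ≤ 1 := by unfold roughInd; split_ifs <;> simp

lemma rough_iff (m₀ r n : ℕ) : Rough (2 ^ 2 ^ (m₀ + r)) n ↔
    n.Coprime (primorial (2 ^ 2 ^ m₀)) ∧ blockRough m₀ r n := by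
  have hmono := two_pow_two_pow_mono (Nat.le_add_right m₀ r)
  have hdvd : ∀ p : ℕ, p.Prime → (p ∣ primorial (2 ^ 2 ^ m₀) ↔ p ≤ 2 ^ 2 ^ m₀) := fun p hp =>
    hp.dvd_primorial_iff
  constructor
  · intro h
    refine ⟨?_, fun p hp => h p (mem_blockPrimes.1 hp).1 (mem_blockPrimes.1 hp).2.2⟩
    refine Nat.Coprime.symm (Nat.coprime_of_dvd fun p hp h1 h2 => ?_)
    exact h p hp (((hdvd p hp).1 h1).trans hmono) h2
  · rintro ⟨h1, h2⟩ p hp hpz hpn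
    rcases le_or_gt p (2 ^ 2 ^ m₀) with h | h
    · have := Nat.dvd_gcd hpn ((hdvd p hp).2 h)
      rw [h1] at this
      exact hp.one_lt.ne' (Nat.dvd_one.1 this)
    · exact h2 p (mem_blockPrimes.2 ⟨hp, h, hpz⟩) hpn

lemma roughInd_eq (m₀ r n : ℕ) : roughInd (2 ^ 2 ^ (m₀ + r)) n
    = if n.Coprime (primorial (2 ^ 2 ^ m₀)) then blockInd m₀ r n else 0 := by
  unfold roughInd blockInd
  by_cases h1 : n.Coprime (primorial (2 ^ 2 ^ m₀)) <;> by_cases h2 : blockRough m₀ r n <;>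
    simp [rough_iff, h1, h2]

lemma totient_primorial (n : ℕ) :
    ((primorial n).totient : ℝ) = primorial n * mertensProd n := by
  have h := Nat.totient_eq_mul_prod_factors (primorial n)
  have h2 : (primorial n).primeFactors = (n + 1).primesBelow := by
    ext p
    rw [Nat.mem_primeFactors, Nat.mem_primesBelow]
    constructor
    · rintro ⟨h1, h2, -⟩
      exact ⟨Nat.lt_succ_of_le (h1.dvd_primorial_iff.1 h2), h1⟩
    · rintro ⟨h1, h2⟩
      exact ⟨h2, h2.dvd_primorial_iff.2 (Nat.le_of_lt_succ h1), (primorial_pos n).ne'⟩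
  rw [h2] at h
  unfold mertensProd
  have h3 := congrArg (fun q : ℚ => (q : ℝ)) h
  push_cast at h3
  exact h3

/-- Bound for the line averages of the balanced sieve function twisted by a polynomial phase. -/
lemma norm_lineAverage_blockInd_le {d m₀ r n W H : ℕ} {η : ℝ} (hη : 0 ≤ η)
    (h : ∀ S : Finset (Fin (d + 1) → Bool),
      |(boxCount H (cubeRough m₀ r n W S) : ℝ) / (H : ℝ) ^ (2 * (d + 1)) - blockProd m₀ r ^ S.card|
        ≤ blockProd m₀ r ^ S.card * η ^ 2 ^ (d + 1)) {Q : Polynomial ℝ} (hQ : Q.natDegree ≤ d) :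
    ‖lineAverage H (d + 1) (fun t => ((blockInd m₀ r (n + W * t) - blockProd m₀ r : ℝ) : ℂ) *
      expi (Q.eval ((n + W * t : ℕ) : ℝ)))‖ ≤ 2 * η * blockProd m₀ r := by
  have hV := (blockProd_pos m₀ r).le
  refine le_of_pow_le_pow_left₀ (n := 2 ^ (d + 1)) (by positivity) (by positivity) ?_
  refine (norm_lineAverage_pow_le H d _).trans ?_
  set φ : Polynomial ℝ := Q.comp (Polynomial.C (W : ℝ) * Polynomial.X + Polynomial.C (n : ℝ)) with hφ
  have hφd : φ.natDegree ≤ d := by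
    rw [hφ]
    refine Polynomial.natDegree_comp_le.trans ?_
    have : (Polynomial.C (W : ℝ) * Polynomial.X + Polynomial.C (n : ℝ)).natDegree ≤ 1 :=
      Polynomial.natDegree_linear_le
    nlinarith
  have h1 : (fun t : ℕ => ((blockInd m₀ r (n + W * t) - blockProd m₀ r : ℝ) : ℂ) *
      expi (Q.eval ((n + W * t : ℕ) : ℝ)))
      = fun t : ℕ => (((fun t => blockInd m₀ r (n + W * t) - blockProd m₀ r) t : ℝ) : ℂ) *
        expi (φ.eval (t : ℝ)) := by
    funext t
    simp only [hφ, Polynomial.eval_comp, Polynomial.eval_add, Polynomial.eval_mul,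
      Polynomial.eval_C, Polynomial.eval_X]
    rw [add_comm ((W : ℝ) * t)]
    push_cast
    rfl
  rw [h1, boxAverage_phase H _ (hφd.trans (Nat.le_succ d)),
    Polynomial.coeff_eq_zero_of_natDegree_lt (Nat.lt_succ_of_le hφd), twistedBoxAverage_eq]
  simp only [mul_zero, zero_mul, expi_zero, mul_one]
  have h2 := abs_boxAverage_blockRough_le hV h
  refine le_trans (le_trans (le_of_eq ?_) (le_abs_self _)) (h2.trans (le_of_eq ?_))
  · rw [← Complex.ofReal_sum, ← Complex.ofReal_natCast, ← Complex.ofReal_pow, ← Complex.ofReal_inv,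
      ← Complex.ofReal_mul, Complex.ofReal_re]
    rfl
  · rw [mul_pow, mul_pow]; ring

lemma norm_sum_roughInd_sub_le {d m₀ r H : ℕ} {η : ℝ} (hη : 0 ≤ η) (hH : 0 < H)
    (h : ∀ n : ℕ, ∀ S : Finset (Fin (d + 1) → Bool),
      |(boxCount H (cubeRough m₀ r n (primorial (2 ^ 2 ^ m₀)) S) : ℝ) / (H : ℝ) ^ (2 * (d + 1))
          - blockProd m₀ r ^ S.card| ≤ blockProd m₀ r ^ S.card * η ^ 2 ^ (d + 1))
    {Q : Polynomial ℝ} (hQ : Q.natDegree ≤ d) (a L : ℕ) :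
    ‖∑ n ∈ Finset.Ico a (a + L), (roughInd (2 ^ 2 ^ (m₀ + r)) n : ℂ) * expi (Q.eval (n : ℝ))
      - blockProd m₀ r * ∑ n ∈ Finset.Ico a (a + L),
        (if n.Coprime (primorial (2 ^ 2 ^ m₀)) then expi (Q.eval (n : ℝ)) else 0)‖
      ≤ 2 * η * mertensProd (2 ^ 2 ^ (m₀ + r)) * (L + primorial (2 ^ 2 ^ m₀))
        + 2 * primorial (2 ^ 2 ^ m₀) * ((d + 1 : ℕ) * H) := by
  set W := primorial (2 ^ 2 ^ m₀) with hW
  have hWpos : 0 < W := primorial_pos _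
  have hV := blockProd_pos m₀ r
  have hV1 := blockProd_le_one m₀ r
  set f : ℕ → ℂ := fun n => if n.Coprime W then
    ((blockInd m₀ r n - blockProd m₀ r : ℝ) : ℂ) * expi (Q.eval (n : ℝ)) else 0 with hf
  have hf1 : ∀ n, ‖f n‖ ≤ 1 := by
    intro n
    simp only [hf]
    split_ifs
    · rw [norm_mul, norm_expi, mul_one, Complex.norm_real, Real.norm_eq_abs, abs_le]
      unfold blockInd
      split_ifs <;> constructor <;> linarith
    · simp
  have e1 : ∑ n ∈ Finset.Ico a (a + L), (roughInd (2 ^ 2 ^ (m₀ + r)) n : ℂ) * expi (Q.eval (n : ℝ))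
      - blockProd m₀ r * ∑ n ∈ Finset.Ico a (a + L),
        (if n.Coprime W then expi (Q.eval (n : ℝ)) else 0) = ∑ n ∈ Finset.Ico a (a + L), f n := by
    rw [Finset.mul_sum, ← Finset.sum_sub_distrib]
    refine Finset.sum_congr rfl fun n _ => ?_
    rw [roughInd_eq]
    simp only [hf, ← hW]
    split_ifs
    · push_cast; ring
    · simp
  rw [e1]
  have h1 := norm_sum_sub_sum_lineAverage_le hf1 hH a (a + L) (d + 1) W
  have h2 : ∀ n, ‖lineAverage H (d + 1) (fun t => f (n + W * t))‖
      ≤ if W.Coprime n then 2 * η * blockProd m₀ r else 0 := by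
    intro n
    have hc : ∀ t, (n + W * t).Coprime W ↔ W.Coprime n := by
      intro t
      rw [Nat.coprime_add_mul_left_left, Nat.coprime_comm]
    split_ifs with hn
    · have : (fun t => f (n + W * t)) = fun t => ((blockInd m₀ r (n + W * t) -
          blockProd m₀ r : ℝ) : ℂ) * expi (Q.eval ((n + W * t : ℕ) : ℝ)) := by
        funext t
        simp only [hf]
        rw [if_pos ((hc t).2 hn)]
      rw [this]
      exact norm_lineAverage_blockInd_le hη (h n) hQ
    · have : (fun t => f (n + W * t)) = fun t => (0 : ℂ) * (0 : ℂ) := by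
        funext t; simp [hf, hc, hn]
      rw [this, lineAverage_mul]
      simp
  have h3 : ‖∑ n ∈ Finset.Ico a (a + L), lineAverage H (d + 1) (fun t => f (n + W * t))‖
      ≤ 2 * η * mertensProd (2 ^ 2 ^ (m₀ + r)) * (L + W) := by
    refine (norm_sum_le _ _).trans ((Finset.sum_le_sum fun n _ => h2 n).trans ?_)
    rw [← Finset.sum_filter, Finset.sum_const, nsmul_eq_mul]
    have h4 : (((Finset.Ico a (a + L)).filter (fun n => W.Coprime n)).card : ℝ)
        ≤ W.totient * (L / W + 1) := by
      have h5 := Nat.Ico_filter_coprime_le a L hWpos.ne'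
      have h6 : ((L / W : ℕ) : ℝ) ≤ (L : ℝ) / W := Nat.cast_div_le
      have h7 : (((Finset.Ico a (a + L)).filter (fun n => W.Coprime n)).card : ℝ)
        ≤ W.totient * (((L / W : ℕ) : ℝ) + 1) := by exact_mod_cast h5
      exact h7.trans (by gcongr)
    refine (mul_le_mul_of_nonneg_right h4 (by positivity)).trans (le_of_eq ?_)
    rw [totient_primorial, mertensProd_eq, ← hW]
    have : (W : ℝ) ≠ 0 := by exact_mod_cast hWpos.ne'
    field_simp
  have h8 := norm_sub_norm_le (∑ n ∈ Finset.Ico a (a + L), f n)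
    (∑ n ∈ Finset.Ico a (a + L), lineAverage H (d + 1) (fun t => f (n + W * t)))
  rw [norm_sub_rev] at h8
  linarith

/-- For `z = 2 ^ 2 ^ (m₀ + r)` with `r ≥ M`, the indicator of the `z`-rough numbers may be replaced
by a density times a coprimality condition modulo a fixed integer, uniformly over intervals of
length `≫ z ^ u` and over polynomial phases of degree at most `d`, up to a relative error `η`. -/
def RoughModel (d u m₀ M : ℕ) (η : ℝ) : Prop :=
  ∀ r ≥ M, primorial (2 ^ 2 ^ m₀) ≤ 2 ^ 2 ^ (m₀ + r) ∧ ∀ K : ℕ, (2 ^ 2 ^ (m₀ + r)) ^ u ≤ K →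
    ∀ a L : ℕ, L ≤ 4 * K → ∀ Q : Polynomial ℝ, Q.natDegree ≤ d →
    ‖∑ n ∈ Finset.Ico a (a + L), (roughInd (2 ^ 2 ^ (m₀ + r)) n : ℂ) * expi (Q.eval (n : ℝ))
      - blockProd m₀ r * ∑ n ∈ Finset.Ico a (a + L),
        (if n.Coprime (primorial (2 ^ 2 ^ m₀)) then expi (Q.eval (n : ℝ)) else 0)‖
      ≤ η * (mertensProd (2 ^ 2 ^ (m₀ + r)) * K)

/-- Fundamental lemma of the sieve twisted by polynomial phases. -/
lemma exists_roughModel (d A u₁ : ℕ) :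
    ∃ u ≥ u₁, ∃ m₀ M : ℕ, RoughModel d u m₀ M (1 / (u : ℝ) ^ A) := by
  set κ := 2 ^ (d + 1) with hκ
  have hκ0 : 0 < 2 ^ (d + 1) := by positivity
  obtain ⟨b, ⟨m₀, r₀, hb⟩, hb2⟩ := ((cube_sieve (Nat.succ_pos d) ((A + 1) * κ)).and
    (eventually_ge_atTop (u₁ + κ + 16 + 11 * 10 ^ A))).exists
  set u := 8 * b + 16 + κ with hu
  have hub : u ≤ 10 * b := by omega
  have hb0 : (0 : ℝ) < b := by
    have : 0 < b := by omega
    exact_mod_cast this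
  set W := primorial (2 ^ 2 ^ m₀) with hW
  have hub' : 11 * (u : ℝ) ^ A ≤ (b : ℝ) ^ (A + 1) := by
    have h1 : (u : ℝ) ≤ 10 * b := by exact_mod_cast hub
    have h2 : (11 * 10 ^ A : ℝ) ≤ b := by exact_mod_cast (show 11 * 10 ^ A ≤ b by omega)
    calc 11 * (u : ℝ) ^ A ≤ 11 * (10 * b : ℝ) ^ A := by gcongr
      _ = (11 * 10 ^ A) * (b : ℝ) ^ A := by rw [mul_pow]; ring
      _ ≤ b * (b : ℝ) ^ A := by gcongr
      _ = _ := by ring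
  have hu0 : (0 : ℝ) < u := by
    have : 0 < u := by omega
    exact_mod_cast this
  refine ⟨u, by omega, m₀, max r₀ (22 * W * (d + 1) * u ^ A + W), fun r hr => ?_⟩
  have hr0 : r₀ ≤ r := (le_max_left _ _).trans hr
  have hr1 : 22 * W * (d + 1) * u ^ A + W ≤ r := (le_max_right _ _).trans hr
  set z : ℕ := 2 ^ 2 ^ (m₀ + r) with hz
  have hz1 : 1 ≤ z := Nat.one_le_two_pow
  have hrz : r ≤ z := by
    have a1 : r < 2 ^ r := Nat.lt_two_pow_self
    have a2 : 2 ^ r ≤ 2 ^ (m₀ + r) := Nat.pow_le_pow_right (by norm_num) (by omega)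
    have a3 : 2 ^ (m₀ + r) < z := Nat.lt_two_pow_self
    omega
  refine ⟨by omega, fun K hK a L hL Q hQ => ?_⟩
  set H := z ^ (8 * b + 14 + κ) with hH
  have hHpos : 0 < H := by positivity
  have key := norm_sum_roughInd_sub_le (d := d) (m₀ := m₀) (r := r) (η := 1 / (b : ℝ) ^ (A + 1))
    (by positivity) hHpos (fun n S => by
      have := hb r hr0 H n W (fun p hp h1 h2 => by
        have := hp.dvd_primorial_iff.1 h2
        omega) le_rfl S
      refine this.trans (le_of_eq ?_)
      rw [div_pow, one_pow, ← pow_mul]) hQ a L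
  rw [← hW] at key
  refine key.trans ?_
  set V := mertensProd z with hV
  have hVz : 1 / (z : ℝ) ≤ V := one_div_le_mertensProd hz1
  have hV0 : 0 < V := mertensProd_pos z
  have hKH : (H : ℝ) * z * z ≤ K := by
    have : H * z * z ≤ K := by
      refine le_trans (le_of_eq ?_) hK
      rw [hH, hu]; ring
    exact_mod_cast this
  have hzR : (1 : ℝ) ≤ z := by exact_mod_cast hz1
  have hHR : (1 : ℝ) ≤ H := by exact_mod_cast hHpos
  have hWK : (W : ℝ) ≤ K := by
    have : (W : ℝ) ≤ z := by exact_mod_cast (show W ≤ z by omega)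
    nlinarith [mul_le_mul hHR hzR (by positivity) (by positivity)]
  have hLK : (L : ℝ) ≤ 4 * K := by exact_mod_cast hL
  have hVK : (H : ℝ) * z ≤ V * K := by
    calc (H : ℝ) * z = 1 / z * (H * z * z) := by field_simp
      _ ≤ V * K := by gcongr
  have hzbig : 22 * (W : ℝ) * (d + 1) * u ^ A ≤ z := by
    exact_mod_cast (show 22 * W * (d + 1) * u ^ A ≤ z by omega)
  have hη : 1 / (b : ℝ) ^ (A + 1) ≤ 1 / 11 * (1 / (u : ℝ) ^ A) := by
    rw [div_mul_div_comm, one_mul]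
    exact one_div_le_one_div_of_le (by positivity) hub'
  have t1 : 2 * (1 / (b : ℝ) ^ (A + 1)) * V * (L + W) ≤ 10 / 11 * (1 / (u : ℝ) ^ A) * (V * K) := by
    calc 2 * (1 / (b : ℝ) ^ (A + 1)) * V * (L + W)
        ≤ 2 * (1 / 11 * (1 / (u : ℝ) ^ A)) * V * (4 * K + K) := by gcongr
      _ = _ := by ring
  have t2 : 2 * (W : ℝ) * ((d + 1 : ℕ) * H) ≤ 1 / 11 * (1 / (u : ℝ) ^ A) * (V * K) := by
    calc 2 * (W : ℝ) * ((d + 1 : ℕ) * H)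
        = 1 / 11 * (1 / (u : ℝ) ^ A) * (H * (22 * (W : ℝ) * (d + 1) * u ^ A)) := by
          push_cast
          field_simp
          ring
      _ ≤ 1 / 11 * (1 / (u : ℝ) ^ A) * (V * K) := by
          refine mul_le_mul_of_nonneg_left (le_trans ?_ hVK) (by positivity)
          gcongr
  linarith

lemma expi_ne_one {β : ℝ} (hβ : Irrational β) : expi β ≠ 1 := by
  intro h
  unfold expi at h
  rw [Complex.exp_eq_one_iff] at h
  obtain ⟨n, hn⟩ := h
  have h2 : (β : ℂ) = n := by
    have : (2 * Real.pi * Complex.I : ℂ) ≠ 0 := Complex.two_pi_I_ne_zero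
    refine mul_right_cancel₀ this ?_
    rw [← hn]; ring
  exact hβ.ne_int n (by exact_mod_cast h2)

lemma expi_nat_mul (β : ℝ) (n : ℕ) : expi (β * n) = expi β ^ n := by
  induction n with
  | zero => simp [expi_zero]
  | succ n ih => rw [pow_succ, ← ih, ← expi_add]; congr 1; push_cast; ring

lemma norm_sum_expi_linear_le {β : ℝ} (hβ : Irrational β) (c : ℝ) (a L : ℕ) :
    ‖∑ n ∈ Finset.Ico a (a + L), expi (β * n + c)‖ ≤ 2 / ‖expi β - 1‖ := by
  have h1 : ∑ n ∈ Finset.Ico a (a + L), expi (β * n + c)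
      = ((expi β ^ (a + L) - expi β ^ a) / (expi β - 1)) * expi c := by
    rw [← geom_sum_Ico (expi_ne_one hβ) (Nat.le_add_right a L), Finset.sum_mul]
    exact Finset.sum_congr rfl fun n _ => by rw [expi_add, expi_nat_mul]
  rw [h1, norm_mul, norm_expi, mul_one, norm_div]
  refine div_le_div_of_nonneg_right ?_ (norm_nonneg _)
  refine (norm_sub_le _ _).trans ?_
  rw [norm_pow, norm_pow, norm_expi]
  norm_num

lemma sq_norm_average_eq (H : ℕ) (f : ℕ → ℂ) :
    ((‖(H : ℂ)⁻¹ * ∑ a ∈ Finset.range H, f a‖ ^ 2 : ℝ) : ℂ)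
      = ((H : ℂ) ^ 2)⁻¹ * ∑ a ∈ Finset.range H, ∑ b ∈ Finset.range H, f a * starRingEnd ℂ (f b) := by
  rw [← Complex.normSq_eq_norm_sq, ← Complex.mul_conj, map_mul, map_inv₀, Complex.conj_natCast, map_sum,
    mul_mul_mul_comm, Finset.sum_mul_sum, ← mul_inv, sq]

/-- Van der Corput's inequality. -/
lemma norm_sum_sq_le_vdC {f : ℕ → ℂ} (hf : ∀ n, ‖f n‖ ≤ 1) {H : ℕ} (hH : 0 < H) (a L : ℕ) :
    ‖∑ n ∈ Finset.Ico a (a + L), f n‖ ≤ 2 * H + Real.sqrt (L * (((H : ℝ) ^ 2)⁻¹ *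
      ∑ i ∈ Finset.range H, ∑ j ∈ Finset.range H,
        ‖∑ n ∈ Finset.Ico a (a + L), f (n + i) * starRingEnd ℂ (f (n + j))‖)) := by
  have h1 := norm_sum_sub_sum_lineAverage_le hf hH a (a + L) 1 1
  have h2 : ∀ n, lineAverage H 1 (fun t => f (n + 1 * t))
      = (H : ℂ)⁻¹ * ∑ i ∈ Finset.range H, f (n + i) := by
    intro n; simp [lineAverage]
  simp only [h2] at h1
  set g : ℕ → ℂ := fun n => (H : ℂ)⁻¹ * ∑ i ∈ Finset.range H, f (n + i) with hg
  have h3 : ‖∑ n ∈ Finset.Ico a (a + L), g n‖ ≤ Real.sqrt (L * (((H : ℝ) ^ 2)⁻¹ *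
      ∑ i ∈ Finset.range H, ∑ j ∈ Finset.range H,
        ‖∑ n ∈ Finset.Ico a (a + L), f (n + i) * starRingEnd ℂ (f (n + j))‖)) := by
    refine (norm_sum_le _ _).trans (Real.le_sqrt_of_sq_le ?_)
    refine (sq_sum_le_card_mul_sum_sq).trans ?_
    rw [Nat.card_Ico, Nat.add_sub_cancel_left]
    refine mul_le_mul_of_nonneg_left ?_ (by positivity)
    have h4 : ((∑ n ∈ Finset.Ico a (a + L), ‖g n‖ ^ 2 : ℝ) : ℂ) = ((H : ℂ) ^ 2)⁻¹ *
        ∑ i ∈ Finset.range H, ∑ j ∈ Finset.range H,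
          ∑ n ∈ Finset.Ico a (a + L), f (n + i) * starRingEnd ℂ (f (n + j)) := by
      rw [Complex.ofReal_sum, Finset.sum_congr rfl fun n _ => sq_norm_average_eq H fun i => f (n + i),
        ← Finset.mul_sum, Finset.sum_comm]
      congr 1
      exact Finset.sum_congr rfl fun i _ => Finset.sum_comm
    have h5 : (∑ n ∈ Finset.Ico a (a + L), ‖g n‖ ^ 2 : ℝ)
        = ‖((∑ n ∈ Finset.Ico a (a + L), ‖g n‖ ^ 2 : ℝ) : ℂ)‖ := by
      rw [Complex.norm_real, Real.norm_eq_abs, abs_of_nonneg (by positivity)]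
    rw [h5, h4, norm_mul, norm_inv, norm_pow, Complex.norm_natCast]
    refine mul_le_mul_of_nonneg_left ?_ (by positivity)
    exact (norm_sum_le _ _).trans (Finset.sum_le_sum fun i _ => norm_sum_le _ _)
  have h6 := norm_sub_norm_le (∑ n ∈ Finset.Ico a (a + L), f n) (∑ n ∈ Finset.Ico a (a + L), g n)
  rw [norm_sub_rev] at h6
  push_cast at h1
  linarith

/-- Weyl's theorem, uniformly over polynomials with a given irrational leading coefficient. -/
lemma weyl_sum (d : ℕ) {β : ℝ} (hβ : Irrational β) {ε : ℝ} (hε : 0 < ε) :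
    ∃ C : ℝ, 0 ≤ C ∧ ∀ Q : Polynomial ℝ, Q.natDegree ≤ d + 1 → Q.coeff (d + 1) = β → ∀ a L : ℕ,
      ‖∑ n ∈ Finset.Ico a (a + L), expi (Q.eval (n : ℝ))‖ ≤ ε * L + C := by
  induction d generalizing β ε with
  | zero =>
    refine ⟨2 / ‖expi β - 1‖, by positivity, fun Q hQ hc a L => ?_⟩
    rw [Polynomial.eq_X_add_C_of_natDegree_le_one hQ]
    simp only [Polynomial.eval_add, Polynomial.eval_mul, Polynomial.eval_C, Polynomial.eval_X]
    rw [show Q.coeff 1 = β from hc]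
    have := norm_sum_expi_linear_le hβ (Q.coeff 0) a L
    have : 0 ≤ ε * L := by positivity
    linarith
  | succ d ih =>
    obtain ⟨H, hH⟩ := exists_nat_gt (8 / ε ^ 2)
    have hH0 : (0 : ℝ) < H := lt_trans (by positivity) hH
    have hHpos : 0 < H := by exact_mod_cast hH0
    have hir : ∀ i j : ℕ, i ≠ j → Irrational (((d + 1 : ℕ) + 1 : ℝ) * β * ((i : ℝ) - j)) := by
      intro i j hij
      have h1 : ((d + 1 : ℕ) + 1 : ℝ) * β * ((i : ℝ) - j) = β * (((d + 1 + 1 : ℕ) * ((i : ℤ) - j) : ℤ) : ℝ) := by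
        push_cast; ring
      rw [h1]
      refine hβ.mul_intCast ?_
      refine mul_ne_zero (by positivity) ?_
      rw [sub_ne_zero]; exact_mod_cast hij
    have hC : ∀ i j : ℕ, ∃ C : ℝ, 0 ≤ C ∧ (i ≠ j → ∀ Q : Polynomial ℝ, Q.natDegree ≤ d + 1 →
        Q.coeff (d + 1) = ((d + 1 : ℕ) + 1 : ℝ) * β * ((i : ℝ) - j) → ∀ a L : ℕ,
        ‖∑ n ∈ Finset.Ico a (a + L), expi (Q.eval (n : ℝ))‖ ≤ (ε ^ 2 / 8) * L + C) := by
      intro i j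
      by_cases hij : i = j
      · exact ⟨0, le_rfl, fun h => (h hij).elim⟩
      · obtain ⟨C, hC0, hC⟩ := ih (hir i j hij) (ε := ε ^ 2 / 8) (by positivity)
        exact ⟨C, hC0, fun _ => hC⟩
    choose C hC0 hC using hC
    set D := ∑ i ∈ Finset.range H, ∑ j ∈ Finset.range H, C i j with hD
    have hD0 : 0 ≤ D := Finset.sum_nonneg fun i _ => Finset.sum_nonneg fun j _ => hC0 i j
    refine ⟨2 * H + D / ε, by positivity, fun Q hQ hc a L => ?_⟩
    refine (norm_sum_sq_le_vdC (fun n => (norm_expi _).le) hHpos a L).trans ?_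
    have h1 : ∀ i j n : ℕ, expi (Q.eval ((n + i : ℕ) : ℝ)) * starRingEnd ℂ (expi (Q.eval ((n + j : ℕ) : ℝ)))
        = expi ((shiftDiff Q i j).eval (n : ℝ)) := by
      intro i j n
      rw [conj_expi, ← expi_add, eval_shiftDiff]
      push_cast
      rw [sub_eq_add_neg]
    simp only [h1]
    have h2 : ∀ i ∈ Finset.range H, ∀ j ∈ Finset.range H,
        ‖∑ n ∈ Finset.Ico a (a + L), expi ((shiftDiff Q i j).eval (n : ℝ))‖
        ≤ (if i = j then (L : ℝ) else 0) + ((ε ^ 2 / 8) * L + C i j) := by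
      intro i _ j _
      split_ifs with hij
      · have : ‖∑ n ∈ Finset.Ico a (a + L), expi ((shiftDiff Q i j).eval (n : ℝ))‖ ≤ L := by
          refine (norm_sum_le _ _).trans ?_
          simp [norm_expi]
        have := hC0 i j
        have : 0 ≤ (ε ^ 2 / 8) * (L : ℝ) := by positivity
        linarith
      · rw [zero_add]
        refine hC i j hij _ (natDegree_shiftDiff_le hQ _ _) ?_ a L
        rw [coeff_shiftDiff hQ, hc]
    have h3 : ((H : ℝ) ^ 2)⁻¹ * ∑ i ∈ Finset.range H, ∑ j ∈ Finset.range H,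
        ‖∑ n ∈ Finset.Ico a (a + L), expi ((shiftDiff Q i j).eval (n : ℝ))‖ ≤ ε ^ 2 / 4 * L + D := by
      have h4 := Finset.sum_le_sum fun i hi => Finset.sum_le_sum (h2 i hi)
      rw [inv_mul_le_iff₀ (by positivity)]
      refine h4.trans ?_
      simp only [Finset.sum_add_distrib, Finset.sum_ite_eq, Finset.mem_range]
      rw [← hD, Finset.sum_congr rfl fun i hi => if_pos (Finset.mem_range.1 hi)]
      simp only [Finset.sum_const, Finset.card_range, nsmul_eq_mul]
      have hL0 : (0 : ℝ) ≤ L := by positivity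
      have hH1 : (1 : ℝ) ≤ H := by exact_mod_cast hHpos
      have h5 : (H : ℝ) ≤ H ^ 2 * (ε ^ 2 / 8) := by
        rw [div_lt_iff₀ (by positivity)] at hH
        nlinarith
      have h6 : (H : ℝ) * L ≤ H ^ 2 * (ε ^ 2 / 8) * L := by gcongr
      have h7 : D ≤ (H : ℝ) ^ 2 * D := by
        have : (1 : ℝ) ≤ H ^ 2 := one_le_pow₀ hH1
        nlinarith
      nlinarith
    have h8 : Real.sqrt (L * (((H : ℝ) ^ 2)⁻¹ * ∑ i ∈ Finset.range H, ∑ j ∈ Finset.range H,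
        ‖∑ n ∈ Finset.Ico a (a + L), expi ((shiftDiff Q i j).eval (n : ℝ))‖)) ≤ ε * L + D / ε := by
      refine Real.sqrt_le_iff.2 ⟨by positivity, ?_⟩
      refine (mul_le_mul_of_nonneg_left h3 (by positivity)).trans ?_
      have h9 : (ε * L + D / ε) ^ 2 = ε ^ 2 * L ^ 2 + 2 * L * D + (D / ε) ^ 2 := by
        field_simp; ring
      rw [h9]
      have : 0 ≤ ε ^ 2 * (L : ℝ) ^ 2 := by positivity
      have : 0 ≤ (L : ℝ) * D := by positivity
      have : 0 ≤ (D / ε) ^ 2 := by positivity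
      nlinarith
    linarith

/-- The polynomial `Q (n + W * X)`. -/
noncomputable def affineComp (Q : Polynomial ℝ) (n W : ℝ) : Polynomial ℝ :=
  (Polynomial.taylor n Q).comp (Polynomial.C W * Polynomial.X)

lemma eval_affineComp (Q : Polynomial ℝ) (n W t : ℝ) :
    (affineComp Q n W).eval t = Q.eval (n + W * t) := by
  simp [affineComp, Polynomial.taylor_eval, add_comm]

lemma natDegree_affineComp_le {Q : Polynomial ℝ} {d : ℕ} (h : Q.natDegree ≤ d) (n W : ℝ) :
    (affineComp Q n W).natDegree ≤ d := by
  refine Polynomial.natDegree_comp_le.trans ?_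
  rw [Polynomial.natDegree_taylor]
  have h1 : (Polynomial.C W * Polynomial.X).natDegree ≤ 1 :=
    (Polynomial.natDegree_C_mul_le _ _).trans Polynomial.natDegree_X_le
  nlinarith

lemma coeff_affineComp {Q : Polynomial ℝ} {d : ℕ} (h : Q.natDegree ≤ d) (n W : ℝ) :
    (affineComp Q n W).coeff d = Q.coeff d * W ^ d := by
  rw [affineComp, Polynomial.comp_C_mul_X_coeff, Polynomial.taylor_coeff]
  have h1 : (Polynomial.hasseDeriv d Q).natDegree = 0 := by
    have := Polynomial.natDegree_hasseDeriv_le Q d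
    omega
  rw [Polynomial.eq_C_of_natDegree_eq_zero h1]
  simp [Polynomial.hasseDeriv_coeff]

/-- Weyl sums restricted to integers coprime to a fixed modulus. -/
lemma weyl_sum_coprime (d : ℕ) {β : ℝ} (hβ : Irrational β) {W : ℕ} (hW : 0 < W) {ε : ℝ} (hε : 0 < ε) :
    ∃ C : ℝ, 0 ≤ C ∧ ∀ Q : Polynomial ℝ, Q.natDegree ≤ d + 1 → Q.coeff (d + 1) = β → ∀ a L : ℕ,
      ‖∑ n ∈ Finset.Ico a (a + L), (if n.Coprime W then expi (Q.eval (n : ℝ)) else 0)‖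
        ≤ ε * L + C := by
  have hir : Irrational (β * ((W ^ (d + 1) : ℕ) : ℝ)) := hβ.mul_natCast (by positivity)
  obtain ⟨C, hC0, hC⟩ := weyl_sum d hir (half_pos hε)
  obtain ⟨T, hT⟩ := exists_nat_gt (2 * C / ε)
  have hT0 : (0 : ℝ) < T := lt_of_le_of_lt (by positivity) hT
  have hTpos : 0 < T := by exact_mod_cast hT0
  refine ⟨2 * W * T, by positivity, fun Q hQ hc a L => ?_⟩
  set f : ℕ → ℂ := fun n => if n.Coprime W then expi (Q.eval (n : ℝ)) else 0 with hf
  have hf1 : ∀ n, ‖f n‖ ≤ 1 := by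
    intro n; simp only [hf]; split_ifs
    · exact (norm_expi _).le
    · simp
  have h1 := norm_sum_sub_sum_lineAverage_le hf1 hTpos a (a + L) 1 W
  have h2 : ∀ n, ‖lineAverage T 1 (fun t => f (n + W * t))‖ ≤ ε := by
    intro n
    have hcop : ∀ t, (n + W * t).Coprime W ↔ n.Coprime W := by
      intro t
      rw [Nat.coprime_add_mul_left_left]
    by_cases hn : n.Coprime W
    · set φ : Polynomial ℝ := affineComp Q n W with hφ
      have hφd : φ.natDegree ≤ d + 1 := natDegree_affineComp_le hQ _ _
      have hφc : φ.coeff (d + 1) = β * ((W ^ (d + 1) : ℕ) : ℝ) := by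
        rw [hφ, coeff_affineComp hQ, hc]
        push_cast
        ring
      have h3 := hC φ hφd hφc 0 T
      have h4 : lineAverage T 1 (fun t => f (n + W * t))
          = (T : ℂ)⁻¹ * ∑ t ∈ Finset.Ico 0 (0 + T), expi (φ.eval (t : ℝ)) := by
        rw [zero_add, ← Finset.range_eq_Ico]
        simp only [lineAverage, zero_add]
        congr 1
        refine Finset.sum_congr rfl fun t _ => ?_
        simp only [hf]
        rw [if_pos ((hcop t).2 hn)]
        rw [hφ, eval_affineComp]
        push_cast
        rfl
      rw [h4, norm_mul, norm_inv, Complex.norm_natCast, inv_mul_le_iff₀ hT0]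
      refine h3.trans ?_
      rw [div_lt_iff₀ hε] at hT
      linarith
    · have : (fun t => f (n + W * t)) = fun t => (0 : ℂ) * (0 : ℂ) := by
        funext t; simp [hf, hcop, hn]
      rw [this, lineAverage_mul]
      simpa using hε.le
  have h3 : ‖∑ n ∈ Finset.Ico a (a + L), lineAverage T 1 (fun t => f (n + W * t))‖ ≤ ε * L := by
    refine (norm_sum_le _ _).trans ((Finset.sum_le_sum fun n _ => h2 n).trans (le_of_eq ?_))
    simp [mul_comm]
  have h8 := norm_sub_norm_le (∑ n ∈ Finset.Ico a (a + L), f n)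
    (∑ n ∈ Finset.Ico a (a + L), lineAverage T 1 (fun t => f (n + W * t)))
  rw [norm_sub_rev] at h8
  push_cast at h1
  linarith

lemma eventually_le_two_pow_two_pow (C : ℝ) (m₀ : ℕ) :
    ∀ᶠ r : ℕ in atTop, C ≤ ((2 ^ 2 ^ (m₀ + r) : ℕ) : ℝ) := by
  obtain ⟨n, hn⟩ := exists_nat_ge C
  filter_upwards [eventually_ge_atTop n] with r hr
  have h1 : r < 2 ^ 2 ^ (m₀ + r) := by
    have h2 : m₀ + r < 2 ^ (m₀ + r) := Nat.lt_two_pow_self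
    have h3 : 2 ^ (m₀ + r) < 2 ^ 2 ^ (m₀ + r) := Nat.lt_two_pow_self
    omega
  refine hn.trans ?_
  exact_mod_cast hr.trans h1.le

lemma card_coprime_primorial_le (w a L : ℕ) :
    (((Finset.Ico a (a + L)).filter (fun n => n.Coprime (primorial w))).card : ℝ)
      ≤ mertensProd w * (L + primorial w) := by
  set W := primorial w with hW
  have hWpos : 0 < W := primorial_pos _
  have h5 := Nat.Ico_filter_coprime_le a L hWpos.ne'
  have h6 : ((L / W : ℕ) : ℝ) ≤ (L : ℝ) / W := Nat.cast_div_le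
  have h7 : (((Finset.Ico a (a + L)).filter (fun n => n.Coprime W)).card : ℝ)
      ≤ W.totient * (((L / W : ℕ) : ℝ) + 1) := by
    have h8 : (Finset.Ico a (a + L)).filter (fun n => n.Coprime W)
        = (Finset.Ico a (a + L)).filter (fun n => W.Coprime n) :=
      Finset.filter_congr fun n _ => Nat.coprime_comm
    rw [h8]
    exact_mod_cast h5
  refine h7.trans ?_
  have h8 : (W.totient : ℝ) * (((L / W : ℕ) : ℝ) + 1) ≤ W.totient * ((L : ℝ) / W + 1) := by gcongr
  refine h8.trans (le_of_eq ?_)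
  rw [totient_primorial, ← hW]
  have : (W : ℝ) ≠ 0 := by exact_mod_cast hWpos.ne'
  field_simp

lemma RoughModel.blockProd_mul_card_le {d u m₀ M : ℕ} {η : ℝ} (h : RoughModel d u m₀ M η) (hu : u ≠ 0)
    {r : ℕ} (hr : M ≤ r) {K : ℕ} (hK : (2 ^ 2 ^ (m₀ + r)) ^ u ≤ K) {a L : ℕ} (hL : L ≤ 4 * K) :
    blockProd m₀ r * (((Finset.Ico a (a + L)).filter
      (fun n => n.Coprime (primorial (2 ^ 2 ^ m₀)))).card : ℝ)
      ≤ 5 * (mertensProd (2 ^ 2 ^ (m₀ + r)) * K) := by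
  have h1 := card_coprime_primorial_le (2 ^ 2 ^ m₀) a L
  have hb := blockProd_pos m₀ r
  have h2 : primorial (2 ^ 2 ^ m₀) ≤ K := ((h r hr).1.trans (Nat.le_self_pow hu _)).trans hK
  have h3 : ((L : ℝ) + primorial (2 ^ 2 ^ m₀)) ≤ 5 * K := by
    have h4 : L + primorial (2 ^ 2 ^ m₀) ≤ 5 * K := by omega
    exact_mod_cast h4
  have h5 := mertensProd_pos (2 ^ 2 ^ m₀)
  calc _ ≤ blockProd m₀ r * (mertensProd (2 ^ 2 ^ m₀) * (5 * K)) := by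
        refine mul_le_mul_of_nonneg_left (h1.trans ?_) hb.le
        gcongr
    _ = _ := by rw [mertensProd_eq]; ring

lemma RoughModel.sum_roughInd_le {d u m₀ M : ℕ} {η : ℝ} (h : RoughModel d u m₀ M η) (hη : η ≤ 1)
    (hu : u ≠ 0) {r : ℕ} (hr : M ≤ r) {K : ℕ} (hK : (2 ^ 2 ^ (m₀ + r)) ^ u ≤ K) (a : ℕ) {L : ℕ}
    (hL : L ≤ 4 * K) :
    ∑ n ∈ Finset.Ico a (a + L), roughInd (2 ^ 2 ^ (m₀ + r)) n
      ≤ 6 * (mertensProd (2 ^ 2 ^ (m₀ + r)) * K) := by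
  have h1 := (h r hr).2 K hK a L hL 0 (by simp)
  have h2 := h.blockProd_mul_card_le hu hr hK (a := a) hL
  simp only [Polynomial.eval_zero, expi_zero, mul_one] at h1
  rw [← Finset.sum_filter, Finset.sum_const, nsmul_eq_mul, mul_one] at h1
  have h3 := norm_sub_norm_le (∑ n ∈ Finset.Ico a (a + L), (roughInd (2 ^ 2 ^ (m₀ + r)) n : ℂ))
    ((blockProd m₀ r : ℂ) * (((Finset.Ico a (a + L)).filter
      (fun n => n.Coprime (primorial (2 ^ 2 ^ m₀)))).card : ℂ))
  rw [norm_mul, Complex.norm_real, Complex.norm_natCast, Real.norm_eq_abs,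
    abs_of_pos (blockProd_pos _ _), ← Complex.ofReal_sum, Complex.norm_real, Real.norm_eq_abs,
    abs_of_nonneg (Finset.sum_nonneg fun n _ => roughInd_nonneg _ n)] at h3
  rw [← Complex.ofReal_sum] at h1
  have h4 : η * (mertensProd (2 ^ 2 ^ (m₀ + r)) * K) ≤ 1 * (mertensProd (2 ^ 2 ^ (m₀ + r)) * K) :=
    mul_le_mul_of_nonneg_right hη (mul_nonneg (mertensProd_pos _).le (Nat.cast_nonneg _))
  linarith

/-- Polynomial phases with a given irrational leading coefficient have little correlation with the
rough numbers. -/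
lemma RoughModel.norm_sum_irrational_le {D u m₀ M : ℕ} {η : ℝ} (h : RoughModel (D + 1) u m₀ M η)
    (hη : 0 < η) (hu : u ≠ 0) {β : ℝ} (hβ : Irrational β) :
    ∀ᶠ r in atTop, ∀ K : ℕ, (2 ^ 2 ^ (m₀ + r)) ^ u ≤ K → ∀ a L : ℕ, L ≤ 4 * K →
      ∀ Q : Polynomial ℝ, Q.natDegree ≤ D + 1 → Q.coeff (D + 1) = β →
      ‖∑ n ∈ Finset.Ico a (a + L), (roughInd (2 ^ 2 ^ (m₀ + r)) n : ℂ) * expi (Q.eval (n : ℝ))‖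
        ≤ 2 * η * (mertensProd (2 ^ 2 ^ (m₀ + r)) * K) := by
  have hm := mertensProd_pos (2 ^ 2 ^ m₀)
  obtain ⟨C, hC0, hC⟩ := weyl_sum_coprime D hβ (primorial_pos (2 ^ 2 ^ m₀))
    (ε := η * mertensProd (2 ^ 2 ^ m₀) / 8) (by positivity)
  filter_upwards [eventually_ge_atTop M,
    eventually_le_two_pow_two_pow (C / (η * mertensProd (2 ^ 2 ^ m₀) / 2)) m₀]
    with r hr hr2 K hK a L hL Q hQ hc
  have h1 := (h r hr).2 K hK a L hL Q hQ
  have h2 := hC Q hQ hc a L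
  have hb := blockProd_pos m₀ r
  have hKz : ((2 ^ 2 ^ (m₀ + r) : ℕ) : ℝ) ≤ K := by
    exact_mod_cast (Nat.le_self_pow hu _).trans hK
  have h3 : C ≤ K * (η * mertensProd (2 ^ 2 ^ m₀) / 2) := by
    rw [div_le_iff₀ (by positivity)] at hr2
    exact hr2.trans (by gcongr)
  have h4 : (L : ℝ) ≤ 4 * K := by exact_mod_cast hL
  set s := ∑ n ∈ Finset.Ico a (a + L),
    (if n.Coprime (primorial (2 ^ 2 ^ m₀)) then expi (Q.eval (n : ℝ)) else 0) with hs
  have h5 : ‖(blockProd m₀ r : ℂ) * s‖ ≤ η * (mertensProd (2 ^ 2 ^ (m₀ + r)) * K) := by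
    rw [norm_mul, Complex.norm_real, Real.norm_eq_abs, abs_of_pos hb, mertensProd_eq]
    have h6 : ‖s‖ ≤ η * mertensProd (2 ^ 2 ^ m₀) * K := by
      refine h2.trans ?_
      have : η * mertensProd (2 ^ 2 ^ m₀) / 8 * L ≤ η * mertensProd (2 ^ 2 ^ m₀) / 8 * (4 * K) := by
        gcongr
      linarith
    calc _ ≤ blockProd m₀ r * (η * mertensProd (2 ^ 2 ^ m₀) * K) := by gcongr
      _ = _ := by ring
  have h7 := norm_sub_norm_le (∑ n ∈ Finset.Ico a (a + L),
    (roughInd (2 ^ 2 ^ (m₀ + r)) n : ℂ) * expi (Q.eval (n : ℝ))) ((blockProd m₀ r : ℂ) * s)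
  linarith

/-- The cube average of the phase `c * t ^ d / d!`. -/
noncomputable def cubePhase (H d : ℕ) (c : ℝ) : ℝ := (twistedBoxAverage H d (fun _ => 1) c).re

lemma le_add_div_mul_pow {x t : ℝ} (hx : 0 ≤ x) (ht : 0 < t) (k : ℕ) :
    x ≤ t + x ^ (k + 1) / t ^ k := by
  rcases le_total x t with h | h
  · have : 0 ≤ x ^ (k + 1) / t ^ k := by positivity
    linarith
  · have : x ≤ x ^ (k + 1) / t ^ k := by
      rw [le_div_iff₀ (by positivity), pow_succ']
      gcongr
    linarith

lemma norm_lineAverage_phase_pow_le (H : ℕ) {D : ℕ} {φ : Polynomial ℝ} (hφ : φ.natDegree ≤ D + 1) :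
    ‖lineAverage H (D + 1) (fun t => expi (φ.eval (t : ℝ)))‖ ^ 2 ^ (D + 1)
      ≤ cubePhase H (D + 1) (φ.coeff (D + 1)) := by
  have h1 := norm_lineAverage_pow_le H D (fun t => expi (φ.eval (t : ℝ)))
  have h2 := boxAverage_phase H (s := D + 1) (fun _ => 1) hφ
  simp only [Complex.ofReal_one, one_mul] at h2
  rw [h2] at h1
  exact h1

/-- A bound for sums of polynomial phases over the rough numbers in terms of the leading coefficient
alone. -/
lemma RoughModel.norm_sum_phase_le {D u m₀ M : ℕ} {η : ℝ} (h : RoughModel (D + 1) u m₀ M η)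
    (hη : 0 < η) (hu : u ≠ 0) {H : ℕ} (hH : 0 < H) {t : ℝ} (ht : 0 < t) :
    ∀ᶠ r in atTop, ∀ K : ℕ, (2 ^ 2 ^ (m₀ + r)) ^ u ≤ K → ∀ a L : ℕ, L ≤ 4 * K →
      ∀ Q : Polynomial ℝ, Q.natDegree ≤ D + 1 →
      ‖∑ n ∈ Finset.Ico a (a + L), (roughInd (2 ^ 2 ^ (m₀ + r)) n : ℂ) * expi (Q.eval (n : ℝ))‖
        ≤ (2 * η + 5 * (t + cubePhase H (D + 1)
          (Q.coeff (D + 1) * (primorial (2 ^ 2 ^ m₀) : ℝ) ^ (D + 1)) / t ^ (2 ^ (D + 1) - 1)))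
          * (mertensProd (2 ^ 2 ^ (m₀ + r)) * K) := by
  have hm := mertensProd_pos (2 ^ 2 ^ m₀)
  set W := primorial (2 ^ 2 ^ m₀) with hW
  filter_upwards [eventually_ge_atTop M, eventually_le_two_pow_two_pow
    (2 * W * ((D + 1 : ℕ) * H) / (η * mertensProd (2 ^ 2 ^ m₀))) m₀] with r hr hr2 K hK a L hL Q hQ
  have h1 := (h r hr).2 K hK a L hL Q hQ
  have hb := blockProd_pos m₀ r
  have hKz : ((2 ^ 2 ^ (m₀ + r) : ℕ) : ℝ) ≤ K := by
    exact_mod_cast (Nat.le_self_pow hu _).trans hK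
  have h3 : 2 * W * ((D + 1 : ℕ) * H) ≤ K * (η * mertensProd (2 ^ 2 ^ m₀)) := by
    rw [div_le_iff₀ (by positivity)] at hr2
    exact hr2.trans (by gcongr)
  set f : ℕ → ℂ := fun n => if n.Coprime W then expi (Q.eval (n : ℝ)) else 0 with hf
  have hf1 : ∀ n, ‖f n‖ ≤ 1 := by
    intro n; simp only [hf]; split_ifs
    · exact (norm_expi _).le
    · simp
  have h4 := norm_sum_sub_sum_lineAverage_le hf1 hH a (a + L) (D + 1) W
  set Y := t + cubePhase H (D + 1) (Q.coeff (D + 1) * (W : ℝ) ^ (D + 1)) / t ^ (2 ^ (D + 1) - 1)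
    with hY
  have hcop : ∀ n t, (n + W * t).Coprime W ↔ n.Coprime W := fun n t => by
    rw [Nat.coprime_add_mul_left_left]
  have h5 : ∀ n, ‖lineAverage H (D + 1) (fun t => f (n + W * t))‖ ≤ if n.Coprime W then Y else 0 := by
    intro n
    split_ifs with hn
    · have h6 : (fun t => f (n + W * t)) = fun t : ℕ => expi ((affineComp Q n W).eval (t : ℝ)) := by
        funext t
        simp only [hf]
        rw [if_pos ((hcop n t).2 hn), eval_affineComp]
        push_cast
        rfl
      rw [h6]
      have h7 := norm_lineAverage_phase_pow_le H (natDegree_affineComp_le hQ n W)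
      rw [coeff_affineComp hQ] at h7
      have h8 : 2 ^ (D + 1) - 1 + 1 = 2 ^ (D + 1) := Nat.sub_add_cancel Nat.one_le_two_pow
      refine (le_add_div_mul_pow (norm_nonneg _) ht (2 ^ (D + 1) - 1)).trans ?_
      rw [h8, hY]
      gcongr
    · have : (fun t => f (n + W * t)) = fun t => (0 : ℂ) * (0 : ℂ) := by
        funext t; simp [hf, hcop, hn]
      rw [this, lineAverage_mul]
      simp
  have hY0 : 0 ≤ Y := by
    have h7 := norm_lineAverage_phase_pow_le H (natDegree_affineComp_le hQ 0 W)
    rw [coeff_affineComp hQ] at h7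
    have : 0 ≤ cubePhase H (D + 1) (Q.coeff (D + 1) * (W : ℝ) ^ (D + 1)) :=
      (by positivity : (0 : ℝ) ≤ _).trans h7
    positivity
  have h9 : ‖∑ n ∈ Finset.Ico a (a + L), lineAverage H (D + 1) (fun t => f (n + W * t))‖
      ≤ ((Finset.Ico a (a + L)).filter (fun n => n.Coprime W)).card * Y := by
    refine (norm_sum_le _ _).trans ((Finset.sum_le_sum fun n _ => h5 n).trans (le_of_eq ?_))
    rw [← Finset.sum_filter, Finset.sum_const, nsmul_eq_mul]
  have h10 := norm_sub_norm_le (∑ n ∈ Finset.Ico a (a + L), f n)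
    (∑ n ∈ Finset.Ico a (a + L), lineAverage H (D + 1) (fun t => f (n + W * t)))
  rw [norm_sub_rev] at h10
  have h11 := h.blockProd_mul_card_le hu hr hK (a := a) hL
  rw [← hW] at h11
  have h12 : ‖(blockProd m₀ r : ℂ) * ∑ n ∈ Finset.Ico a (a + L), f n‖
      ≤ (η + 5 * Y) * (mertensProd (2 ^ 2 ^ (m₀ + r)) * K) := by
    rw [norm_mul, Complex.norm_real, Real.norm_eq_abs, abs_of_pos hb]
    calc _ ≤ blockProd m₀ r * (K * (η * mertensProd (2 ^ 2 ^ m₀))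
          + ((Finset.Ico a (a + L)).filter (fun n => n.Coprime W)).card * Y) := by
          refine mul_le_mul_of_nonneg_left ?_ hb.le
          linarith
      _ = η * (mertensProd (2 ^ 2 ^ (m₀ + r)) * K) + (blockProd m₀ r *
          ((Finset.Ico a (a + L)).filter (fun n => n.Coprime W)).card) * Y := by
          rw [mertensProd_eq]; ring
      _ ≤ η * (mertensProd (2 ^ 2 ^ (m₀ + r)) * K)
          + (5 * (mertensProd (2 ^ 2 ^ (m₀ + r)) * K)) * Y := by gcongr
      _ = _ := by ring
  have h13 := norm_sub_norm_le (∑ n ∈ Finset.Ico a (a + L),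
    (roughInd (2 ^ 2 ^ (m₀ + r)) n : ℂ) * expi (Q.eval (n : ℝ)))
    ((blockProd m₀ r : ℂ) * ∑ n ∈ Finset.Ico a (a + L), f n)
  linarith

lemma card_degenerate_cubes_le (H d : ℕ) :
    ((Fintype.piFinset (fun _ : Fin d × Bool => Finset.range H)).filter
      (fun x => ∃ i, x (i, true) = x (i, false))).card * H ≤ d * H ^ (2 * d) := by
  classical
  have h1 : ∀ i : Fin d, ((Fintype.piFinset (fun _ : Fin d × Bool => Finset.range H)).filter
      (fun x => x (i, true) = x (i, false))).card * H ≤ H ^ (2 * d) := by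
    intro i
    have h2 : ((Fintype.piFinset (fun _ : Fin d × Bool => Finset.range H)).filter
      (fun x => x (i, true) = x (i, false))).card ≤ (Fintype.piFinset
        (Function.update (fun _ : Fin d × Bool => Finset.range H) (i, true) {0})).card := by
      refine Finset.card_le_card_of_injOn (fun x => Function.update x (i, true) 0) ?_ ?_
      · intro x hx
        simp only [Finset.coe_filter, Set.mem_ofPred_eq, Fintype.mem_piFinset] at hx
        simp only [Finset.mem_coe, Fintype.mem_piFinset]
        intro j
        by_cases hj : j = (i, true)
        · subst hj; simp
        · rw [Function.update_of_ne hj, Function.update_of_ne hj]; exact hx.1 j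
      · intro x hx y hy hxy
        simp only [Finset.coe_filter, Set.mem_ofPred_eq] at hx hy
        have h3 : ∀ j, j ≠ (i, true) → x j = y j := by
          intro j hj
          have := congrFun hxy j
          simpa [Function.update_of_ne hj] using this
        funext j
        by_cases hj : j = (i, true)
        · subst hj
          rw [hx.2, hy.2]
          exact h3 _ (by simp)
        · exact h3 j hj
    have h4 : (Fintype.piFinset
        (Function.update (fun _ : Fin d × Bool => Finset.range H) (i, true) {0})).card * H
        = H ^ (2 * d) := by
      rw [Fintype.card_piFinset]
      have h5 : ∀ j, (Function.update (fun _ : Fin d × Bool => Finset.range H) (i, true) {0} j).card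
          = Function.update (fun _ : Fin d × Bool => H) (i, true) 1 j := by
        intro j
        by_cases hj : j = (i, true)
        · subst hj; simp
        · simp [Function.update_of_ne hj]
      rw [Finset.prod_congr rfl fun j _ => h5 j, Finset.prod_update_of_mem (Finset.mem_univ _), one_mul,
        Finset.prod_const, ← pow_succ]
      congr 1
      rw [Finset.card_sdiff_of_subset (Finset.subset_univ _)]
      simp only [Finset.card_univ, Fintype.card_prod, Fintype.card_fin, Fintype.card_bool,
        Finset.card_singleton]
      have := i.pos
      omega
    rw [← h4]
    exact Nat.mul_le_mul_right _ h2
  have h6 : (Fintype.piFinset (fun _ : Fin d × Bool => Finset.range H)).filter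
      (fun x => ∃ i, x (i, true) = x (i, false)) ⊆ Finset.univ.biUnion (fun i =>
      (Fintype.piFinset (fun _ : Fin d × Bool => Finset.range H)).filter
      (fun x => x (i, true) = x (i, false))) := by
    intro x hx
    simp only [Finset.mem_filter] at hx
    obtain ⟨h7, i, hi⟩ := hx
    exact Finset.mem_biUnion.2 ⟨i, Finset.mem_univ _, Finset.mem_filter.2 ⟨h7, hi⟩⟩
  calc _ ≤ (∑ i : Fin d, ((Fintype.piFinset (fun _ : Fin d × Bool => Finset.range H)).filter
      (fun x => x (i, true) = x (i, false))).card) * H :=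
        Nat.mul_le_mul_right _ ((Finset.card_le_card h6).trans Finset.card_biUnion_le)
    _ ≤ _ := by
        rw [Finset.sum_mul]
        refine (Finset.sum_le_sum fun i _ => h1 i).trans ?_
        simp

lemma sum_sum_mul_expi_sub (s : Finset ℕ) (w g : ℕ → ℝ) :
    ∑ m ∈ s, ∑ m' ∈ s, ((w m * w m' : ℝ) : ℂ) * expi (g m - g m')
      = ((‖∑ m ∈ s, (w m : ℂ) * expi (g m)‖ ^ 2 : ℝ) : ℂ) := by
  rw [← Complex.normSq_eq_norm_sq, ← Complex.mul_conj, map_sum, Finset.sum_mul_sum]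
  refine Finset.sum_congr rfl fun m _ => Finset.sum_congr rfl fun m' _ => ?_
  rw [map_mul, conj_expi, Complex.conj_ofReal, sub_eq_add_neg, expi_add]
  push_cast
  ring

lemma sum_sum_mul_cubePhase (H d : ℕ) (s : Finset ℕ) (w g : ℕ → ℝ) :
    ∑ m ∈ s, ∑ m' ∈ s, w m * w m' * cubePhase H d (g m - g m')
      = ((H : ℝ) ^ (2 * d))⁻¹ * ∑ x ∈ Fintype.piFinset (fun _ : Fin d × Bool => Finset.range H),
        ‖∑ m ∈ s, (w m : ℂ) *
          expi (d.factorial * (∏ i, ((x (i, true) : ℝ) - x (i, false))) * g m)‖ ^ 2 := by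
  set X := Fintype.piFinset (fun _ : Fin d × Bool => Finset.range H) with hX
  set e : (Fin d × Bool → ℕ) → ℝ := fun x =>
    d.factorial * (∏ i, ((x (i, true) : ℝ) - x (i, false))) with he
  have h1 : ∀ m m', ((w m * w m' * cubePhase H d (g m - g m') : ℝ) : ℂ)
      = ((w m * w m' : ℝ) : ℂ) * ((((H : ℂ) ^ (2 * d))⁻¹ * ∑ x ∈ X, expi (e x * g m - e x * g m')).re : ℝ) := by
    intro m m'
    rw [cubePhase, twistedBoxAverage_eq, ← Complex.ofReal_mul]
    congr 4
    refine Finset.sum_congr rfl fun x _ => ?_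
    simp only [Finset.prod_const_one, Complex.ofReal_one, one_mul, he]
    congr 1
    ring
  have h2 : ∑ m ∈ s, ∑ m' ∈ s, w m * w m' * cubePhase H d (g m - g m')
      = (∑ m ∈ s, ∑ m' ∈ s, ((w m * w m' : ℝ) : ℂ) * (((H : ℂ) ^ (2 * d))⁻¹ *
        ∑ x ∈ X, expi (e x * g m - e x * g m'))).re := by
    simp only [Complex.re_sum, Complex.re_ofReal_mul]
    refine Finset.sum_congr rfl fun m _ => Finset.sum_congr rfl fun m' _ => ?_
    have := h1 m m'
    rw [← Complex.ofReal_mul] at this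
    exact_mod_cast this
  have h3 : ∑ m ∈ s, ∑ m' ∈ s, ((w m * w m' : ℝ) : ℂ) * (((H : ℂ) ^ (2 * d))⁻¹ *
        ∑ x ∈ X, expi (e x * g m - e x * g m'))
      = ((H : ℂ) ^ (2 * d))⁻¹ * ∑ x ∈ X, ∑ m ∈ s, ∑ m' ∈ s,
        ((w m * w m' : ℝ) : ℂ) * expi (e x * g m - e x * g m') := by
    have h4 : ∀ m ∈ s, ∑ m' ∈ s, ∑ x ∈ X, ((w m * w m' : ℝ) : ℂ) * expi (e x * g m - e x * g m')
        = ∑ x ∈ X, ∑ m' ∈ s, ((w m * w m' : ℝ) : ℂ) * expi (e x * g m - e x * g m') :=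
      fun m _ => Finset.sum_comm
    rw [Finset.sum_comm (s := X), ← Finset.sum_congr rfl h4]
    simp only [Finset.mul_sum]
    refine Finset.sum_congr rfl fun m _ => Finset.sum_congr rfl fun m' _ =>
      Finset.sum_congr rfl fun x _ => ?_
    ring
  rw [h2, h3, Finset.sum_congr rfl fun x _ => sum_sum_mul_expi_sub s w fun m => e x * g m]
  rw [← Complex.ofReal_sum, ← Complex.ofReal_natCast, ← Complex.ofReal_pow, ← Complex.ofReal_inv,
    ← Complex.ofReal_mul, Complex.ofReal_re]

/-- Second moment bound for the differences of a rough number raised to a power. -/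
lemma RoughModel.sum_cubePhase_le {D u m₀ M : ℕ} {η : ℝ} (h : RoughModel (D + 1) u m₀ M η)
    (hη : 0 < η) (hη1 : η ≤ 1) (hu : u ≠ 0) {H : ℕ} (hH : 0 < H) {W : ℕ} (hW : 0 < W) {α : ℝ}
    (hα : Irrational α) :
    ∀ᶠ r in atTop, ∀ K : ℕ, (2 ^ 2 ^ (m₀ + r)) ^ u ≤ K → ∀ a L : ℕ, L ≤ 4 * K →
      ∑ m ∈ Finset.Ico a (a + L), ∑ m' ∈ Finset.Ico a (a + L),
        roughInd (2 ^ 2 ^ (m₀ + r)) m * roughInd (2 ^ 2 ^ (m₀ + r)) m' *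
          cubePhase H (D + 1) (α * (W : ℝ) ^ (D + 1) * (m : ℝ) ^ (D + 1)
            - α * (W : ℝ) ^ (D + 1) * (m' : ℝ) ^ (D + 1))
        ≤ (4 * η ^ 2 + 36 * ((D + 1 : ℕ) / H)) * (mertensProd (2 ^ 2 ^ (m₀ + r)) * K) ^ 2 := by
  classical
  set X := Fintype.piFinset (fun _ : Fin (D + 1) × Bool => Finset.range H) with hX
  have h1 : ∀ x ∈ X, ∀ᶠ r in atTop, ∀ K : ℕ, (2 ^ 2 ^ (m₀ + r)) ^ u ≤ K → ∀ a L : ℕ, L ≤ 4 * K →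
      ‖∑ m ∈ Finset.Ico a (a + L), (roughInd (2 ^ 2 ^ (m₀ + r)) m : ℂ) *
          expi ((D + 1).factorial * (∏ i, ((x (i, true) : ℝ) - x (i, false)))
            * (α * (W : ℝ) ^ (D + 1) * (m : ℝ) ^ (D + 1)))‖ ^ 2
        ≤ (4 * η ^ 2 + if ∃ i, x (i, true) = x (i, false) then 36 else 0)
          * (mertensProd (2 ^ 2 ^ (m₀ + r)) * K) ^ 2 := by
    intro x _
    by_cases hx : ∃ i, x (i, true) = x (i, false)
    · filter_upwards [eventually_ge_atTop M] with r hr K hK a L hL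
      rw [if_pos hx]
      have h2 := h.sum_roughInd_le hη1 hu hr hK a hL
      have h3 : ‖∑ m ∈ Finset.Ico a (a + L), (roughInd (2 ^ 2 ^ (m₀ + r)) m : ℂ) *
          expi ((D + 1).factorial * (∏ i, ((x (i, true) : ℝ) - x (i, false)))
            * (α * (W : ℝ) ^ (D + 1) * (m : ℝ) ^ (D + 1)))‖
          ≤ 6 * (mertensProd (2 ^ 2 ^ (m₀ + r)) * K) := by
        refine (norm_sum_le _ _).trans (le_trans (le_of_eq ?_) h2)
        refine Finset.sum_congr rfl fun m _ => ?_
        rw [norm_mul, norm_expi, mul_one, Complex.norm_real, Real.norm_eq_abs,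
          abs_of_nonneg (roughInd_nonneg _ _)]
      calc _ ≤ (6 * (mertensProd (2 ^ 2 ^ (m₀ + r)) * K)) ^ 2 := by gcongr
        _ = (0 + 36) * (mertensProd (2 ^ 2 ^ (m₀ + r)) * K) ^ 2 := by ring
        _ ≤ _ := by
          refine mul_le_mul_of_nonneg_right ?_ (by positivity)
          have := sq_nonneg η
          linarith
    · set c : ℤ := (D + 1).factorial * (∏ i, ((x (i, true) : ℤ) - x (i, false))) * (W : ℤ) ^ (D + 1)
        with hc
      have hc0 : c ≠ 0 := by
        refine mul_ne_zero (mul_ne_zero (by positivity) ?_) (by positivity)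
        refine Finset.prod_ne_zero_iff.2 fun i _ => ?_
        rw [sub_ne_zero]
        intro h2
        exact hx ⟨i, by exact_mod_cast h2⟩
      filter_upwards [h.norm_sum_irrational_le hη hu (hα.mul_intCast hc0)] with r hr K hK a L hL
      rw [if_neg hx, add_zero]
      have h2 := hr K hK a L hL (Polynomial.C (α * (c : ℝ)) * Polynomial.X ^ (D + 1))
        (Polynomial.natDegree_C_mul_X_pow_le _ _)
        (by rw [Polynomial.coeff_C_mul, Polynomial.coeff_X_pow, if_pos rfl, mul_one])
      have h3 : ∀ m : ℕ, (Polynomial.C (α * (c : ℝ)) * Polynomial.X ^ (D + 1)).eval (m : ℝ)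
          = (D + 1).factorial * (∏ i, ((x (i, true) : ℝ) - x (i, false)))
            * (α * (W : ℝ) ^ (D + 1) * (m : ℝ) ^ (D + 1)) := by
        intro m
        simp only [Polynomial.eval_mul, Polynomial.eval_C, Polynomial.eval_pow, Polynomial.eval_X, hc]
        push_cast
        ring
      simp only [h3] at h2
      calc _ ≤ (2 * η * (mertensProd (2 ^ 2 ^ (m₀ + r)) * K)) ^ 2 := by gcongr
        _ = _ := by ring
  filter_upwards [(Filter.eventually_all_finset X).2 h1] with r hr K hK a L hL
  rw [sum_sum_mul_cubePhase, ← hX]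
  have h2 := Finset.sum_le_sum fun x hx => hr x hx K hK a L hL
  rw [← Finset.sum_mul, Finset.sum_add_distrib, Finset.sum_const, ← Finset.sum_filter,
    Finset.sum_const, nsmul_eq_mul, nsmul_eq_mul] at h2
  have h3 : (X.card : ℝ) = (H : ℝ) ^ (2 * (D + 1)) := by
    rw [hX, Fintype.card_piFinset]
    simp [mul_comm]
  have h4 : ((X.filter (fun x => ∃ i, x (i, true) = x (i, false))).card : ℝ) * H
      ≤ (D + 1 : ℕ) * (H : ℝ) ^ (2 * (D + 1)) := by
    exact_mod_cast card_degenerate_cubes_le H (D + 1)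
  have hH0 : (0 : ℝ) < H := by exact_mod_cast hH
  rw [inv_mul_le_iff₀ (by positivity)]
  refine h2.trans ?_
  rw [← mul_assoc ((H : ℝ) ^ (2 * (D + 1)))]
  refine mul_le_mul_of_nonneg_right ?_ (sq_nonneg _)
  rw [h3]
  have h5 : ((X.filter (fun x => ∃ i, x (i, true) = x (i, false))).card : ℝ)
      ≤ (H : ℝ) ^ (2 * (D + 1)) * ((D + 1 : ℕ) / H) := by
    rw [← mul_div_assoc, le_div_iff₀ hH0]
    linarith
  calc _ ≤ (H : ℝ) ^ (2 * (D + 1)) * (4 * η ^ 2)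
        + (H : ℝ) ^ (2 * (D + 1)) * ((D + 1 : ℕ) / H) * 36 := by gcongr
    _ = _ := by ring

lemma exists_filter_eq_Ico (K x y m m' : ℕ) : ∃ a L : ℕ, L ≤ K ∧
    (Finset.Ioc K (2 * K)).filter (fun k => (y < k * m ∧ k * m ≤ x) ∧ (y < k * m' ∧ k * m' ≤ x))
      = Finset.Ico a (a + L) := by
  rcases Nat.eq_zero_or_pos m with rfl | hm
  · exact ⟨0, 0, Nat.zero_le _, by simp⟩
  rcases Nat.eq_zero_or_pos m' with rfl | hm'
  · exact ⟨0, 0, Nat.zero_le _, by simp⟩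
  set a := max (K + 1) (max (y / m + 1) (y / m' + 1)) with ha
  set b := min (2 * K + 1) (min (x / m + 1) (x / m' + 1)) with hb
  refine ⟨a, b - a, by omega, ?_⟩
  ext k
  rw [Finset.mem_filter, Finset.mem_Ioc, Finset.mem_Ico, ← Nat.div_lt_iff_lt_mul hm,
    ← Nat.div_lt_iff_lt_mul hm', ← Nat.le_div_iff_mul_le hm, ← Nat.le_div_iff_mul_le hm']
  omega

/-- Mean square bound for a bilinear sum over a dyadic range. -/
lemma RoughModel.sum_sq_bilinear_le {D u m₀ M : ℕ} {η : ℝ} (h : RoughModel (D + 1) u m₀ M η)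
    (hη : 0 < η) (hη1 : η ≤ 1) (hu : u ≠ 0) {H : ℕ} (hH : 0 < H) {t : ℝ} (ht : 0 < t) {α : ℝ}
    (hα : Irrational α) :
    ∀ᶠ r in atTop, ∀ K M₁ : ℕ, (2 ^ 2 ^ (m₀ + r)) ^ u ≤ K → (2 ^ 2 ^ (m₀ + r)) ^ u ≤ M₁ →
      ∀ P : Polynomial ℝ, P.natDegree ≤ D + 1 → P.coeff (D + 1) = α →
      ∀ x y : ℕ, ∀ c : ℕ → ℝ, (∀ m, 0 ≤ c m) → (∀ m, c m ≤ roughInd (2 ^ 2 ^ (m₀ + r)) m) →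
      ∑ k ∈ Finset.Ioc K (2 * K), roughInd (2 ^ 2 ^ (m₀ + r)) k *
        ‖∑ m ∈ Finset.range (M₁ + 1), ((if y < k * m ∧ k * m ≤ x then c m else 0 : ℝ) : ℂ)
          * expi (P.eval ((k * m : ℕ) : ℝ))‖ ^ 2
      ≤ (36 * (2 * η + 5 * t) + 5 / t ^ (2 ^ (D + 1) - 1) * (4 * η ^ 2 + 36 * ((D + 1 : ℕ) / H)))
        * (mertensProd (2 ^ 2 ^ (m₀ + r)) ^ 3 * K * M₁ ^ 2) := by
  filter_upwards [eventually_ge_atTop M, h.norm_sum_phase_le hη hu hH ht,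
    h.sum_cubePhase_le hη hη1 hu hH (primorial_pos (2 ^ 2 ^ m₀)) hα]
    with r hr hph hcube K M₁ hK hM P hP hPα x y c hc0 hc
  set z := 2 ^ 2 ^ (m₀ + r) with hz
  set W := primorial (2 ^ 2 ^ m₀) with hW
  set V := mertensProd z with hV
  have hV0 : 0 < V := mertensProd_pos _
  set s := Finset.range (M₁ + 1) with hs
  have hsIco : s = Finset.Ico 0 (0 + (M₁ + 1)) := by rw [zero_add, ← Finset.range_eq_Ico]
  have hzpos : 0 < z ^ u := by positivity
  have hM4 : M₁ + 1 ≤ 4 * M₁ := by omega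
  set T := 5 / t ^ (2 ^ (D + 1) - 1) with hT
  have hT0 : 0 < T := by positivity
  set Y : ℕ → ℕ → ℝ := fun m m' => cubePhase H (D + 1)
    (α * (W : ℝ) ^ (D + 1) * (m : ℝ) ^ (D + 1) - α * (W : ℝ) ^ (D + 1) * (m' : ℝ) ^ (D + 1)) with hY
  -- the inner sums over `k`
  have hinner : ∀ m m' : ℕ, ‖∑ k ∈ Finset.Ioc K (2 * K),
      if (y < k * m ∧ k * m ≤ x) ∧ (y < k * m' ∧ k * m' ≤ x) then (roughInd z k : ℂ) *
        expi (P.eval ((k * m : ℕ) : ℝ) - P.eval ((k * m' : ℕ) : ℝ)) else 0‖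
      ≤ (2 * η + 5 * t + T * Y m m') * (V * K) := by
    intro m m'
    obtain ⟨a, L, hL, hfil⟩ := exists_filter_eq_Ico K x y m m'
    rw [← Finset.sum_filter, hfil]
    have hdeg : (affineComp P 0 m - affineComp P 0 m').natDegree ≤ D + 1 :=
      (Polynomial.natDegree_sub_le _ _).trans
        (max_le (natDegree_affineComp_le hP _ _) (natDegree_affineComp_le hP _ _))
    have h1 := hph K hK a L (by omega) _ hdeg
    rw [Polynomial.coeff_sub, coeff_affineComp hP, coeff_affineComp hP, hPα] at h1
    have h2 : ∀ k : ℕ, (affineComp P 0 m - affineComp P 0 m').eval (k : ℝ)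
        = P.eval ((k * m : ℕ) : ℝ) - P.eval ((k * m' : ℕ) : ℝ) := by
      intro k
      rw [Polynomial.eval_sub, eval_affineComp, eval_affineComp]
      push_cast
      rw [zero_add, zero_add, mul_comm (m : ℝ), mul_comm (m' : ℝ)]
    simp only [h2] at h1
    refine h1.trans (le_of_eq ?_)
    rw [hT, hY]
    dsimp only
    rw [show (α * (m : ℝ) ^ (D + 1) - α * (m' : ℝ) ^ (D + 1)) * (W : ℝ) ^ (D + 1)
      = α * (W : ℝ) ^ (D + 1) * (m : ℝ) ^ (D + 1) - α * (W : ℝ) ^ (D + 1) * (m' : ℝ) ^ (D + 1) by ring]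
    ring
  have hexpand : ∑ k ∈ Finset.Ioc K (2 * K), roughInd z k *
        ‖∑ m ∈ s, ((if y < k * m ∧ k * m ≤ x then c m else 0 : ℝ) : ℂ)
          * expi (P.eval ((k * m : ℕ) : ℝ))‖ ^ 2
      = ‖∑ m ∈ s, ∑ m' ∈ s, ((c m * c m' : ℝ) : ℂ) * ∑ k ∈ Finset.Ioc K (2 * K),
        if (y < k * m ∧ k * m ≤ x) ∧ (y < k * m' ∧ k * m' ≤ x) then (roughInd z k : ℂ) *
          expi (P.eval ((k * m : ℕ) : ℝ) - P.eval ((k * m' : ℕ) : ℝ)) else 0‖ := by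
    have h1 : ((∑ k ∈ Finset.Ioc K (2 * K), roughInd z k *
        ‖∑ m ∈ s, ((if y < k * m ∧ k * m ≤ x then c m else 0 : ℝ) : ℂ)
          * expi (P.eval ((k * m : ℕ) : ℝ))‖ ^ 2 : ℝ) : ℂ)
        = ∑ m ∈ s, ∑ m' ∈ s, ((c m * c m' : ℝ) : ℂ) * ∑ k ∈ Finset.Ioc K (2 * K),
        if (y < k * m ∧ k * m ≤ x) ∧ (y < k * m' ∧ k * m' ≤ x) then (roughInd z k : ℂ) *
          expi (P.eval ((k * m : ℕ) : ℝ) - P.eval ((k * m' : ℕ) : ℝ)) else 0 := by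
      have h2 : ∀ m ∈ s, (∑ m' ∈ s, ((c m * c m' : ℝ) : ℂ) * ∑ k ∈ Finset.Ioc K (2 * K),
          if (y < k * m ∧ k * m ≤ x) ∧ (y < k * m' ∧ k * m' ≤ x) then (roughInd z k : ℂ) *
            expi (P.eval ((k * m : ℕ) : ℝ) - P.eval ((k * m' : ℕ) : ℝ)) else 0)
          = ∑ k ∈ Finset.Ioc K (2 * K), ∑ m' ∈ s, ((c m * c m' : ℝ) : ℂ) *
          if (y < k * m ∧ k * m ≤ x) ∧ (y < k * m' ∧ k * m' ≤ x) then (roughInd z k : ℂ) *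
            expi (P.eval ((k * m : ℕ) : ℝ) - P.eval ((k * m' : ℕ) : ℝ)) else 0 := by
        intro m _
        simp only [Finset.mul_sum]
        exact Finset.sum_comm
      rw [Finset.sum_congr rfl h2, Finset.sum_comm, Complex.ofReal_sum]
      refine Finset.sum_congr rfl fun k _ => ?_
      rw [Complex.ofReal_mul, ← sum_sum_mul_expi_sub s
        (fun m => if y < k * m ∧ k * m ≤ x then c m else 0) (fun m => P.eval ((k * m : ℕ) : ℝ)),
        Finset.mul_sum]
      refine Finset.sum_congr rfl fun m _ => ?_
      rw [Finset.mul_sum]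
      refine Finset.sum_congr rfl fun m' _ => ?_
      by_cases h3 : y < k * m ∧ k * m ≤ x <;> by_cases h4 : y < k * m' ∧ k * m' ≤ x
      · rw [if_pos h3, if_pos h4, if_pos ⟨h3, h4⟩]; ring
      · simp only [h3, h4, and_false, if_false, Complex.ofReal_zero, mul_zero, zero_mul]
      · simp only [h3, h4, false_and, if_false, Complex.ofReal_zero, mul_zero, zero_mul]
      · simp only [h3, h4, false_and, if_false, Complex.ofReal_zero, mul_zero, zero_mul]
    rw [← h1, Complex.norm_real, Real.norm_eq_abs, abs_of_nonneg]
    exact Finset.sum_nonneg fun k _ => mul_nonneg (roughInd_nonneg _ _) (by positivity)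
  rw [hexpand]
  have hcount := h.sum_roughInd_le hη1 hu hr hM 0 hM4
  rw [← hsIco, ← hz, ← hV] at hcount
  have hcube' := hcube M₁ hM 0 (M₁ + 1) hM4
  rw [← hsIco] at hcube'
  have hterm : ∀ m ∈ s, ∀ m' ∈ s, ‖((c m * c m' : ℝ) : ℂ) * ∑ k ∈ Finset.Ioc K (2 * K),
        if (y < k * m ∧ k * m ≤ x) ∧ (y < k * m' ∧ k * m' ≤ x) then (roughInd z k : ℂ) *
          expi (P.eval ((k * m : ℕ) : ℝ) - P.eval ((k * m' : ℕ) : ℝ)) else 0‖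
      ≤ ((2 * η + 5 * t) * (roughInd z m * roughInd z m')
        + T * (roughInd z m * roughInd z m' * Y m m')) * (V * K) := by
    intro m _ m' _
    rw [norm_mul, Complex.norm_real, Real.norm_eq_abs, abs_of_nonneg (mul_nonneg (hc0 m) (hc0 m'))]
    calc _ ≤ (roughInd z m * roughInd z m') * ((2 * η + 5 * t + T * Y m m') * (V * K)) := by
          refine mul_le_mul ?_ (hinner m m') (norm_nonneg _)
            (mul_nonneg (roughInd_nonneg _ _) (roughInd_nonneg _ _))
          exact mul_le_mul (hc m) (hc m') (hc0 m') (roughInd_nonneg _ _)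
      _ = _ := by ring
  refine (norm_sum_le _ _).trans ((Finset.sum_le_sum fun m hm => (norm_sum_le _ _).trans
    (Finset.sum_le_sum fun m' hm' => hterm m hm m' hm')).trans ?_)
  have hfac : ∑ m ∈ s, ∑ m' ∈ s, ((2 * η + 5 * t) * (roughInd z m * roughInd z m')
        + T * (roughInd z m * roughInd z m' * Y m m')) * (V * K)
      = ((2 * η + 5 * t) * (∑ m ∈ s, roughInd z m) ^ 2
        + T * ∑ m ∈ s, ∑ m' ∈ s, roughInd z m * roughInd z m' * Y m m') * (V * K) := by
    rw [sq, Finset.sum_mul_sum]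
    simp only [← Finset.sum_mul, Finset.sum_add_distrib, ← Finset.mul_sum]
  rw [hfac]
  have hsum0 : 0 ≤ ∑ m ∈ s, roughInd z m := Finset.sum_nonneg fun m _ => roughInd_nonneg _ _
  calc _ ≤ ((2 * η + 5 * t) * (6 * (V * M₁)) ^ 2
        + T * ((4 * η ^ 2 + 36 * ((D + 1 : ℕ) / H)) * (V * M₁) ^ 2)) * (V * K) := by
        refine mul_le_mul_of_nonneg_right ?_ (by positivity)
        refine add_le_add ?_ (mul_le_mul_of_nonneg_left hcube' hT0.le)
        gcongr
    _ = _ := by ring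

lemma rough_mul_iff {z k m : ℕ} : Rough z (k * m) ↔ Rough z k ∧ Rough z m := by
  constructor
  · intro h
    exact ⟨fun p hp hpz hd => h p hp hpz (hd.mul_right m), fun p hp hpz hd => h p hp hpz (hd.mul_left k)⟩
  · rintro ⟨h1, h2⟩ p hp hpz hd
    rcases hp.dvd_mul.1 hd with h | h
    exacts [h1 p hp hpz h, h2 p hp hpz h]

lemma roughInd_mul (z k m : ℕ) : roughInd z (k * m) = roughInd z k * roughInd z m := by
  unfold roughInd
  by_cases h1 : Rough z k <;> by_cases h2 : Rough z m <;> simp [rough_mul_iff, h1, h2]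

lemma roughInd_eq_zero {z n : ℕ} (h1 : n ≠ 1) (h2 : n ≤ z) (hz : 2 ≤ z) : roughInd z n = 0 := by
  unfold roughInd
  rw [if_neg]
  intro h
  rcases Nat.eq_zero_or_pos n with rfl | hn
  · exact h 2 Nat.prime_two hz (dvd_zero 2)
  · exact h n.minFac (Nat.minFac_prime h1) ((Nat.minFac_le hn).trans h2) (Nat.minFac_dvd n)

lemma roughInd_anti {z z' : ℕ} (h : z' ≤ z) (n : ℕ) : roughInd z n ≤ roughInd z' n := by
  unfold roughInd
  by_cases h1 : Rough z n
  · have h2 : Rough z' n := fun p hp hpz => h1 p hp (hpz.trans h)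
    rw [if_pos h1, if_pos h2]
  · rw [if_neg h1]; split_ifs <;> simp

lemma roughInd_mul_self (z n : ℕ) : roughInd z n * roughInd z n = roughInd z n := by
  unfold roughInd; split_ifs <;> simp

/-- The inner sum of the bilinear form arising from the decomposition of the logarithm. -/
noncomputable def cofactorSum (P : Polynomial ℝ) (z x y k : ℕ) : ℂ :=
  ∑ m ∈ Finset.Ioc 0 x, ((if y < k * m ∧ k * m ≤ x then (if m = 1 then 0 else roughInd z m) else 0 : ℝ) : ℂ)
    * expi (P.eval ((k * m : ℕ) : ℝ))

lemma sum_roughInd_mul_log (P : Polynomial ℝ) (z x y : ℕ) :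
    ∑ n ∈ Finset.Ioc y x, ((roughInd z n * Real.log n : ℝ) : ℂ) * expi (P.eval (n : ℝ))
      = ∑ n ∈ Finset.Ioc y x, ((roughInd z n * ArithmeticFunction.vonMangoldt n : ℝ) : ℂ)
          * expi (P.eval (n : ℝ))
        + ∑ k ∈ Finset.Ioc 0 x, ((ArithmeticFunction.vonMangoldt k * roughInd z k : ℝ) : ℂ)
          * cofactorSum P z x y k := by
  set F : ℕ → ℕ → ℂ := fun k m => ((ArithmeticFunction.vonMangoldt k * roughInd z (k * m) : ℝ) : ℂ)
    * expi (P.eval ((k * m : ℕ) : ℝ)) with hF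
  have h1 : ∀ n ∈ Finset.Ioc y x, ((roughInd z n * Real.log n : ℝ) : ℂ) * expi (P.eval (n : ℝ))
      = ∑ k ∈ Finset.Ioc 0 x, ∑ m ∈ Finset.Ioc 0 x, if k * m = n then F k m else 0 := by
    intro n hn
    rw [Finset.mem_Ioc] at hn
    rw [← Finset.sum_product', ← Finset.sum_filter,
      ← Nat.divisorsAntidiagonal_eq_prod_filter_of_le (by omega) hn.2,
      ← ArithmeticFunction.vonMangoldt_sum, ← Nat.map_div_right_divisors, Finset.sum_map]
    rw [Complex.ofReal_mul, Complex.ofReal_sum, Finset.mul_sum, Finset.sum_mul]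
    refine Finset.sum_congr rfl fun k hk => ?_
    have h2 : k * (n / k) = n := Nat.mul_div_cancel' (Nat.dvd_of_mem_divisors hk)
    change _ = ((ArithmeticFunction.vonMangoldt k * roughInd z (k * (n / k)) : ℝ) : ℂ)
      * expi (P.eval ((k * (n / k) : ℕ) : ℝ))
    rw [h2]
    push_cast
    ring
  have h2 : ∀ k m : ℕ, ∑ n ∈ Finset.Ioc y x, (if k * m = n then F k m else 0)
      = if y < k * m ∧ k * m ≤ x then F k m else 0 := by
    intro k m
    rw [Finset.sum_ite_eq]
    simp only [Finset.mem_Ioc]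
  have h3 : ∑ n ∈ Finset.Ioc y x, ((roughInd z n * ArithmeticFunction.vonMangoldt n : ℝ) : ℂ)
          * expi (P.eval (n : ℝ))
      = ∑ k ∈ Finset.Ioc 0 x, if y < k ∧ k ≤ x then F k 1 else 0 := by
    rw [← Finset.sum_filter]
    have h4 : (Finset.Ioc 0 x).filter (fun k => y < k ∧ k ≤ x) = Finset.Ioc y x := by
      ext k; simp only [Finset.mem_filter, Finset.mem_Ioc]; omega
    rw [h4]
    refine Finset.sum_congr rfl fun k _ => ?_
    simp only [hF, mul_one]
    push_cast
    ring
  rw [Finset.sum_congr rfl h1, Finset.sum_comm, h3, ← Finset.sum_add_distrib]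
  refine Finset.sum_congr rfl fun k hk => ?_
  rw [Finset.sum_comm]
  simp only [h2]
  have hx : 1 ∈ Finset.Ioc 0 x := by
    rw [Finset.mem_Ioc] at hk ⊢; omega
  rw [cofactorSum, ← Finset.add_sum_erase _ _ hx, ← Finset.add_sum_erase _ _ hx]
  simp only [mul_one, if_true, ite_self, Complex.ofReal_zero, zero_mul, zero_add]
  rw [Finset.mul_sum]
  congr 1
  refine Finset.sum_congr rfl fun m hm => ?_
  rw [if_neg (Finset.ne_of_mem_erase hm)]
  split_ifs with h5
  · simp only [hF, roughInd_mul]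
    push_cast
    ring
  · simp

lemma sum_Ioc_dyadic (f : ℕ → ℂ) (I : ℕ) :
    ∑ k ∈ Finset.Ioc 0 (2 ^ I), f k
      = f 1 + ∑ i ∈ Finset.range I, ∑ k ∈ Finset.Ioc (2 ^ i) (2 * 2 ^ i), f k := by
  induction I with
  | zero =>
    rw [pow_zero, show Finset.Ioc 0 1 = {1} by rfl]
    simp
  | succ I ih =>
    rw [Finset.sum_range_succ, ← add_assoc, ← ih, pow_succ', ← Finset.sum_Ioc_consecutive f (Nat.zero_le _)
      (show 2 ^ I ≤ 2 * 2 ^ I by omega)]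

lemma sum_sq_vonMangoldt_le {K x : ℕ} (hx : 2 * K ≤ x) :
    ∑ k ∈ Finset.Ioc K (2 * K), ArithmeticFunction.vonMangoldt k ^ 2 ≤ Real.log x * (12 * K) := by
  have h1 : ∀ k ∈ Finset.Ioc K (2 * K), ArithmeticFunction.vonMangoldt k ^ 2
      ≤ Real.log x * ArithmeticFunction.vonMangoldt k := by
    intro k hk
    rw [Finset.mem_Ioc] at hk
    rw [sq]
    refine mul_le_mul_of_nonneg_right (ArithmeticFunction.vonMangoldt_le_log.trans ?_)
      ArithmeticFunction.vonMangoldt_nonneg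
    refine Real.log_le_log ?_ ?_
    · exact_mod_cast (show 0 < k by omega)
    · exact_mod_cast (show k ≤ x by omega)
  have h2 : ∑ k ∈ Finset.Ioc K (2 * K), ArithmeticFunction.vonMangoldt k
      ≤ Chebyshev.psi ((2 * K : ℕ) : ℝ) := by
    rw [Chebyshev.psi, Nat.floor_natCast]
    exact Finset.sum_le_sum_of_subset_of_nonneg (Finset.Ioc_subset_Ioc_left (Nat.zero_le _))
      fun _ _ _ => ArithmeticFunction.vonMangoldt_nonneg
  have h3 := Chebyshev.psi_le_const_mul_self (Nat.cast_nonneg (α := ℝ) (2 * K))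
  have h4 : Real.log 4 ≤ 2 := by
    have h5 : Real.log 4 = 2 * Real.log 2 := by
      rw [show (4 : ℝ) = 2 ^ 2 by norm_num, Real.log_pow]; norm_num
    have := Real.log_two_lt_d9
    linarith
  have h5 : Chebyshev.psi ((2 * K : ℕ) : ℝ) ≤ 12 * K := by
    refine h3.trans ?_
    push_cast
    have : (0 : ℝ) ≤ K := Nat.cast_nonneg _
    nlinarith
  refine (Finset.sum_le_sum h1).trans ?_
  rw [← Finset.mul_sum]
  exact mul_le_mul_of_nonneg_left (h2.trans h5) (Real.log_natCast_nonneg _)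

lemma RoughModel.norm_sq_bilinear_le {D u m₀ M : ℕ} {η : ℝ} (h : RoughModel (D + 1) u m₀ M η)
    (hη : 0 < η) (hη1 : η ≤ 1) (hu : u ≠ 0) {H : ℕ} (hH : 0 < H) {t : ℝ} (ht : 0 < t)
    {P : Polynomial ℝ} (hP : P.natDegree ≤ D + 1) (hα : Irrational (P.coeff (D + 1))) :
    ∀ᶠ r in atTop, ∀ z : ℕ, 2 * (2 ^ 2 ^ (m₀ + r)) ^ u ≤ z → ∀ x y K : ℕ, 0 < K →
      ‖∑ k ∈ Finset.Ioc K (2 * K), ((ArithmeticFunction.vonMangoldt k * roughInd z k : ℝ) : ℂ)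
          * cofactorSum P z x y k‖ ^ 2
      ≤ (36 * (2 * η + 5 * t) + 5 / t ^ (2 ^ (D + 1) - 1) * (4 * η ^ 2 + 36 * ((D + 1 : ℕ) / H)))
        * (12 * (x : ℝ) ^ 2 * (Real.log x * mertensProd (2 ^ 2 ^ (m₀ + r)) ^ 3)) := by
  filter_upwards [h.sum_sq_bilinear_le hη hη1 hu hH ht hα] with r hr z hz x y K hK0
  set z' := 2 ^ 2 ^ (m₀ + r) with hz'
  set E := 36 * (2 * η + 5 * t) + 5 / t ^ (2 ^ (D + 1) - 1) * (4 * η ^ 2 + 36 * ((D + 1 : ℕ) / H)) with hE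
  have hE0 : 0 ≤ E := by positivity
  have hV := mertensProd_pos z'
  have hlog : 0 ≤ Real.log x := Real.log_natCast_nonneg _
  have hrhs : 0 ≤ E * (12 * (x : ℝ) ^ 2 * (Real.log x * mertensProd z' ^ 3)) := by positivity
  have hz'1 : 2 ≤ z' := by
    rw [hz']
    exact Nat.le_self_pow (by positivity) 2
  have hzz : z' ≤ z := by
    have := Nat.le_self_pow hu z'
    omega
  have hpos : 0 < z' ^ u := by positivity
  have hzero : ∀ w : ℂ, w = 0 → ‖w‖ ^ 2 ≤ E * (12 * (x : ℝ) ^ 2 * (Real.log x * mertensProd z' ^ 3)) := by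
    rintro w rfl; simpa using hrhs
  rcases lt_or_ge K (z' ^ u) with hK | hK
  · refine hzero _ (Finset.sum_eq_zero fun k hk => ?_)
    rw [Finset.mem_Ioc] at hk
    rw [roughInd_eq_zero (by omega) (by omega) (by omega)]
    simp
  rcases lt_or_ge (x / K) (z' ^ u) with hM | hM
  · refine hzero _ (Finset.sum_eq_zero fun k hk => ?_)
    rw [Finset.mem_Ioc] at hk
    rw [cofactorSum, Finset.sum_eq_zero, mul_zero]
    intro m hm
    split_ifs with h1 h2
    · simp
    · have h3 : m ≤ x / K := by
        rw [Nat.le_div_iff_mul_le hK0]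
        nlinarith
      rw [roughInd_eq_zero h2 (by omega) (by omega)]
      simp
    · simp
  have hKx : 2 * K ≤ x := by
    have h1 : 2 ≤ x / K := by
      have := Nat.le_self_pow hu z'
      omega
    rw [Nat.le_div_iff_mul_le hK0] at h1
    exact h1
  have h1 := hr K (x / K) hK hM P hP rfl x y (fun m => if m = 1 then 0 else roughInd z m)
    (fun m => by split_ifs; exacts [le_rfl, roughInd_nonneg _ _])
    (fun m => by split_ifs; exacts [roughInd_nonneg _ _, roughInd_anti hzz _])
  have h2 : ∀ k ∈ Finset.Ioc K (2 * K), cofactorSum P z x y k = ∑ m ∈ Finset.range (x / K + 1),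
      ((if y < k * m ∧ k * m ≤ x then (if m = 1 then 0 else roughInd z m) else 0 : ℝ) : ℂ)
          * expi (P.eval ((k * m : ℕ) : ℝ)) := by
    intro k hk
    rw [Finset.mem_Ioc] at hk
    rw [cofactorSum]
    have h3 : ∀ S : Finset ℕ, (∑ m ∈ S,
      ((if y < k * m ∧ k * m ≤ x then (if m = 1 then 0 else roughInd z m) else 0 : ℝ) : ℂ)
          * expi (P.eval ((k * m : ℕ) : ℝ))) = ∑ m ∈ S.filter (fun m => y < k * m ∧ k * m ≤ x),
      ((if m = 1 then 0 else roughInd z m : ℝ) : ℂ) * expi (P.eval ((k * m : ℕ) : ℝ)) := by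
      intro S
      rw [Finset.sum_filter]
      refine Finset.sum_congr rfl fun m _ => ?_
      split_ifs <;> simp
    rw [h3, h3]
    refine Finset.sum_congr ?_ fun _ _ => rfl
    ext m
    simp only [Finset.mem_filter, Finset.mem_Ioc, Finset.mem_range]
    constructor
    · rintro ⟨_, h4⟩
      refine ⟨?_, h4⟩
      have : m ≤ x / K := by
        rw [Nat.le_div_iff_mul_le hK0]
        nlinarith
      omega
    · rintro ⟨_, h4⟩
      refine ⟨⟨?_, ?_⟩, h4⟩
      · rcases Nat.eq_zero_or_pos m with rfl | hm
        · simp at h4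
        · exact hm
      · nlinarith
  rw [Finset.sum_congr rfl fun k hk => by rw [h2 k hk]]
  set S : ℕ → ℂ := fun k => ∑ m ∈ Finset.range (x / K + 1),
      ((if y < k * m ∧ k * m ≤ x then (if m = 1 then 0 else roughInd z m) else 0 : ℝ) : ℂ)
          * expi (P.eval ((k * m : ℕ) : ℝ)) with hS
  have h4 : ‖∑ k ∈ Finset.Ioc K (2 * K), ((ArithmeticFunction.vonMangoldt k * roughInd z k : ℝ) : ℂ)
      * S k‖ ≤ ∑ k ∈ Finset.Ioc K (2 * K), ArithmeticFunction.vonMangoldt k * (roughInd z k * ‖S k‖) := by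
    refine (norm_sum_le _ _).trans (le_of_eq (Finset.sum_congr rfl fun k _ => ?_))
    rw [norm_mul, Complex.norm_real, Real.norm_eq_abs, abs_of_nonneg, mul_assoc]
    exact mul_nonneg ArithmeticFunction.vonMangoldt_nonneg (roughInd_nonneg _ _)
  have h5 := Finset.sum_mul_sq_le_sq_mul_sq (Finset.Ioc K (2 * K))
    (fun k => (ArithmeticFunction.vonMangoldt k : ℝ)) (fun k => roughInd z k * ‖S k‖)
  have h6 : ∑ k ∈ Finset.Ioc K (2 * K), (roughInd z k * ‖S k‖) ^ 2
      ≤ E * (mertensProd z' ^ 3 * K * (x / K : ℕ) ^ 2) := by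
    refine le_trans (Finset.sum_le_sum fun k _ => ?_) h1
    rw [mul_pow, sq (roughInd z k), roughInd_mul_self]
    exact mul_le_mul_of_nonneg_right (roughInd_anti hzz _) (by positivity)
  have h7 := sum_sq_vonMangoldt_le hKx
  have h8 : (K : ℝ) * (x / K : ℕ) ≤ x := by
    exact_mod_cast Nat.mul_div_le x K
  calc _ ≤ (∑ k ∈ Finset.Ioc K (2 * K),
        ArithmeticFunction.vonMangoldt k * (roughInd z k * ‖S k‖)) ^ 2 := by gcongr
    _ ≤ _ := h5
    _ ≤ (Real.log x * (12 * K)) * (E * (mertensProd z' ^ 3 * K * (x / K : ℕ) ^ 2)) := by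
        refine mul_le_mul h7 h6 (Finset.sum_nonneg fun k _ => sq_nonneg _) (by positivity)
    _ = E * (12 * ((K : ℝ) * (x / K : ℕ)) ^ 2 * (Real.log x * mertensProd z' ^ 3)) := by ring
    _ ≤ _ := by gcongr

lemma bilinear_error_le {w v : ℕ} (hw : 1 ≤ w) (hv : 1 ≤ v) (d : ℕ) (hd : 1 ≤ d) :
    36 * (2 * (1 / (v : ℝ) ^ (4 * w)) + 5 * (1 / (v : ℝ) ^ 4))
      + 5 / (1 / (v : ℝ) ^ 4) ^ (w - 1) * (4 * (1 / (v : ℝ) ^ (4 * w)) ^ 2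
        + 36 * ((d : ℝ) / ((d * v ^ (4 * w) : ℕ) : ℝ))) ≤ 452 / (v : ℝ) ^ 4 := by
  have hv1 : (1 : ℝ) ≤ v := by exact_mod_cast hv
  have hd0 : (0 : ℝ) < d := by exact_mod_cast hd
  obtain ⟨w, rfl⟩ : ∃ w', w = w' + 1 := ⟨w - 1, by omega⟩
  have h1 : (1 : ℝ) / (v : ℝ) ^ (4 * (w + 1)) ≤ 1 / (v : ℝ) ^ 4 := by
    apply one_div_le_one_div_of_le (by positivity)
    exact pow_le_pow_right₀ hv1 (by omega)
  have h2 : (1 : ℝ) / (v : ℝ) ^ (4 * (w + 1)) ≤ 1 := by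
    rw [div_le_one (by positivity)]
    exact one_le_pow₀ hv1
  have h3 : (d : ℝ) / ((d * v ^ (4 * (w + 1)) : ℕ) : ℝ) = 1 / (v : ℝ) ^ (4 * (w + 1)) := by
    push_cast
    field_simp
  have h4 : (1 / (v : ℝ) ^ (4 * (w + 1))) ^ 2 ≤ 1 / (v : ℝ) ^ (4 * (w + 1)) := by
    rw [sq]
    exact mul_le_of_le_one_left (by positivity) h2
  have h5 : 5 / (1 / (v : ℝ) ^ 4) ^ (w + 1 - 1) * (40 * (1 / (v : ℝ) ^ (4 * (w + 1))))
      = 200 / (v : ℝ) ^ 4 := by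
    have hv4 : (v : ℝ) ^ 4 ≠ 0 := by positivity
    rw [Nat.add_sub_cancel, mul_add, mul_one, pow_add, pow_mul, one_div_pow]
    generalize (v : ℝ) ^ 4 = b at hv4
    have hb : b ^ w ≠ 0 := pow_ne_zero _ hv4
    generalize b ^ w = c at hb
    field_simp
    norm_num
  have h6 : 5 / (1 / (v : ℝ) ^ 4) ^ (w + 1 - 1) * (4 * (1 / (v : ℝ) ^ (4 * (w + 1))) ^ 2
        + 36 * ((d : ℝ) / ((d * v ^ (4 * (w + 1)) : ℕ) : ℝ))) ≤ 200 / (v : ℝ) ^ 4 := by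
    rw [← h5, h3]
    refine mul_le_mul_of_nonneg_left ?_ (by positivity)
    linarith
  have h7 : 452 / (v : ℝ) ^ 4 = 252 * (1 / (v : ℝ) ^ 4) + 200 / (v : ℝ) ^ 4 := by ring
  rw [h7]
  linarith

lemma cofactorSum_eq_zero (P : Polynomial ℝ) {z x y k : ℕ} (h : x < k) : cofactorSum P z x y k = 0 := by
  refine Finset.sum_eq_zero fun m hm => ?_
  rw [Finset.mem_Ioc] at hm
  rw [if_neg]
  · simp
  · rintro ⟨_, h2⟩
    nlinarith

lemma log_add_one_le_three_mul_log {x : ℕ} (hx : 2 ≤ x) : ((Nat.log 2 x + 1 : ℕ) : ℝ) ≤ 3 * Real.log x := by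
  have h2 := Real.log_two_gt_d9
  have h3 : Real.log 2 ≤ Real.log x := Real.log_le_log (by norm_num) (by exact_mod_cast hx)
  have h1 : (Nat.log 2 x : ℝ) * Real.log 2 ≤ Real.log x := by
    rw [← Real.log_pow]
    refine Real.log_le_log (by positivity) ?_
    exact_mod_cast Nat.pow_log_le_self 2 (by omega)
  push_cast
  have h4 : (0 : ℝ) ≤ Nat.log 2 x := Nat.cast_nonneg _
  nlinarith

lemma norm_sum_cofactorSum_le {D : ℕ} {P : Polynomial ℝ} (hP : P.natDegree ≤ D + 1)
    (hα : Irrational (P.coeff (D + 1))) (u : ℕ) {δ : ℝ} (hδ : 0 < δ) :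
    ∀ᶠ m in atTop, ∀ x y : ℕ, 2 ≤ x → Real.log x ≤ 2 * u * Real.log ((2 ^ 2 ^ m : ℕ) : ℝ) →
      ‖∑ k ∈ Finset.Ioc 0 x, ((ArithmeticFunction.vonMangoldt k * roughInd (2 ^ 2 ^ m) k : ℝ) : ℂ)
          * cofactorSum P (2 ^ 2 ^ m) x y k‖ ≤ δ * x := by
  set w := 2 ^ (D + 1) with hw
  obtain ⟨v, hv, m₀, M, hmod⟩ := exists_roughModel (D + 1) (4 * w)
    (⌈4000000 * (u : ℝ) ^ 3 / δ ^ 2⌉₊ + 1)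
  have hv1 : 1 ≤ v := by omega
  have hvR : (1 : ℝ) ≤ v := by exact_mod_cast hv1
  have hvδ : 4000000 * (u : ℝ) ^ 3 / v ≤ δ ^ 2 := by
    have h1 : 4000000 * (u : ℝ) ^ 3 / δ ^ 2 ≤ v := by
      refine (Nat.le_ceil _).trans ?_
      exact Nat.cast_le.2 (by omega)
    rw [div_le_iff₀ (by positivity)] at h1 ⊢
    linarith
  have hw1 : 1 ≤ w := Nat.one_le_two_pow
  have hη1 : 1 / (v : ℝ) ^ (4 * w) ≤ 1 := by
    rw [div_le_one (by positivity)]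
    exact one_le_pow₀ hvR
  have hE := bilinear_error_le hw1 hv1 (D + 1) (by omega)
  have key := hmod.norm_sq_bilinear_le (by positivity) hη1 (by omega)
    (H := (D + 1) * v ^ (4 * w)) (by positivity) (t := 1 / (v : ℝ) ^ 4) (by positivity) hP hα
  rw [← hw] at key
  set j := Nat.log 2 v + 1 with hj
  have hj1 : v < 2 ^ j := Nat.lt_pow_succ_log_self (by norm_num) v
  have hj2 : 2 ^ j ≤ 2 * v := by
    rw [hj, pow_succ']
    exact Nat.mul_le_mul_left 2 (Nat.pow_log_le_self 2 (by omega))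
  have hsub : Tendsto (fun m : ℕ => m - (m₀ + j)) atTop atTop := tendsto_sub_atTop_nat _
  filter_upwards [hsub.eventually key, eventually_ge_atTop (m₀ + j)] with m hm hmj x y hx hlog
  set Z := 2 ^ 2 ^ m with hZ
  set Z' := 2 ^ 2 ^ (m₀ + (m - (m₀ + j))) with hZ'
  have hZZ : Z = Z' ^ 2 ^ j := by
    rw [hZ, hZ', ← pow_mul, ← pow_add]
    congr 2
    omega
  have hZ'2 : 2 ≤ Z' := Nat.le_self_pow (by positivity) 2
  have hZ'Z : 2 * Z' ^ v ≤ Z := by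
    calc 2 * Z' ^ v ≤ Z' * Z' ^ v := Nat.mul_le_mul_right _ hZ'2
      _ = Z' ^ (v + 1) := (pow_succ' _ _).symm
      _ ≤ Z := by rw [hZZ]; exact Nat.pow_le_pow_right (by omega) hj1
  have hV := mertensProd_pos Z'
  have hZ'R : (2 : ℝ) ≤ Z' := by exact_mod_cast hZ'2
  have hlogZ' : 0 ≤ Real.log Z' := Real.log_natCast_nonneg _
  have hVlog : mertensProd Z' * Real.log Z' ≤ 1 := by
    refine le_trans ?_ (mertensProd_mul_log_le Z')
    refine mul_le_mul_of_nonneg_left (Real.log_le_log (by linarith) (by linarith)) hV.le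
  have hlogZ : Real.log (Z : ℝ) ≤ 2 * v * Real.log Z' := by
    rw [hZZ, Nat.cast_pow, Real.log_pow]
    refine mul_le_mul_of_nonneg_right ?_ hlogZ'
    exact_mod_cast hj2
  have hxV : Real.log x * mertensProd Z' ≤ 4 * u * v := by
    have h1 : Real.log x ≤ 2 * u * (2 * v * Real.log Z') :=
      hlog.trans (mul_le_mul_of_nonneg_left hlogZ (by positivity))
    calc Real.log x * mertensProd Z' ≤ 2 * u * (2 * v * Real.log Z') * mertensProd Z' :=
          mul_le_mul_of_nonneg_right h1 hV.le
      _ = 4 * u * v * (mertensProd Z' * Real.log Z') := by ring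
      _ ≤ 4 * u * v * 1 := mul_le_mul_of_nonneg_left hVlog (by positivity)
      _ = _ := mul_one _
  have hlogx : 0 ≤ Real.log x := Real.log_natCast_nonneg _
  set f : ℕ → ℂ := fun k => ((ArithmeticFunction.vonMangoldt k * roughInd Z k : ℝ) : ℂ)
    * cofactorSum P Z x y k with hf
  set I := Nat.log 2 x + 1 with hI
  have hxI : x ≤ 2 ^ I := (Nat.lt_pow_succ_log_self (by norm_num) x).le
  set B := 452 / (v : ℝ) ^ 4 * (12 * (x : ℝ) ^ 2 * (Real.log x * mertensProd Z' ^ 3)) with hB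
  have hB0 : 0 ≤ B := by positivity
  have h1 : ∑ k ∈ Finset.Ioc 0 x, f k = ∑ i ∈ Finset.range I, ∑ k ∈ Finset.Ioc (2 ^ i) (2 * 2 ^ i), f k := by
    have h2 : ∑ k ∈ Finset.Ioc 0 x, f k = ∑ k ∈ Finset.Ioc 0 (2 ^ I), f k := by
      refine Finset.sum_subset (Finset.Ioc_subset_Ioc_right hxI) fun k hk hk2 => ?_
      rw [Finset.mem_Ioc] at hk hk2
      simp only [hf]
      rw [cofactorSum_eq_zero P (by omega), mul_zero]
    rw [h2, sum_Ioc_dyadic]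
    simp [hf]
  have h3 : ∀ i ∈ Finset.range I, ‖∑ k ∈ Finset.Ioc (2 ^ i) (2 * 2 ^ i), f k‖ ≤ √B := by
    intro i _
    refine Real.le_sqrt_of_sq_le ((hm Z hZ'Z x y (2 ^ i) (by positivity)).trans ?_)
    exact mul_le_mul_of_nonneg_right hE (by positivity)
  have h4 : ‖∑ k ∈ Finset.Ioc 0 x, f k‖ ≤ (3 * Real.log x) * √B := by
    rw [h1]
    refine (norm_sum_le_of_le _ h3).trans ?_
    rw [Finset.sum_const, Finset.card_range, nsmul_eq_mul]
    exact mul_le_mul_of_nonneg_right (log_add_one_le_three_mul_log hx) (Real.sqrt_nonneg _)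
  refine h4.trans (abs_le_of_sq_le_sq' ?_ (by positivity)).2
  rw [mul_pow, Real.sq_sqrt hB0]
  calc (3 * Real.log x) ^ 2 * B
      = 48816 / (v : ℝ) ^ 4 * (x : ℝ) ^ 2 * (Real.log x * mertensProd Z') ^ 3 := by rw [hB]; ring
    _ ≤ 48816 / (v : ℝ) ^ 4 * (x : ℝ) ^ 2 * (4 * u * v) ^ 3 := by gcongr
    _ = 3124224 * (u : ℝ) ^ 3 / v * (x : ℝ) ^ 2 := by
        have hv0 : (v : ℝ) ≠ 0 := by positivity
        field_simp
        ring
    _ ≤ 4000000 * (u : ℝ) ^ 3 / v * (x : ℝ) ^ 2 := by gcongr; norm_num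
    _ ≤ δ ^ 2 * (x : ℝ) ^ 2 := by gcongr
    _ = (δ * x) ^ 2 := by ring

lemma roughInd_prime {z p : ℕ} (hp : p.Prime) (h : z < p) : roughInd z p = 1 := by
  have h1 : Rough z p := by
    intro q hq hqz hd
    have := (Nat.prime_dvd_prime_iff_eq hq hp).1 hd
    omega
  unfold roughInd
  rw [if_pos h1]

lemma sum_one_sub_roughInd_mul_le {z y x : ℕ} (h : z ≤ y) :
    ∑ n ∈ Finset.Ioc y x, (1 - roughInd z n) * ArithmeticFunction.vonMangoldt n
      ≤ Chebyshev.psi (x : ℝ) - Chebyshev.theta (x : ℝ) := by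
  rw [Chebyshev.psi_sub_theta_eq_sum_not_prime, Nat.floor_natCast, Finset.sum_filter]
  refine le_trans (Finset.sum_le_sum (g := fun n => if ¬ Nat.Prime n then
    ArithmeticFunction.vonMangoldt n else 0) fun n hn => ?_) ?_
  · rw [Finset.mem_Ioc] at hn
    by_cases hp : n.Prime
    · rw [roughInd_prime hp (by omega)]
      simp [hp]
    · rw [if_pos hp]
      exact mul_le_of_le_one_left ArithmeticFunction.vonMangoldt_nonneg
        (by linarith [roughInd_nonneg z n])
  · refine Finset.sum_le_sum_of_subset_of_nonneg (Finset.Ioc_subset_Ioc_left (Nat.zero_le _))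
      fun n _ _ => ?_
    split_ifs
    exacts [le_rfl, ArithmeticFunction.vonMangoldt_nonneg]

lemma tendsto_log_two : Tendsto (Nat.log 2) atTop atTop := by
  refine tendsto_atTop_atTop_of_monotone (fun _ _ h => Nat.log_mono_right h) fun b => ⟨2 ^ b, ?_⟩
  rw [Nat.log_pow (by norm_num)]

lemma norm_sum_vonMangoldt_mul_expi_le {D : ℕ} {P : Polynomial ℝ} (hP : P.natDegree ≤ D + 1)
    (hα : Irrational (P.coeff (D + 1))) {ε : ℝ} (hε : 0 < ε) :
    ∀ᶠ x : ℕ in atTop, ‖∑ n ∈ Finset.Ioc (x / 2) x, (ArithmeticFunction.vonMangoldt n : ℂ)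
      * expi (P.eval (n : ℝ))‖ ≤ ε * x := by
  obtain ⟨u, hu, m₀, M, hmod⟩ := exists_roughModel (D + 1) 2 (⌈16 / ε⌉₊ + 2)
  have hu0 : u ≠ 0 := by omega
  have huR : (1 : ℝ) ≤ u := by exact_mod_cast (show 1 ≤ u by omega)
  have huε : 4 / u ≤ ε / 4 := by
    have h1 : 16 / ε ≤ u := (Nat.le_ceil _).trans (Nat.cast_le.2 (by omega))
    rw [div_le_iff₀ (by positivity)] at h1 ⊢
    linarith
  have hη1 : 1 / (u : ℝ) ^ 2 ≤ 1 := by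
    rw [div_le_one (by positivity)]
    exact one_le_pow₀ huR
  obtain ⟨C, hC⟩ := Chebyshev.psi_sub_theta_le_mul_sqrt
  have hmt : Tendsto (fun x : ℕ => Nat.log 2 (Nat.log 2 x / u)) atTop atTop :=
    tendsto_log_two.comp ((Nat.tendsto_div_const_atTop hu0).comp tendsto_log_two)
  have hsub : Tendsto (fun m : ℕ => m - m₀) atTop atTop := tendsto_sub_atTop_nat _
  have hsq : ∀ᶠ x : ℕ in atTop, 4 * |C| / ε ≤ √(x : ℝ) :=
    (Real.tendsto_sqrt_atTop.comp tendsto_natCast_atTop_atTop).eventually_ge_atTop _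
  have hlg : ∀ᶠ x : ℕ in atTop, 48 * u / ε ≤ Real.log x :=
    (Real.tendsto_log_atTop.comp tendsto_natCast_atTop_atTop).eventually_ge_atTop _
  filter_upwards [hmt.eventually (norm_sum_cofactorSum_le hP hα u (δ := ε / 4) (by positivity)),
    (hsub.comp hmt).eventually (hmod.norm_sum_irrational_le (by positivity) hu0 hα),
    hmt.eventually_ge_atTop (m₀ + M), hsq, hlg, tendsto_log_two.eventually_ge_atTop u,
    eventually_ge_atTop 2]
    with x hII hI hm hsq hlg hxu hx2
  set y := x / 2 with hy
  set m := Nat.log 2 (Nat.log 2 x / u) with hmdef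
  simp only [Function.comp] at hI
  have hmm : m₀ + (m - m₀) = m := by omega
  rw [hmm] at hI
  have hsum := fun K => hmod.sum_roughInd_le hη1 hu0 (r := m - m₀) (by omega) (K := K)
  rw [hmm] at hsum
  set Z := 2 ^ 2 ^ m with hZ
  have hdiv : 0 < Nat.log 2 x / u := Nat.div_pos hxu (by omega)
  have hZx : Z ^ u ≤ x := by
    have h1 : 2 ^ m ≤ Nat.log 2 x / u := Nat.pow_log_le_self 2 (by omega)
    rw [Nat.le_div_iff_mul_le (by omega)] at h1
    rw [hZ, ← pow_mul]
    exact (Nat.pow_le_pow_right (by norm_num) h1).trans (Nat.pow_log_le_self 2 (by omega))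
  have hxZ : x ≤ Z ^ (2 * u) := by
    have h1 : Nat.log 2 x / u < 2 ^ (m + 1) := Nat.lt_pow_succ_log_self (by norm_num) _
    rw [Nat.div_lt_iff_lt_mul (by omega)] at h1
    have h2 : x < 2 ^ (Nat.log 2 x + 1) := Nat.lt_pow_succ_log_self (by norm_num) _
    rw [hZ, ← pow_mul]
    refine h2.le.trans (Nat.pow_le_pow_right (by norm_num) ?_)
    calc Nat.log 2 x + 1 ≤ 2 ^ (m + 1) * u := h1
      _ = 2 ^ m * (2 * u) := by ring
  have hZ2 : 2 ≤ Z := Nat.le_self_pow (by positivity) 2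
  have hZy : Z ≤ y := by
    have h1 : Z ^ 2 ≤ Z ^ u := Nat.pow_le_pow_right (by omega) (by omega)
    rw [hy, Nat.le_div_iff_mul_le (by norm_num)]
    nlinarith
  have hx0 : (0 : ℝ) < x := by exact_mod_cast (show 0 < x by omega)
  have hlogxZ : Real.log x ≤ 2 * u * Real.log (Z : ℝ) := by
    have := Real.log_le_log hx0 (by exact_mod_cast hxZ : (x : ℝ) ≤ (Z : ℝ) ^ (2 * u))
    rw [Real.log_pow] at this
    push_cast at this
    exact this
  have hV := mertensProd_pos Z
  have hlogx : 0 < Real.log x := Real.log_pos (by exact_mod_cast (show 1 < x by omega))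
  have hVx : mertensProd Z * Real.log x ≤ 2 * u := by
    have h1 : mertensProd Z * Real.log Z ≤ 1 := by
      refine le_trans ?_ (mertensProd_mul_log_le Z)
      have : (0 : ℝ) < Z := by exact_mod_cast (show 0 < Z by omega)
      exact mul_le_mul_of_nonneg_left (Real.log_le_log this (by linarith)) hV.le
    calc mertensProd Z * Real.log x ≤ mertensProd Z * (2 * u * Real.log Z) :=
          mul_le_mul_of_nonneg_left hlogxZ hV.le
      _ = 2 * u * (mertensProd Z * Real.log Z) := by ring
      _ ≤ 2 * u * 1 := mul_le_mul_of_nonneg_left h1 (by positivity)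
      _ = _ := mul_one _
  have hIoc : Finset.Ioc y x = Finset.Ico (y + 1) (y + 1 + (x - y)) := by
    ext n; simp only [Finset.mem_Ioc, Finset.mem_Ico]; omega
  have hII' := hII x y hx2 hlogxZ
  have hI' := hI x hZx (y + 1) (x - y) (by omega) P hP rfl
  have hsum' := hsum x hZx (y + 1) (L := x - y) (by omega)
  rw [← hIoc] at hI' hsum'
  have hlogdiff : ∀ n ∈ Finset.Ioc y x, |Real.log x - Real.log n| ≤ 1 := by
    intro n hn
    rw [Finset.mem_Ioc] at hn
    have hn0 : (0 : ℝ) < n := by exact_mod_cast (show 0 < n by omega)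
    have h1 : Real.log n ≤ Real.log x := Real.log_le_log hn0 (by exact_mod_cast hn.2)
    have h2 : Real.log x ≤ Real.log (2 * n) :=
      Real.log_le_log hx0 (by exact_mod_cast (show x ≤ 2 * n by omega))
    rw [Real.log_mul (by norm_num) hn0.ne'] at h2
    have := Real.log_two_lt_d9
    rw [abs_of_nonneg (by linarith)]
    linarith
  have hA : ‖∑ n ∈ Finset.Ioc y x, (((1 - roughInd Z n) * ArithmeticFunction.vonMangoldt n : ℝ) : ℂ)
      * expi (P.eval (n : ℝ))‖ ≤ ε / 4 * x := by
    have h1 : ‖∑ n ∈ Finset.Ioc y x, (((1 - roughInd Z n) * ArithmeticFunction.vonMangoldt n : ℝ) : ℂ)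
      * expi (P.eval (n : ℝ))‖ ≤ ∑ n ∈ Finset.Ioc y x, (1 - roughInd Z n) * ArithmeticFunction.vonMangoldt n := by
      refine (norm_sum_le _ _).trans (le_of_eq (Finset.sum_congr rfl fun n _ => ?_))
      rw [norm_mul, norm_expi, mul_one, Complex.norm_real, Real.norm_eq_abs, abs_of_nonneg]
      exact mul_nonneg (by linarith [roughInd_le_one Z n]) ArithmeticFunction.vonMangoldt_nonneg
    have h2 : C * √(x : ℝ) ≤ ε / 4 * x := by
      have h3 := Real.mul_self_sqrt hx0.le
      have h4 : |C| ≤ ε / 4 * √(x : ℝ) := by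
        rw [div_le_iff₀ hε] at hsq
        linarith
      calc C * √(x : ℝ) ≤ |C| * √(x : ℝ) := by gcongr; exact le_abs_self C
        _ ≤ ε / 4 * √(x : ℝ) * √(x : ℝ) := by gcongr
        _ = ε / 4 * x := by rw [mul_assoc, h3]
    exact h1.trans ((sum_one_sub_roughInd_mul_le hZy).trans ((hC x).trans h2))
  have hB : ‖(Real.log x : ℂ) * ∑ n ∈ Finset.Ioc y x, (roughInd Z n : ℂ) * expi (P.eval (n : ℝ))‖
      ≤ ε / 4 * x := by
    rw [norm_mul, Complex.norm_real, Real.norm_eq_abs, abs_of_pos hlogx]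
    calc _ ≤ Real.log x * (2 * (1 / (u : ℝ) ^ 2) * (mertensProd Z * x)) := by gcongr
      _ = 2 / (u : ℝ) ^ 2 * (mertensProd Z * Real.log x) * x := by ring
      _ ≤ 2 / (u : ℝ) ^ 2 * (2 * u) * x := by gcongr
      _ = 4 / u * x := by field_simp; norm_num
      _ ≤ ε / 4 * x := by gcongr
  have hD : ‖∑ n ∈ Finset.Ioc y x, ((roughInd Z n * (Real.log x - Real.log n) : ℝ) : ℂ)
      * expi (P.eval (n : ℝ))‖ ≤ ε / 4 * x := by
    have h1 : ‖∑ n ∈ Finset.Ioc y x, ((roughInd Z n * (Real.log x - Real.log n) : ℝ) : ℂ)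
      * expi (P.eval (n : ℝ))‖ ≤ ∑ n ∈ Finset.Ioc y x, roughInd Z n := by
      refine norm_sum_le_of_le _ fun n hn => ?_
      rw [norm_mul, norm_expi, mul_one, Complex.norm_real, Real.norm_eq_abs, abs_mul,
        abs_of_nonneg (roughInd_nonneg Z n)]
      exact mul_le_of_le_one_right (roughInd_nonneg Z n) (hlogdiff n hn)
    refine h1.trans (hsum'.trans ?_)
    have h2 : 6 * mertensProd Z ≤ ε / 4 := by
      rw [div_le_iff₀ hε] at hlg
      have h3 : 6 * mertensProd Z * Real.log x ≤ ε / 4 * Real.log x := by nlinarith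
      exact le_of_mul_le_mul_right h3 hlogx
    calc _ = 6 * mertensProd Z * x := by ring
      _ ≤ _ := by gcongr
  have hsplit := sum_roughInd_mul_log P Z x y
  have heq : ∑ n ∈ Finset.Ioc y x, (ArithmeticFunction.vonMangoldt n : ℂ) * expi (P.eval (n : ℝ))
      = ∑ n ∈ Finset.Ioc y x, (((1 - roughInd Z n) * ArithmeticFunction.vonMangoldt n : ℝ) : ℂ)
          * expi (P.eval (n : ℝ))
        + (Real.log x : ℂ) * ∑ n ∈ Finset.Ioc y x, (roughInd Z n : ℂ) * expi (P.eval (n : ℝ))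
        - ∑ n ∈ Finset.Ioc y x, ((roughInd Z n * (Real.log x - Real.log n) : ℝ) : ℂ)
          * expi (P.eval (n : ℝ))
        - ∑ k ∈ Finset.Ioc 0 x, ((ArithmeticFunction.vonMangoldt k * roughInd Z k : ℝ) : ℂ)
          * cofactorSum P Z x y k := by
    rw [eq_sub_iff_add_eq'.2 hsplit.symm, Finset.mul_sum, ← Finset.sum_add_distrib,
      ← Finset.sum_sub_distrib, ← Finset.sum_sub_distrib, ← Finset.sum_sub_distrib]
    refine Finset.sum_congr rfl fun n _ => ?_
    push_cast
    ring
  rw [heq]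
  refine (norm_sub_le _ _).trans ?_
  have h1 := (norm_sub_le (∑ n ∈ Finset.Ioc y x, (((1 - roughInd Z n) * ArithmeticFunction.vonMangoldt n : ℝ) : ℂ)
          * expi (P.eval (n : ℝ))
        + (Real.log x : ℂ) * ∑ n ∈ Finset.Ioc y x, (roughInd Z n : ℂ) * expi (P.eval (n : ℝ)))
        (∑ n ∈ Finset.Ioc y x, ((roughInd Z n * (Real.log x - Real.log n) : ℝ) : ℂ)
          * expi (P.eval (n : ℝ))))
  have h2 := norm_add_le (∑ n ∈ Finset.Ioc y x, (((1 - roughInd Z n) * ArithmeticFunction.vonMangoldt n : ℝ) : ℂ)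
          * expi (P.eval (n : ℝ)))
        ((Real.log x : ℂ) * ∑ n ∈ Finset.Ioc y x, (roughInd Z n : ℂ) * expi (P.eval (n : ℝ)))
  linarith

/-- Vinogradov's theorem on exponential sums over primes, for polynomial phases with irrational
leading coefficient. -/
lemma sum_vonMangoldt_mul_expi_isLittleO {D : ℕ} {P : Polynomial ℝ} (hP : P.natDegree ≤ D + 1)
    (hα : Irrational (P.coeff (D + 1))) :
    Tendsto (fun x : ℕ => (∑ n ∈ Finset.Ioc 0 x, (ArithmeticFunction.vonMangoldt n : ℂ)
      * expi (P.eval (n : ℝ))) / x) atTop (nhds 0) := by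
  set S : ℕ → ℂ := fun x => ∑ n ∈ Finset.Ioc 0 x, (ArithmeticFunction.vonMangoldt n : ℂ)
      * expi (P.eval (n : ℝ)) with hS
  have hhalf : ∀ x, S x = S (x / 2) + ∑ n ∈ Finset.Ioc (x / 2) x,
      (ArithmeticFunction.vonMangoldt n : ℂ) * expi (P.eval (n : ℝ)) := fun x =>
    (Finset.sum_Ioc_consecutive _ (Nat.zero_le _) (Nat.div_le_self _ _)).symm
  have hbound : ∀ ε : ℝ, 0 < ε → ∃ C : ℝ, ∀ x : ℕ, ‖S x‖ ≤ 2 * ε * x + C := by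
    intro ε hε
    obtain ⟨x₀, hx₀⟩ := eventually_atTop.1 (norm_sum_vonMangoldt_mul_expi_le hP hα hε)
    refine ⟨∑ i ∈ Finset.range (x₀ + 1), ‖S i‖, fun x => ?_⟩
    induction x using Nat.strong_induction_on with
    | _ x ih =>
      rcases le_or_gt x x₀ with hx | hx
      · have h1 : ‖S x‖ ≤ ∑ i ∈ Finset.range (x₀ + 1), ‖S i‖ :=
          Finset.single_le_sum (f := fun i => ‖S i‖) (fun _ _ => norm_nonneg _) (Finset.mem_range.2 (by omega))
        have : 0 ≤ 2 * ε * (x : ℝ) := by positivity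
        linarith
      · have h1 := ih (x / 2) (by omega)
        have h2 := hx₀ x hx.le
        have h3 : ((x / 2 : ℕ) : ℝ) ≤ x / 2 := Nat.cast_div_le
        rw [hhalf]
        refine (norm_add_le _ _).trans ?_
        nlinarith
  rw [Metric.tendsto_atTop]
  intro ε hε
  obtain ⟨C, hC⟩ := hbound (ε / 4) (by positivity)
  obtain ⟨N, hN⟩ := exists_nat_gt (2 * C / ε)
  refine ⟨N + 1, fun x hx => ?_⟩
  have hx0 : (0 : ℝ) < x := by exact_mod_cast (show 0 < x by omega)
  have hNx : (N : ℝ) ≤ x := by exact_mod_cast (show N ≤ x by omega)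
  rw [dist_zero_right, norm_div, Complex.norm_natCast, div_lt_iff₀ hx0]
  rw [div_lt_iff₀ hε] at hN
  have := hC x
  nlinarith

lemma norm_sum_Ico_mul_le_of_antitone {c : ℕ → ℂ} {f : ℕ → ℝ} {B : ℝ}
    (hc : ∀ k, ‖∑ n ∈ Finset.range k, c n‖ ≤ B) {N M : ℕ} (hNM : N ≤ M) (hf0 : ∀ n, N ≤ n → 0 ≤ f n)
    (hf : ∀ n, N ≤ n → f (n + 1) ≤ f n) :
    ‖∑ n ∈ Finset.Ico N M, (f n : ℂ) * c n‖ ≤ 2 * B * f N := by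
  set G : ℕ → ℂ := fun k => ∑ n ∈ Finset.range k, c n with hG
  have key : ‖∑ n ∈ Finset.Ico N M, (f n : ℂ) * c n - f M * G M + f N * G N‖ ≤ B * (f N - f M) := by
    induction M, hNM using Nat.le_induction with
    | base => simp
    | succ M hM ih =>
      have h1 : ∑ n ∈ Finset.Ico N (M + 1), (f n : ℂ) * c n - f (M + 1) * G (M + 1) + f N * G N
          = (∑ n ∈ Finset.Ico N M, (f n : ℂ) * c n - f M * G M + f N * G N)
            + ((f M - f (M + 1) : ℝ) : ℂ) * G (M + 1) := by
        rw [Finset.sum_Ico_succ_top hM]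
        simp only [hG, Finset.sum_range_succ]
        push_cast
        ring
      rw [h1]
      refine (norm_add_le _ _).trans ?_
      have h2 : ‖((f M - f (M + 1) : ℝ) : ℂ) * G (M + 1)‖ ≤ (f M - f (M + 1)) * B := by
        rw [norm_mul, Complex.norm_real, Real.norm_eq_abs, abs_of_nonneg (sub_nonneg.2 (hf M hM))]
        exact mul_le_mul_of_nonneg_left (hc _) (sub_nonneg.2 (hf M hM))
      linarith
  have h3 : ∀ k, N ≤ k → ‖(f k : ℂ) * G k‖ ≤ f k * B := fun k hk => by
    rw [norm_mul, Complex.norm_real, Real.norm_eq_abs, abs_of_nonneg (hf0 k hk)]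
    exact mul_le_mul_of_nonneg_left (hc _) (hf0 k hk)
  have h4 : ∑ n ∈ Finset.Ico N M, (f n : ℂ) * c n
      = (∑ n ∈ Finset.Ico N M, (f n : ℂ) * c n - f M * G M + f N * G N) + f M * G M - f N * G N := by
    ring
  rw [h4]
  refine (norm_sub_le _ _).trans ?_
  have h5 := norm_add_le (∑ n ∈ Finset.Ico N M, (f n : ℂ) * c n - f M * G M + f N * G N) (f M * G M)
  have h6 := h3 M hNM
  have h7 := h3 N le_rfl
  linarith

section DirichletCharacter

variable {q : ℕ} [NeZero q]

lemma sum_range_dirichletCharacter {χ : DirichletCharacter ℂ q} (hχ : χ ≠ 1) :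
    ∑ n ∈ Finset.range q, χ (n : ZMod q) = 0 := by
  rw [← MulChar.sum_eq_zero_of_ne_one hχ]
  refine Finset.sum_nbij' (fun n => (n : ZMod q)) ZMod.val (fun _ _ => Finset.mem_univ _)
    (fun b _ => Finset.mem_range.2 (ZMod.val_lt b)) (fun n hn => ?_) (fun b _ => ?_) (fun _ _ => rfl)
  · exact ZMod.val_cast_of_lt (Finset.mem_range.1 hn)
  · simp

lemma norm_sum_range_dirichletCharacter_le {χ : DirichletCharacter ℂ q} (hχ : χ ≠ 1) (k : ℕ) :
    ‖∑ n ∈ Finset.range k, χ (n : ZMod q)‖ ≤ q := by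
  induction k using Nat.strong_induction_on with
  | _ k ih =>
    rcases lt_or_ge k q with hk | hk
    · refine (norm_sum_le_of_le (n := fun _ => (1 : ℝ)) _ fun n _ => χ.norm_le_one _).trans ?_
      simp only [Finset.sum_const, Finset.card_range, nsmul_eq_mul, mul_one]
      exact_mod_cast hk.le
    · have hq := NeZero.pos q
      obtain ⟨j, rfl⟩ := Nat.exists_eq_add_of_le hk
      rw [Finset.sum_range_add, sum_range_dirichletCharacter hχ, zero_add]
      simp only [Nat.cast_add, CharP.cast_eq_zero, zero_add]
      exact ih j (by omega)

lemma norm_LFunction_one_sub_sum_le {χ : DirichletCharacter ℂ q} (hχ : χ ≠ 1) (N : ℕ) :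
    ‖χ.LFunction 1 - ∑ n ∈ Finset.Ioc 0 N, χ (n : ZMod q) / n‖ ≤ 2 * q / (N + 1) := by
  have hIoc : Finset.Ioc 0 N = Finset.Ico 1 (N + 1) := by
    ext; simp only [Finset.mem_Ioc, Finset.mem_Ico]; omega
  have hterm : ∀ s : ℝ, ∀ n : ℕ, n ≠ 0 → LSeries.term (χ ·) s n
      = (((n : ℝ) ^ (-s) : ℝ) : ℂ) * χ (n : ZMod q) := by
    intro s n hn
    rw [LSeries.term_of_ne_zero hn, Complex.ofReal_cpow (Nat.cast_nonneg _)]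
    push_cast
    rw [Complex.cpow_neg]
    ring
  have h1 : ∀ s : ℝ, 1 < s → ‖χ.LFunction s - ∑ n ∈ Finset.Ioc 0 N,
      (((n : ℝ) ^ (-s) : ℝ) : ℂ) * χ (n : ZMod q)‖ ≤ 2 * q / (N + 1) := by
    intro s hs
    have hs' : 1 < (s : ℂ).re := by simpa using hs
    have hsum := (DirichletCharacter.LSeriesSummable_of_one_lt_re χ hs').hasSum.tendsto_sum_nat
    rw [← LSeries, ← DirichletCharacter.LFunction_eq_LSeries χ hs'] at hsum
    refine le_of_tendsto (hsum.sub_const _).norm ?_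
    filter_upwards [eventually_ge_atTop (N + 1)] with M hM
    have h2 : ∑ n ∈ Finset.range M, LSeries.term (χ ·) s n
        = ∑ n ∈ Finset.Ico 1 M, (((n : ℝ) ^ (-s) : ℝ) : ℂ) * χ (n : ZMod q) := by
      rw [Finset.range_eq_Ico, Finset.sum_eq_sum_Ico_succ_bot (by omega), LSeries.term_zero, zero_add]
      refine Finset.sum_congr rfl fun n hn => hterm s n ?_
      rw [Finset.mem_Ico] at hn
      omega
    rw [h2, hIoc, ← Finset.sum_Ico_consecutive _ (show 1 ≤ N + 1 by omega) hM, add_sub_cancel_left]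
    refine (norm_sum_Ico_mul_le_of_antitone (norm_sum_range_dirichletCharacter_le hχ) hM
      (fun n _ => by positivity) fun n hn => ?_).trans ?_
    · refine Real.rpow_le_rpow_of_nonpos ?_ (by push_cast; linarith) (by linarith)
      exact_mod_cast (show 0 < n by omega)
    · have h3 : (((N + 1 : ℕ) : ℝ)) ^ (-s) ≤ 1 / (N + 1) := by
        rw [one_div, ← Real.rpow_neg_one]
        push_cast
        refine Real.rpow_le_rpow_of_exponent_le ?_ (by linarith)
        linarith [(Nat.cast_nonneg N : (0 : ℝ) ≤ N)]
      calc _ ≤ 2 * (q : ℝ) * (1 / (N + 1)) := mul_le_mul_of_nonneg_left h3 (by positivity)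
        _ = _ := by ring
  have hcont : Tendsto (fun s : ℝ => ‖χ.LFunction s - ∑ n ∈ Finset.Ioc 0 N,
      (((n : ℝ) ^ (-s) : ℝ) : ℂ) * χ (n : ZMod q)‖) (nhdsWithin 1 (Set.Ioi 1))
      (nhds ‖χ.LFunction 1 - ∑ n ∈ Finset.Ioc 0 N, χ (n : ZMod q) / n‖) := by
    refine Tendsto.norm (Tendsto.sub ?_ ?_)
    · have := ((DirichletCharacter.differentiable_LFunction hχ).continuous.comp
        Complex.continuous_ofReal).tendsto 1
      simp only [Function.comp, Complex.ofReal_one] at this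
      exact this.mono_left nhdsWithin_le_nhds
    · refine tendsto_finsetSum _ fun n hn => ?_
      rw [Finset.mem_Ioc] at hn
      have hn0 : (n : ℝ) ≠ 0 := by exact_mod_cast (show n ≠ 0 by omega)
      have h4 : Tendsto (fun s : ℝ => (n : ℝ) ^ (-s)) (nhds 1) (nhds ((n : ℝ) ^ (-1 : ℝ))) :=
        (Real.continuousAt_const_rpow hn0).tendsto.comp (continuous_neg.tendsto 1)
      have h5 : χ (n : ZMod q) / n = (((n : ℝ) ^ (-1 : ℝ) : ℝ) : ℂ) * χ (n : ZMod q) := by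
        rw [Real.rpow_neg_one]
        push_cast
        rw [div_eq_inv_mul]
      rw [h5]
      exact ((Complex.continuous_ofReal.tendsto _).comp
        (h4.mono_left nhdsWithin_le_nhds)).mul_const _
  exact le_of_tendsto hcont (eventually_nhdsWithin_of_forall h1)

lemma exists_norm_sum_mul_log_div_le {χ : DirichletCharacter ℂ q} (hχ : χ ≠ 1) :
    ∃ C : ℝ, ∀ N : ℕ, ‖∑ n ∈ Finset.Ioc 0 N, χ (n : ZMod q) * (Real.log n / n : ℝ)‖ ≤ C := by
  set f : ℕ → ℝ := fun n => Real.log n / n with hf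
  have hf0 : ∀ n, 0 ≤ f n := fun n => div_nonneg (Real.log_natCast_nonneg _) (Nat.cast_nonneg _)
  have hanti : ∀ n, 3 ≤ n → f (n + 1) ≤ f n := by
    intro n hn
    have hn3 : (3 : ℝ) ≤ n := by exact_mod_cast hn
    have he := Real.exp_one_lt_d9
    refine Real.log_div_self_antitoneOn (Set.mem_Ici.2 ?_) (Set.mem_Ici.2 ?_) ?_
    · linarith
    · push_cast; linarith
    · push_cast; linarith
  have hle : ∀ s : Finset ℕ, ‖∑ n ∈ s, χ (n : ZMod q) * (f n : ℂ)‖ ≤ ∑ n ∈ s, f n := by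
    intro s
    refine norm_sum_le_of_le _ fun n _ => ?_
    rw [norm_mul, Complex.norm_real, Real.norm_eq_abs, abs_of_nonneg (hf0 n)]
    exact mul_le_of_le_one_left (hf0 n) (χ.norm_le_one _)
  refine ⟨∑ n ∈ Finset.Ico 1 3, f n + 2 * q * f 3, fun N => ?_⟩
  have hIoc : Finset.Ioc 0 N = Finset.Ico 1 (N + 1) := by
    ext; simp only [Finset.mem_Ioc, Finset.mem_Ico]; omega
  change ‖∑ n ∈ Finset.Ioc 0 N, χ (n : ZMod q) * (f n : ℂ)‖ ≤ _
  rw [hIoc]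
  rcases lt_or_ge (N + 1) 3 with hN | hN
  · have h1 : ∑ n ∈ Finset.Ico 1 (N + 1), f n ≤ ∑ n ∈ Finset.Ico 1 3, f n :=
      Finset.sum_le_sum_of_subset_of_nonneg (Finset.Ico_subset_Ico_right hN.le) fun n _ _ => hf0 n
    have := hf0 3
    exact ((hle _).trans h1).trans (le_add_of_nonneg_right (by positivity))
  · rw [← Finset.sum_Ico_consecutive _ (show 1 ≤ 3 by norm_num) hN]
    refine (norm_add_le _ _).trans (add_le_add (hle _) ?_)
    have := norm_sum_Ico_mul_le_of_antitone (norm_sum_range_dirichletCharacter_le hχ) hN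
      (fun n _ => hf0 n) hanti
    simpa only [mul_comm (χ _)] using this

lemma exists_norm_sum_mul_vonMangoldt_div_le {χ : DirichletCharacter ℂ q} (hχ : χ ≠ 1) :
    ∃ C : ℝ, ∀ N : ℕ,
      ‖∑ n ∈ Finset.Ioc 0 N, χ (n : ZMod q) * (ArithmeticFunction.vonMangoldt n / n : ℝ)‖ ≤ C := by
  obtain ⟨C, hC⟩ := exists_norm_sum_mul_log_div_le hχ
  have hL : 0 < ‖χ.LFunction 1‖ := norm_pos_iff.2 (DirichletCharacter.LFunction_apply_one_ne_zero hχ)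
  refine ⟨(C + 2 * q * (Real.log 4 + 4)) / ‖χ.LFunction 1‖, fun N => ?_⟩
  rw [le_div_iff₀ hL]
  set F : ArithmeticFunction ℂ := ⟨fun n => χ (n : ZMod q) * (ArithmeticFunction.vonMangoldt n / n : ℝ), by simp⟩ with hF
  set G : ArithmeticFunction ℂ := ⟨fun n => χ (n : ZMod q) / n, by simp⟩ with hG
  have hFG : ∀ n, (F * G) n = χ (n : ZMod q) * (Real.log n / n : ℝ) := by
    intro n
    rw [ArithmeticFunction.mul_apply, ← ArithmeticFunction.vonMangoldt_sum, ← Nat.map_div_right_divisors,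
      Finset.sum_map, Complex.ofReal_div, Complex.ofReal_sum, Finset.sum_div, Finset.mul_sum]
    refine Finset.sum_congr rfl fun k hk => ?_
    obtain ⟨m, hm⟩ := Nat.dvd_of_mem_divisors hk
    have hn0 : n ≠ 0 := (Nat.mem_divisors.1 hk).2
    have hk0 : k ≠ 0 := by rintro rfl; simp at hm; exact hn0 hm
    have hnk : n / k = m := by rw [hm, Nat.mul_div_cancel_left _ (Nat.pos_of_ne_zero hk0)]
    change (χ (k : ZMod q) * (ArithmeticFunction.vonMangoldt k / k : ℝ)) *
      (χ ((n / k : ℕ) : ZMod q) / ((n / k : ℕ) : ℂ)) = _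
    rw [hnk, hm]
    have hm0 : m ≠ 0 := by rintro rfl; simp at hm; exact hn0 hm
    push_cast
    rw [map_mul]
    field_simp
  have hsplit := ArithmeticFunction.sum_Ioc_mul_eq_sum_sum F G N
  rw [Finset.sum_congr rfl fun n _ => hFG n] at hsplit
  have herr : ‖∑ n ∈ Finset.Ioc 0 N, F n * (χ.LFunction 1 - ∑ m ∈ Finset.Ioc 0 (N / n), G m)‖
      ≤ 2 * q * (Real.log 4 + 4) := by
    rcases Nat.eq_zero_or_pos N with rfl | hN
    · simp only [Finset.Ioc_self, Finset.sum_empty, norm_zero]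
      have := Real.log_nonneg (show (1 : ℝ) ≤ 4 by norm_num)
      positivity
    have hN0 : (0 : ℝ) < N := by exact_mod_cast hN
    have h1 : ∀ n ∈ Finset.Ioc 0 N, ‖F n * (χ.LFunction 1 - ∑ m ∈ Finset.Ioc 0 (N / n), G m)‖
        ≤ 2 * q / N * ArithmeticFunction.vonMangoldt n := by
      intro n hn
      rw [Finset.mem_Ioc] at hn
      have hn0 : (0 : ℝ) < n := by exact_mod_cast hn.1
      have h2 := norm_LFunction_one_sub_sum_le hχ (N / n)
      have h3 : ‖F n‖ ≤ ArithmeticFunction.vonMangoldt n / n := by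
        change ‖χ (n : ZMod q) * (ArithmeticFunction.vonMangoldt n / n : ℝ)‖ ≤ _
        have h4 : 0 ≤ ArithmeticFunction.vonMangoldt n / (n : ℝ) :=
          div_nonneg ArithmeticFunction.vonMangoldt_nonneg hn0.le
        rw [norm_mul, Complex.norm_real, Real.norm_eq_abs, abs_of_nonneg h4]
        exact mul_le_of_le_one_left h4 (χ.norm_le_one _)
      have h5 : (N : ℝ) ≤ n * (((N / n : ℕ) : ℝ) + 1) := by
        exact_mod_cast (Nat.lt_mul_div_succ N hn.1).le
      rw [norm_mul]
      calc _ ≤ ArithmeticFunction.vonMangoldt n / n * (2 * q / (((N / n : ℕ) : ℝ) + 1)) :=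
            mul_le_mul h3 h2 (norm_nonneg _) (div_nonneg ArithmeticFunction.vonMangoldt_nonneg hn0.le)
        _ = 2 * q / (n * (((N / n : ℕ) : ℝ) + 1)) * ArithmeticFunction.vonMangoldt n := by
            field_simp
        _ ≤ _ := by
            refine mul_le_mul_of_nonneg_right ?_ ArithmeticFunction.vonMangoldt_nonneg
            exact div_le_div_of_nonneg_left (by positivity) hN0 h5
    refine (norm_sum_le_of_le _ h1).trans ?_
    rw [← Finset.mul_sum]
    have h6 := Chebyshev.psi_le_const_mul_self hN0.le
    rw [Chebyshev.psi, Nat.floor_natCast] at h6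
    calc _ ≤ 2 * (q : ℝ) / N * ((Real.log 4 + 4) * N) := mul_le_mul_of_nonneg_left h6 (by positivity)
      _ = _ := by field_simp
  have heq : (∑ n ∈ Finset.Ioc 0 N, F n) * χ.LFunction 1
      = ∑ n ∈ Finset.Ioc 0 N, χ (n : ZMod q) * (Real.log n / n : ℝ)
        + ∑ n ∈ Finset.Ioc 0 N, F n * (χ.LFunction 1 - ∑ m ∈ Finset.Ioc 0 (N / n), G m) := by
    rw [hsplit, ← Finset.sum_add_distrib, Finset.sum_mul]
    refine Finset.sum_congr rfl fun n _ => ?_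
    ring
  change ‖∑ n ∈ Finset.Ioc 0 N, F n‖ * _ ≤ _
  rw [← norm_mul, heq]
  exact (norm_add_le _ _).trans (add_le_add (hC N) herr)

end DirichletCharacter

lemma exists_abs_sum_vonMangoldt_div_sub_log_le :
    ∃ C : ℝ, ∀ N : ℕ, 0 < N →
      |∑ n ∈ Finset.Ioc 0 N, ArithmeticFunction.vonMangoldt n / n - Real.log N| ≤ C := by
  refine ⟨Real.log 4 + 4, fun N hN => ?_⟩
  have hN0 : (0 : ℝ) < N := by exact_mod_cast hN
  have hfac : Real.log (N.factorial : ℝ)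
      = ∑ n ∈ Finset.Ioc 0 N, ArithmeticFunction.vonMangoldt n * ((N / n : ℕ) : ℝ) := by
    rw [← ArithmeticFunction.sum_Ioc_mul_zeta_eq_sum, ArithmeticFunction.vonMangoldt_mul_zeta,
      ← Finset.prod_Ico_id_eq_factorial, Nat.cast_prod, Real.log_prod]
    · refine Finset.sum_congr ?_ fun n _ => by rw [ArithmeticFunction.log_apply]
      ext; simp only [Finset.mem_Ioc, Finset.mem_Ico]; omega
    · intro n hn
      rw [Finset.mem_Ico] at hn
      exact_mod_cast (show n ≠ 0 by omega)
  have hlow : N * Real.log N - N ≤ Real.log (N.factorial : ℝ) := by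
    have h1 := Stirling.le_log_factorial_stirling hN.ne'
    have h2 : 0 ≤ Real.log N := Real.log_natCast_nonneg _
    have h3 : 0 ≤ Real.log (2 * Real.pi) := Real.log_nonneg (by linarith [Real.pi_gt_three])
    linarith
  have hup : Real.log (N.factorial : ℝ) ≤ N * Real.log N := by
    rw [← Real.log_pow]
    refine Real.log_le_log (by exact_mod_cast N.factorial_pos) ?_
    exact_mod_cast Nat.factorial_le_pow N
  have hpsi := Chebyshev.psi_le_const_mul_self hN0.le
  rw [Chebyshev.psi, Nat.floor_natCast] at hpsi
  have h1 : Real.log (N.factorial : ℝ) ≤ N * ∑ n ∈ Finset.Ioc 0 N, ArithmeticFunction.vonMangoldt n / n := by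
    rw [hfac, Finset.mul_sum]
    refine Finset.sum_le_sum fun n _ => ?_
    calc _ ≤ ArithmeticFunction.vonMangoldt n * ((N : ℝ) / n) :=
          mul_le_mul_of_nonneg_left Nat.cast_div_le ArithmeticFunction.vonMangoldt_nonneg
      _ = _ := by ring
  have h2 : N * ∑ n ∈ Finset.Ioc 0 N, ArithmeticFunction.vonMangoldt n / n
      ≤ Real.log (N.factorial : ℝ) + ∑ n ∈ Finset.Ioc 0 N, ArithmeticFunction.vonMangoldt n := by
    rw [hfac, Finset.mul_sum, ← Finset.sum_add_distrib]
    refine Finset.sum_le_sum fun n hn => ?_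
    rw [Finset.mem_Ioc] at hn
    have hn0 : (0 : ℝ) < n := by exact_mod_cast hn.1
    have h5 : (N : ℝ) / n ≤ ((N / n : ℕ) : ℝ) + 1 := by
      rw [div_le_iff₀' hn0]
      exact_mod_cast (Nat.lt_mul_div_succ N hn.1).le
    calc _ = ArithmeticFunction.vonMangoldt n * ((N : ℝ) / n) := by ring
      _ ≤ ArithmeticFunction.vonMangoldt n * (((N / n : ℕ) : ℝ) + 1) :=
          mul_le_mul_of_nonneg_left h5 ArithmeticFunction.vonMangoldt_nonneg
      _ = _ := by ring
  have h4 := Real.log_nonneg (show (1 : ℝ) ≤ 4 by norm_num)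
  rw [abs_le]
  constructor
  · have h6 : (N : ℝ) * (Real.log N - 1) ≤ N * ∑ n ∈ Finset.Ioc 0 N, ArithmeticFunction.vonMangoldt n / n := by
      linarith
    have := le_of_mul_le_mul_left h6 hN0
    linarith
  · have h6 : N * ∑ n ∈ Finset.Ioc 0 N, ArithmeticFunction.vonMangoldt n / n
        ≤ (N : ℝ) * (Real.log N + (Real.log 4 + 4)) := by
      linarith
    have := le_of_mul_le_mul_left h6 hN0
    linarith

section DirichletCharacter

variable {q : ℕ} [NeZero q]

lemma exists_norm_sum_trivChar_mul_vonMangoldt_div_sub_log_le (q : ℕ) [NeZero q] :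
    ∃ C : ℝ, ∀ N : ℕ, 0 < N → ‖∑ n ∈ Finset.Ioc 0 N, (1 : DirichletCharacter ℂ q) (n : ZMod q)
      * (ArithmeticFunction.vonMangoldt n / n : ℝ) - Real.log N‖ ≤ C := by
  classical
  obtain ⟨C, hC⟩ := exists_abs_sum_vonMangoldt_div_sub_log_le
  have hs := ArithmeticFunction.vonMangoldt.summable_residueClass_non_primes_div (0 : ZMod 1)
  have hres : ∀ n, ArithmeticFunction.vonMangoldt.residueClass (0 : ZMod 1) n
      = ArithmeticFunction.vonMangoldt n := fun n =>
    Set.indicator_of_mem (s := {n : ℕ | (n : ZMod 1) = 0}) (Subsingleton.elim _ _) _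
  simp only [hres] at hs
  set f : ℕ → ℝ := fun n => (if n.Prime then 0 else ArithmeticFunction.vonMangoldt n) / n with hf
  have hf0 : ∀ n, 0 ≤ f n := fun n => by
    refine div_nonneg ?_ (Nat.cast_nonneg _)
    split_ifs
    exacts [le_rfl, ArithmeticFunction.vonMangoldt_nonneg]
  set g : ℕ → ℝ := fun n => ArithmeticFunction.vonMangoldt n / n with hg
  have hg0 : ∀ n, 0 ≤ g n := fun n => div_nonneg ArithmeticFunction.vonMangoldt_nonneg (Nat.cast_nonneg _)
  refine ⟨C + (∑' n, f n + ∑ n ∈ Finset.Ioc 0 q, g n), fun N hN => ?_⟩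
  set h : ℕ → ℝ := fun n => if IsUnit (n : ZMod q) then 0 else g n with hh
  have h1 : ∀ n ∈ Finset.Ioc 0 N, h n ≤ f n + if n ∈ Finset.Ioc 0 q then g n else 0 := by
    intro n hn
    rw [Finset.mem_Ioc] at hn
    have h2 : (0 : ℝ) ≤ if n ∈ Finset.Ioc 0 q then g n else 0 := by split_ifs; exacts [hg0 n, le_rfl]
    by_cases hu : IsUnit (n : ZMod q)
    · simp only [hh, if_pos hu]
      linarith [hf0 n]
    · simp only [hh, if_neg hu]
      by_cases hp : n.Prime
      · have h3 : n ∣ q := by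
          by_contra hd
          exact hu ((ZMod.isUnit_iff_coprime n q).2 ((Nat.Prime.coprime_iff_not_dvd hp).2 hd))
        rw [if_pos (Finset.mem_Ioc.2 ⟨hn.1, Nat.le_of_dvd (NeZero.pos q) h3⟩)]
        linarith [hf0 n]
      · have h3 : f n = g n := by simp only [hf, hg, if_neg hp]
        linarith
  have h2 : ∑ n ∈ Finset.Ioc 0 N, h n ≤ ∑' n, f n + ∑ n ∈ Finset.Ioc 0 q, g n := by
    refine (Finset.sum_le_sum h1).trans ?_
    rw [Finset.sum_add_distrib, ← Finset.sum_filter]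
    refine add_le_add (hs.sum_le_tsum _ fun n _ => hf0 n)
      (Finset.sum_le_sum_of_subset_of_nonneg (fun n hn => (Finset.mem_filter.1 hn).2) fun n _ _ => hg0 n)
  have h3 : 0 ≤ ∑ n ∈ Finset.Ioc 0 N, h n := Finset.sum_nonneg fun n _ => by
    simp only [hh]
    split_ifs
    exacts [le_rfl, hg0 n]
  have heq : ∑ n ∈ Finset.Ioc 0 N, (1 : DirichletCharacter ℂ q) (n : ZMod q)
      * (ArithmeticFunction.vonMangoldt n / n : ℝ) - Real.log N
      = (((∑ n ∈ Finset.Ioc 0 N, g n - Real.log N) - ∑ n ∈ Finset.Ioc 0 N, h n : ℝ) : ℂ) := by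
    rw [sub_right_comm, ← Finset.sum_sub_distrib]
    rw [Complex.ofReal_sub, Complex.ofReal_sum]
    congr 1
    refine Finset.sum_congr rfl fun n _ => ?_
    by_cases hu : IsUnit (n : ZMod q)
    · rw [MulChar.one_apply hu]
      simp [hh, hg, hu]
    · rw [MulChar.map_nonunit _ hu]
      simp [hh, hg, hu]
  rw [heq, Complex.norm_real, Real.norm_eq_abs]
  refine (abs_sub _ _).trans ?_
  rw [abs_of_nonneg h3]
  exact add_le_add (hC N hN) h2

/-- Mertens' theorem in arithmetic progressions. -/
lemma exists_abs_sum_residueClass_div_sub_log_le {a : ZMod q} (ha : IsUnit a) :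
    ∃ C : ℝ, ∀ N : ℕ, 0 < N → |∑ n ∈ Finset.Ioc 0 N,
      ArithmeticFunction.vonMangoldt.residueClass a n / n - (q.totient : ℝ)⁻¹ * Real.log N| ≤ C := by
  have hχ : ∀ χ : DirichletCharacter ℂ q, ∃ C : ℝ, ∀ N : ℕ, 0 < N →
      ‖∑ n ∈ Finset.Ioc 0 N, χ (n : ZMod q) * (ArithmeticFunction.vonMangoldt n / n : ℝ)
        - if χ = 1 then (Real.log N : ℂ) else 0‖ ≤ C := by
    intro χ
    rcases eq_or_ne χ 1 with rfl | h
    · simpa only [if_true] using exists_norm_sum_trivChar_mul_vonMangoldt_div_sub_log_le q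
    · obtain ⟨C, hC⟩ := exists_norm_sum_mul_vonMangoldt_div_le h
      refine ⟨C, fun N _ => ?_⟩
      rw [if_neg h, sub_zero]
      exact hC N
  choose C hC using hχ
  refine ⟨‖(q.totient : ℂ)⁻¹‖ * ∑ χ : DirichletCharacter ℂ q, C χ, fun N hN => ?_⟩
  have hinv : IsUnit a⁻¹ := ⟨ha.unit⁻¹, by rw [← ZMod.inv_coe_unit]; rfl⟩
  have heq : ((∑ n ∈ Finset.Ioc 0 N, ArithmeticFunction.vonMangoldt.residueClass a n / n
      - (q.totient : ℝ)⁻¹ * Real.log N : ℝ) : ℂ)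
      = (q.totient : ℂ)⁻¹ * ∑ χ : DirichletCharacter ℂ q, χ a⁻¹ *
        (∑ n ∈ Finset.Ioc 0 N, χ (n : ZMod q) * (ArithmeticFunction.vonMangoldt n / n : ℝ)
          - if χ = 1 then (Real.log N : ℂ) else 0) := by
    simp only [mul_sub, Finset.sum_sub_distrib, mul_ite, mul_zero, Finset.sum_ite_eq',
      Finset.mem_univ, if_true]
    rw [MulChar.one_apply hinv, one_mul]
    push_cast
    congr 1
    simp only [Finset.mul_sum]
    rw [Finset.sum_comm]
    refine Finset.sum_congr rfl fun n _ => ?_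
    rw [ArithmeticFunction.vonMangoldt.residueClass_apply ha, Finset.mul_sum, Finset.sum_div]
    refine Finset.sum_congr rfl fun χ _ => ?_
    ring
  rw [← Real.norm_eq_abs, ← Complex.norm_real, heq, norm_mul]
  refine mul_le_mul_of_nonneg_left (norm_sum_le_of_le _ fun χ _ => ?_) (norm_nonneg _)
  rw [norm_mul]
  exact (mul_le_of_le_one_left (norm_nonneg _) (χ.norm_le_one _)).trans (hC χ N hN)

lemma exists_mul_le_sum_residueClass {a : ZMod q} (ha : IsUnit a) :
    ∃ c : ℝ, 0 < c ∧ ∀ᶠ N : ℕ in atTop,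
      c * N ≤ ∑ n ∈ Finset.Ioc 0 N, ArithmeticFunction.vonMangoldt.residueClass a n := by
  obtain ⟨C, hC⟩ := exists_abs_sum_residueClass_div_sub_log_le ha
  set φ : ℝ := (q.totient : ℝ)⁻¹ with hφ
  have hφ0 : 0 < φ := inv_pos.2 (by exact_mod_cast Nat.totient_pos.2 (NeZero.pos q))
  obtain ⟨K, hK⟩ := ((Real.tendsto_log_atTop.comp tendsto_natCast_atTop_atTop).eventually_ge_atTop
    ((2 * C + 1) / φ)).and (eventually_ge_atTop (1 : ℕ)) |>.exists
  obtain ⟨hK, hK1⟩ := hK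
  simp only [Function.comp] at hK
  rw [div_le_iff₀ hφ0] at hK
  have hK0 : (0 : ℝ) < K := by exact_mod_cast hK1
  refine ⟨1 / K, by positivity, ?_⟩
  filter_upwards [eventually_ge_atTop K] with N hN
  have hN0 : (0 : ℝ) < N := by exact_mod_cast (show 0 < N by omega)
  set M := N / K with hM
  have hM1 : 1 ≤ M := Nat.div_pos hN hK1
  have hM0 : (0 : ℝ) < M := by exact_mod_cast hM1
  have hMN : M ≤ N := Nat.div_le_self _ _
  have h1 := (abs_le.1 (hC N (by omega))).1
  have h2 := (abs_le.1 (hC M (by omega))).2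
  have h3 : Real.log M + Real.log K ≤ Real.log N := by
    rw [← Real.log_mul hM0.ne' hK0.ne']
    refine Real.log_le_log (by positivity) ?_
    exact_mod_cast Nat.div_mul_le_self N K
  have h4 := Finset.sum_Ioc_consecutive
    (fun n : ℕ => ArithmeticFunction.vonMangoldt.residueClass a n / (n : ℝ)) (Nat.zero_le M) hMN
  have h5 : 1 ≤ ∑ n ∈ Finset.Ioc M N, ArithmeticFunction.vonMangoldt.residueClass a n / (n : ℝ) := by
    have h6 : φ * (Real.log M + Real.log K) ≤ φ * Real.log N := mul_le_mul_of_nonneg_left h3 hφ0.le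
    linarith
  have h7 : ∑ n ∈ Finset.Ioc M N, ArithmeticFunction.vonMangoldt.residueClass a n / (n : ℝ)
      ≤ ∑ n ∈ Finset.Ioc M N, K / N * ArithmeticFunction.vonMangoldt.residueClass a n := by
    refine Finset.sum_le_sum fun n hn => ?_
    rw [Finset.mem_Ioc] at hn
    have hn0 : (0 : ℝ) < n := by exact_mod_cast (show 0 < n by omega)
    rw [div_eq_inv_mul]
    refine mul_le_mul_of_nonneg_right ?_ (ArithmeticFunction.vonMangoldt.residueClass_nonneg a n)
    rw [inv_eq_one_div, div_le_div_iff₀ hn0 hN0, one_mul]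
    have h8 : N < K * (M + 1) := Nat.lt_mul_div_succ N hK1
    exact_mod_cast h8.le.trans (Nat.mul_le_mul_left K hn.1)
  rw [← Finset.mul_sum] at h7
  have h9 : ∑ n ∈ Finset.Ioc M N, ArithmeticFunction.vonMangoldt.residueClass a n
      ≤ ∑ n ∈ Finset.Ioc 0 N, ArithmeticFunction.vonMangoldt.residueClass a n :=
    Finset.sum_le_sum_of_subset_of_nonneg (Finset.Ioc_subset_Ioc_left (Nat.zero_le _))
      fun n _ _ => ArithmeticFunction.vonMangoldt.residueClass_nonneg a n
  have h10 := h5.trans (h7.trans (mul_le_mul_of_nonneg_left h9 (by positivity)))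
  rw [div_mul_eq_mul_div, le_div_iff₀ hN0] at h10
  rw [div_mul_eq_mul_div, div_le_iff₀ hK0]
  linarith

end DirichletCharacter

lemma sum_Ico_sum_Ico_ite_add_sub (N : ℕ) (n : ℤ) :
    ∑ j ∈ Finset.Ico (0 : ℤ) N, ∑ k ∈ Finset.Ico (0 : ℤ) N,
      (if n + (k - j) = 0 then (1 : ℂ) else 0) =
        (((min (N : ℤ) (N + n) - max 0 n).toNat : ℕ) : ℂ) := by
  have h : ∀ j ∈ Finset.Ico (0 : ℤ) N, ∑ k ∈ Finset.Ico (0 : ℤ) N,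
      (if n + (k - j) = 0 then (1 : ℂ) else 0) =
        if j ∈ Finset.Ico n (N + n) then 1 else 0 := by
    intro j _
    have : ∀ k : ℤ, (n + (k - j) = 0) = (k = j - n) := fun k => by
      apply propext; constructor <;> intro h <;> linarith
    simp only [this, Finset.sum_ite_eq', Finset.mem_Ico]
    refine if_congr ?_ rfl rfl
    constructor <;> rintro ⟨h1, h2⟩ <;> constructor <;> linarith
  rw [Finset.sum_congr rfl h, Finset.sum_boole, Finset.filter_mem_eq_inter,
    Finset.Ico_inter_Ico, Int.card_Ico]

/-- The Fejér-type density attached to a sequence of correlations. -/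
noncomputable def fejerDensity (c : ℤ → ℝ) (N : ℕ) : C(UnitAddCircle, ℂ) :=
  ((N : ℂ)⁻¹) • ∑ j ∈ Finset.Ico (0 : ℤ) N, ∑ k ∈ Finset.Ico (0 : ℤ) N,
    ((c (j - k) : ℂ)) • fourier (k - j)

lemma fejerDensity_apply (c : ℤ → ℝ) (N : ℕ) (t : UnitAddCircle) :
    fejerDensity c N t = (N : ℂ)⁻¹ * ∑ j ∈ Finset.Ico (0 : ℤ) N, ∑ k ∈ Finset.Ico (0 : ℤ) N,
      (c (j - k) : ℂ) * fourier (k - j) t := by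
  simp [fejerDensity]

lemma conj_fejerDensity {c : ℤ → ℝ} (hc : ∀ n, c (-n) = c n) (N : ℕ) (t : UnitAddCircle) :
    starRingEnd ℂ (fejerDensity c N t) = fejerDensity c N t := by
  rw [fejerDensity_apply, map_mul, map_inv₀, map_natCast, map_sum]
  congr 1
  rw [Finset.sum_comm]
  simp only [map_sum, map_mul, Complex.conj_ofReal, ← fourier_neg]
  refine Finset.sum_congr rfl fun j _ => Finset.sum_congr rfl fun k _ => ?_
  rw [← hc]
  simp only [neg_sub]

lemma integral_fourier_haarAddCircle (n : ℤ) :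
    ∫ t : UnitAddCircle, fourier n t ∂AddCircle.haarAddCircle = if n = 0 then (1 : ℂ) else 0 := by
  have h := congrFun (fourierCoeff_fourier (T := (1 : ℝ)) n) 0
  simp only [fourierCoeff, neg_zero, fourier_zero, one_smul, Pi.single_apply] at h
  simp only [h, eq_comm]

lemma integral_fourier_mul_fejerDensity (c : ℤ → ℝ) (N : ℕ) (n : ℤ) :
    ∫ t : UnitAddCircle, fourier n t * fejerDensity c N t ∂AddCircle.haarAddCircle =
      c n * ((N : ℂ)⁻¹ * (((min (N : ℤ) (N + n) - max 0 n).toNat : ℕ) : ℂ)) := by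
  have hint : ∀ m : ℤ, Integrable (fun t : UnitAddCircle => fourier m t)
      AddCircle.haarAddCircle := fun m =>
    (fourier m).continuous.integrable_of_hasCompactSupport (HasCompactSupport.of_compactSpace _)
  have h1 : ∀ t : UnitAddCircle, fourier n t * fejerDensity c N t =
      (N : ℂ)⁻¹ * ∑ j ∈ Finset.Ico (0 : ℤ) N, ∑ k ∈ Finset.Ico (0 : ℤ) N,
        (c (j - k) : ℂ) * fourier (n + (k - j)) t := by
    intro t
    rw [fejerDensity_apply, mul_left_comm, Finset.mul_sum]
    congr 1
    refine Finset.sum_congr rfl fun j _ => ?_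
    rw [Finset.mul_sum]
    refine Finset.sum_congr rfl fun k _ => ?_
    rw [fourier_add]; ring
  simp only [h1]
  rw [integral_const_mul, integral_finsetSum _ fun j _ =>
    integrable_finsetSum _ fun k _ => (hint _).const_mul _]
  rw [mul_left_comm, ← sum_Ico_sum_Ico_ite_add_sub, Finset.mul_sum _ _ (c n : ℂ)]
  refine congrArg ((N : ℂ)⁻¹ * ·) (Finset.sum_congr rfl fun j _ => ?_)
  rw [integral_finsetSum _ fun k _ => (hint _).const_mul _, Finset.mul_sum]
  refine Finset.sum_congr rfl fun k _ => ?_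
  rw [integral_const_mul, integral_fourier_haarAddCircle]
  split_ifs with h
  · rw [show j - k = n by linarith]
  · simp

lemma tendsto_inv_mul_toNat_min_sub_max (n : ℤ) :
    Tendsto (fun N : ℕ => (N : ℂ)⁻¹ * (((min (N : ℤ) (N + n) - max 0 n).toNat : ℕ) : ℂ))
      atTop (nhds 1) := by
  have h : Tendsto (fun N : ℕ => (1 : ℂ) - (n.natAbs : ℂ) / N) atTop (nhds (1 - 0)) :=
    tendsto_const_nhds.sub (tendsto_const_div_atTop_nhds_zero_nat _)
  rw [sub_zero] at h
  refine h.congr' ?_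
  filter_upwards [eventually_gt_atTop n.natAbs] with N hN
  have hN0 : (N : ℂ) ≠ 0 := by
    have : N ≠ 0 := by omega
    exact_mod_cast this
  have : (min (N : ℤ) (N + n) - max 0 n).toNat = N - n.natAbs := by omega
  rw [this, Nat.cast_sub hN.le]
  field_simp

/-- **Herglotz' theorem** for real symmetric positive definite sequences. -/
theorem exists_measure_integral_fourier_eq {c : ℤ → ℝ} (h0 : c 0 = 1) (hc : ∀ n, c (-n) = c n)
    (hpos : ∀ (N : ℕ) (z : ℤ → ℂ), 0 ≤ (∑ j ∈ Finset.Ico (0 : ℤ) N,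
      ∑ k ∈ Finset.Ico (0 : ℤ) N, (c (j - k) : ℂ) * (z j * starRingEnd ℂ (z k))).re) :
    ∃ ν : Measure UnitAddCircle, IsProbabilityMeasure ν ∧
      ∀ n : ℤ, ∫ t, fourier n t ∂ν = (c n : ℂ) := by
  have hre : ∀ N t, ((fejerDensity c N t).re : ℂ) = fejerDensity c N t := fun N t =>
    Complex.conj_eq_iff_re.mp (conj_fejerDensity hc N t)
  have hnn : ∀ N t, 0 ≤ (fejerDensity c N t).re := by
    intro N t
    rw [fejerDensity_apply, ← Complex.ofReal_natCast, ← Complex.ofReal_inv, Complex.re_ofReal_mul]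
    refine mul_nonneg (by positivity) ?_
    refine (hpos N fun j => fourier (-j) t).trans_eq ?_
    refine congrArg Complex.re (Finset.sum_congr rfl fun j _ => Finset.sum_congr rfl fun k _ => ?_)
    rw [← fourier_neg, neg_neg, ← fourier_add, neg_add_eq_sub]
  have hcont : ∀ N, Continuous fun t => (fejerDensity c N t).re := fun N =>
    Complex.continuous_re.comp (fejerDensity c N).continuous
  have hwd : ∀ N (n : ℤ), ∫ t, fourier n t ∂(AddCircle.haarAddCircle (T := (1 : ℝ))).withDensity
      (fun t => ENNReal.ofReal (fejerDensity c N t).re) =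
      c n * ((N : ℂ)⁻¹ * (((min (N : ℤ) (N + n) - max 0 n).toNat : ℕ) : ℂ)) := by
    intro N n
    rw [← integral_fourier_mul_fejerDensity,
      integral_withDensity_eq_integral_toReal_smul
        ((hcont N).measurable.ennreal_ofReal) (by simp)]
    refine integral_congr_ae (Eventually.of_forall fun t => ?_)
    simp only [ENNReal.toReal_ofReal (hnn N t), Complex.real_smul, hre]
    ring
  have hprob : ∀ N : ℕ, IsProbabilityMeasure
      ((AddCircle.haarAddCircle (T := (1 : ℝ))).withDensity
        (fun t => ENNReal.ofReal (fejerDensity c (N + 1) t).re)) := by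
    intro N
    have hfin : IsFiniteMeasure ((AddCircle.haarAddCircle (T := (1 : ℝ))).withDensity
        (fun t => ENNReal.ofReal (fejerDensity c (N + 1) t).re)) :=
      isFiniteMeasure_withDensity_ofReal
        ((hcont (N + 1)).integrable_of_hasCompactSupport (HasCompactSupport.of_compactSpace _)).2
    have h := hwd (N + 1) 0
    have hN : ((N : ℂ) + 1) ≠ 0 := by exact_mod_cast N.succ_ne_zero
    simp only [fourier_zero, h0] at h
    simp only [integral_const, Complex.real_smul, mul_one] at h
    have h2 : ((min ((N + 1 : ℕ) : ℤ) ((N + 1 : ℕ) + 0) - max 0 0).toNat) = N + 1 := by omega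
    rw [h2] at h
    push_cast at h
    rw [inv_mul_cancel₀ hN] at h
    norm_num at h
    constructor
    rw [Measure.real] at h
    exact (ENNReal.toReal_eq_one_iff _).mp (by exact_mod_cast h)
  let P : ℕ → ProbabilityMeasure UnitAddCircle := fun N => ⟨_, hprob N⟩
  obtain ⟨ν, -, hν⟩ := isCompact_univ.ultrafilter_le_nhds
    ((hyperfilter ℕ).map P) (by simp)
  refine ⟨ν, inferInstance, fun n => ?_⟩
  have hlim : Tendsto P (hyperfilter ℕ : Filter ℕ) (nhds ν) := hν
  rw [ProbabilityMeasure.tendsto_iff_forall_integral_rclike_tendsto ℂ] at hlim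
  have h1 := hlim (BoundedContinuousFunction.mkOfCompact (fourier n))
  have h2 : Tendsto (fun N : ℕ => (c n : ℂ) * (((N + 1 : ℕ) : ℂ)⁻¹ *
      (((min ((N + 1 : ℕ) : ℤ) ((N + 1 : ℕ) + n) - max 0 n).toNat : ℕ) : ℂ)))
      (hyperfilter ℕ : Filter ℕ) (nhds (c n)) := by
    have := ((tendsto_inv_mul_toNat_min_sub_max n).comp (tendsto_add_atTop_nat 1)).const_mul
      (c n : ℂ)
    rw [mul_one] at this
    exact this.mono_left Nat.hyperfilter_le_atTop
  refine tendsto_nhds_unique h1 (h2.congr fun N => ?_)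
  exact (hwd (N + 1) n).symm

lemma zpreimage_eq {X : Type*} (e : Equiv.Perm X) (n : ℤ) (A : Set X) :
    zpreimage e e.symm n A = ⇑(e ^ n) ⁻¹' A := by
  unfold zpreimage
  split_ifs with h
  · obtain ⟨m, rfl⟩ := Int.eq_ofNat_of_zero_le h
    rw [Int.toNat_natCast, zpow_natCast, ← Equiv.Perm.iterate_eq_pow]
  · obtain ⟨m, hm⟩ := Int.eq_ofNat_of_zero_le (show 0 ≤ -n by omega)
    obtain rfl : n = -m := by omega
    rw [neg_neg, Int.toNat_natCast, zpow_neg, zpow_natCast, ← inv_pow,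
      ← Equiv.Perm.iterate_eq_pow]
    rfl

section Correlation

variable {X : Type*} [MeasurableSpace X] {μ : Measure X} {e : Equiv.Perm X} {A : Set X}

lemma measurePreserving_zpow (h : MeasurePreserving e μ μ) (h' : Measurable e.symm) (n : ℤ) :
    MeasurePreserving (⇑(e ^ n)) μ μ := by
  have hs : MeasurePreserving e.symm μ μ := by
    refine ⟨h', ?_⟩
    conv_lhs => rw [← h.map_eq]
    rw [Measure.map_map h' h.measurable, Equiv.symm_comp_self, Measure.map_id]
  rcases le_or_gt 0 n with hn | hn
  · obtain ⟨m, rfl⟩ := Int.eq_ofNat_of_zero_le hn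
    rw [zpow_natCast, ← Equiv.Perm.iterate_eq_pow]
    exact h.iterate m
  · obtain ⟨m, hm⟩ := Int.eq_ofNat_of_zero_le (show 0 ≤ -n by omega)
    obtain rfl : n = -m := by omega
    rw [zpow_neg, zpow_natCast, ← inv_pow, ← Equiv.Perm.iterate_eq_pow]
    exact hs.iterate m

lemma measureReal_preimage_zpow_inter (h : MeasurePreserving e μ μ) (h' : Measurable e.symm)
    (hA : MeasurableSet A) (j k : ℤ) :
    μ.real ((⇑(e ^ j) ⁻¹' A) ∩ (⇑(e ^ k) ⁻¹' A)) = μ.real (A ∩ (⇑(e ^ (j - k)) ⁻¹' A)) := by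
  have hm := measurePreserving_zpow h h'
  rw [← (hm k).measureReal_preimage
    (hA.inter ((hm (j - k)).measurable hA)).nullMeasurableSet, Set.preimage_inter,
    ← Set.preimage_comp, ← Equiv.Perm.coe_mul, ← zpow_add, sub_add_cancel, Set.inter_comm]

lemma measureReal_inter_preimage_zpow_neg (h : MeasurePreserving e μ μ)
    (h' : Measurable e.symm) (hA : MeasurableSet A) (n : ℤ) :
    μ.real (A ∩ (⇑(e ^ (-n)) ⁻¹' A)) = μ.real (A ∩ (⇑(e ^ n) ⁻¹' A)) := by
  have h1 := measureReal_preimage_zpow_inter h h' hA 0 n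
  have h2 := measureReal_preimage_zpow_inter h h' hA n 0
  rw [zero_sub, Set.inter_comm] at h1
  rw [sub_zero] at h2
  rw [← h1, h2]

lemma sum_correlation_nonneg [IsProbabilityMeasure μ] (h : MeasurePreserving e μ μ)
    (h' : Measurable e.symm) (hA : MeasurableSet A) (a : ℝ) (s : Finset ℤ) (z : ℤ → ℂ) :
    0 ≤ (∑ j ∈ s, ∑ k ∈ s,
      ((μ.real (A ∩ (⇑(e ^ (j - k)) ⁻¹' A)) - 2 * a * μ.real A + a ^ 2 : ℝ) : ℂ) *
        (z j * starRingEnd ℂ (z k))).re := by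
  have hm := measurePreserving_zpow h h'
  have hmeas : ∀ j : ℤ, MeasurableSet (⇑(e ^ j) ⁻¹' A) := fun j => (hm j).measurable hA
  set u : ℤ → X → ℝ := fun j => (⇑(e ^ j) ⁻¹' A).indicator 1 with hu
  have hu1 : ∀ j, Integrable (u j) μ := fun j => (integrable_const (1 : ℝ)).indicator (hmeas j)
  have hu2 : ∀ j k, Integrable (fun x => u j x * u k x) μ := by
    intro j k
    have : (fun x => u j x * u k x) =
        ((⇑(e ^ j) ⁻¹' A) ∩ (⇑(e ^ k) ⁻¹' A)).indicator (fun _ => (1 : ℝ)) := by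
      ext x; by_cases h1 : x ∈ ⇑(e ^ j) ⁻¹' A <;> by_cases h2 : x ∈ ⇑(e ^ k) ⁻¹' A <;>
        simp [hu, Set.indicator, h1, h2]
    rw [this]
    exact (integrable_const (1 : ℝ)).indicator ((hmeas j).inter (hmeas k))
  have hi1 : ∀ j, ∫ x, u j x ∂μ = μ.real A := by
    intro j
    rw [hu, integral_indicator_one (hmeas j), (hm j).measureReal_preimage hA.nullMeasurableSet]
  have hi2 : ∀ j k, ∫ x, u j x * u k x ∂μ = μ.real (A ∩ (⇑(e ^ (j - k)) ⁻¹' A)) := by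
    intro j k
    rw [← measureReal_preimage_zpow_inter h h' hA,
      ← integral_indicator_one ((hmeas j).inter (hmeas k))]
    congr 1
    ext x; by_cases h1 : x ∈ ⇑(e ^ j) ⁻¹' A <;> by_cases h2 : x ∈ ⇑(e ^ k) ⁻¹' A <;>
        simp [hu, Set.indicator, h1, h2]
  have he : ∀ j k x, (u j x - a) * (u k x - a) = u j x * u k x - a * u j x - a * u k x + a ^ 2 :=
    fun j k x => by ring
  have hint : ∀ j k, Integrable (fun x => (u j x - a) * (u k x - a)) μ := by
    intro j k
    simp only [he]
    exact (((hu2 j k).sub ((hu1 j).const_mul a)).sub ((hu1 k).const_mul a)).add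
      (integrable_const _)
  have hi3 : ∀ j k, ∫ x, (u j x - a) * (u k x - a) ∂μ =
      μ.real (A ∩ (⇑(e ^ (j - k)) ⁻¹' A)) - 2 * a * μ.real A + a ^ 2 := by
    intro j k
    simp only [he]
    have h1 : Integrable (fun x => u j x * u k x - a * u j x) μ :=
      (hu2 j k).sub ((hu1 j).const_mul a)
    have h2 : Integrable (fun x => u j x * u k x - a * u j x - a * u k x) μ :=
      h1.sub ((hu1 k).const_mul a)
    rw [integral_add h2 (integrable_const _), integral_sub h1 ((hu1 k).const_mul a),
      integral_sub (hu2 j k) ((hu1 j).const_mul a), integral_const_mul,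
      integral_const_mul, hi1, hi1, hi2]
    simp
    ring
  have hre : ∀ j k, (((μ.real (A ∩ (⇑(e ^ (j - k)) ⁻¹' A)) - 2 * a * μ.real A + a ^ 2 : ℝ) : ℂ) *
      (z j * starRingEnd ℂ (z k))).re =
      ∫ x, (u j x - a) * (u k x - a) * (z j * starRingEnd ℂ (z k)).re ∂μ := by
    intro j k
    rw [integral_mul_const, hi3, Complex.re_ofReal_mul]
  rw [Complex.re_sum]
  simp only [Complex.re_sum, hre]
  rw [← Finset.sum_congr rfl fun j _ => integral_finsetSum s fun k _ => (hint j k).mul_const _,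
    ← integral_finsetSum s fun j _ => integrable_finsetSum s fun k _ => (hint j k).mul_const _]
  refine integral_nonneg fun x => ?_
  have : ∑ j ∈ s, ∑ k ∈ s, (u j x - a) * (u k x - a) * (z j * starRingEnd ℂ (z k)).re =
      Complex.normSq (∑ j ∈ s, ((u j x - a : ℝ) : ℂ) * z j) := by
    have h1 : (∑ i ∈ s, ∑ j ∈ s, ((u i x - a : ℝ) : ℂ) * z i *
        starRingEnd ℂ (((u j x - a : ℝ) : ℂ) * z j)) =
        ((Complex.normSq (∑ j ∈ s, ((u j x - a : ℝ) : ℂ) * z j) : ℝ) : ℂ) := by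
      rw [← Complex.mul_conj, map_sum, Finset.sum_mul_sum]
    rw [← Complex.ofReal_re (Complex.normSq _), ← h1]
    simp only [Complex.re_sum]
    refine Finset.sum_congr rfl fun j _ => Finset.sum_congr rfl fun k _ => ?_
    rw [map_mul, Complex.conj_ofReal, ← Complex.re_ofReal_mul]
    congr 1
    push_cast; ring
  exact this ▸ Complex.normSq_nonneg _

end Correlation

lemma fourier_one_ne_one {t : UnitAddCircle} (ht : t ≠ 0) : (fourier 1 t : ℂ) ≠ 1 := by
  rw [fourier_one]
  intro h
  refine ht (AddCircle.injective_toCircle one_ne_zero (Circle.ext ?_))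
  rw [h, AddCircle.toCircle_zero, Circle.coe_one]

lemma fourier_natCast_eq_pow (n : ℕ) (t : UnitAddCircle) :
    (fourier (n : ℤ) t : ℂ) = fourier 1 t ^ n := by
  induction n with
  | zero => simp
  | succ n ih => rw [Nat.cast_succ, fourier_add, ih, pow_succ]

lemma tendsto_average_fourier (t : UnitAddCircle) :
    Tendsto (fun N : ℕ => Complex.normSq ((∑ j ∈ Finset.range N, fourier (j : ℤ) t) / N)) atTop
      (nhds (({0} : Set UnitAddCircle).indicator 1 t)) := by
  by_cases ht : t = 0
  · subst ht
    rw [Set.indicator_of_mem (Set.mem_singleton _), Pi.one_apply]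
    refine tendsto_const_nhds.congr' ?_
    filter_upwards [eventually_gt_atTop 0] with N hN
    have : (N : ℂ) ≠ 0 := by exact_mod_cast hN.ne'
    simp [this]
  · rw [Set.indicator_of_notMem (by simpa using ht)]
    have hz := fourier_one_ne_one ht
    have h1 : Tendsto (fun N : ℕ => (∑ j ∈ Finset.range N, (fourier (j : ℤ) t : ℂ)) / N) atTop
        (nhds 0) := by
      refine squeeze_zero_norm (a := fun N : ℕ => (2 / ‖fourier 1 t - 1‖) / N) (fun N => ?_)
        (tendsto_const_div_atTop_nhds_zero_nat _)
      simp only [fourier_natCast_eq_pow]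
      rw [geom_sum_eq hz, norm_div, norm_div, Complex.norm_natCast]
      gcongr
      refine (norm_sub_le _ _).trans ?_
      have : ‖(fourier 1 t : ℂ)‖ = 1 := Circle.norm_coe _
      rw [norm_pow, this]
      norm_num
    have h2 := (Complex.continuous_normSq.tendsto _).comp h1
    rw [map_zero] at h2
    exact h2

lemma integral_normSq_average_fourier (ν : Measure UnitAddCircle) [IsFiniteMeasure ν]
    {c : ℤ → ℝ} (hc : ∀ n, ∫ t, fourier n t ∂ν = (c n : ℂ)) (N : ℕ) :
    ∫ t, Complex.normSq ((∑ j ∈ Finset.range N, fourier (j : ℤ) t) / N) ∂ν =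
      (∑ j ∈ Finset.range N, ∑ k ∈ Finset.range N, c ((j : ℤ) - k)) / (N : ℝ) ^ 2 := by
  have hint : ∀ m : ℤ, Integrable (fun t : UnitAddCircle => (fourier m t : ℂ)) ν := fun m =>
    (fourier m).continuous.integrable_of_hasCompactSupport (HasCompactSupport.of_compactSpace _)
  rw [← Complex.ofReal_inj, ← integral_complex_ofReal]
  have h : ∀ t : UnitAddCircle,
      ((Complex.normSq ((∑ j ∈ Finset.range N, fourier (j : ℤ) t) / N) : ℝ) : ℂ) =
        (∑ j ∈ Finset.range N, ∑ k ∈ Finset.range N, fourier ((j : ℤ) - k) t) / (N : ℂ) ^ 2 := by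
    intro t
    rw [← Complex.mul_conj, map_div₀, map_sum, Complex.conj_natCast, div_mul_div_comm,
      Finset.sum_mul_sum, sq]
    simp only [← fourier_neg, ← fourier_add, sub_eq_add_neg]
  simp only [h]
  rw [integral_div, integral_finsetSum _ fun j _ => integrable_finsetSum _ fun k _ => hint _]
  push_cast
  congr 1
  refine Finset.sum_congr rfl fun j _ => ?_
  rw [integral_finsetSum _ fun k _ => hint _]
  exact Finset.sum_congr rfl fun k _ => hc _

lemma le_measureReal_singleton_zero (ν : Measure UnitAddCircle) [IsFiniteMeasure ν]
    {c : ℤ → ℝ} (hc : ∀ n, ∫ t, fourier n t ∂ν = (c n : ℂ)) {m : ℝ}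
    (hm : ∀ N : ℕ, m * (N : ℝ) ^ 2 ≤
      ∑ j ∈ Finset.range N, ∑ k ∈ Finset.range N, c ((j : ℤ) - k)) :
    m ≤ ν.real {0} := by
  have h1 : Tendsto (fun N : ℕ => ∫ t, Complex.normSq
      ((∑ j ∈ Finset.range N, fourier (j : ℤ) t) / N) ∂ν) atTop
      (nhds (∫ t, ({0} : Set UnitAddCircle).indicator 1 t ∂ν)) := by
    refine tendsto_integral_of_dominated_convergence (fun _ => 1) (fun N => ?_)
      (integrable_const _) (fun N => Eventually.of_forall fun t => ?_)
      (Eventually.of_forall tendsto_average_fourier)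
    · have hcont : Continuous fun t : UnitAddCircle =>
          (∑ j ∈ Finset.range N, (fourier (j : ℤ) t : ℂ)) / N :=
        by
        refine Continuous.div_const (continuous_finsetSum _ fun j _ => ?_) _
        exact (fourier (T := (1 : ℝ)) (j : ℤ)).continuous
      exact (Complex.continuous_normSq.comp hcont).aestronglyMeasurable
    · rw [Real.norm_of_nonneg (Complex.normSq_nonneg _), Complex.normSq_eq_norm_sq]
      refine pow_le_one₀ (norm_nonneg _) ?_
      rw [norm_div, Complex.norm_natCast]
      refine div_le_one_of_le₀ ((norm_sum_le _ _).trans ?_) (by positivity)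
      have : ∀ j : ℕ, ‖(fourier (j : ℤ) t : ℂ)‖ = 1 := fun j => Circle.norm_coe _
      rw [Finset.sum_congr rfl fun j _ => this j]
      simp
  rw [integral_indicator_one (measurableSet_singleton 0)] at h1
  refine ge_of_tendsto h1 ?_
  filter_upwards [eventually_gt_atTop 0] with N hN
  have hN' : (0 : ℝ) < N := by exact_mod_cast hN
  rw [integral_normSq_average_fourier ν hc, le_div_iff₀ (by positivity)]
  exact hm N

/-- The normalised spectral measure of the indicator function of a set of positive measure has
an atom of mass at least the measure of the set at the origin. -/
theorem exists_spectralMeasure {X : Type*} [MeasurableSpace X] {μ : Measure X}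
    [IsProbabilityMeasure μ] {e : Equiv.Perm X} {A : Set X} (h : MeasurePreserving e μ μ)
    (h' : Measurable e.symm) (hA : MeasurableSet A) (hpos : 0 < μ.real A) :
    ∃ ν : Measure UnitAddCircle, IsProbabilityMeasure ν ∧
      (∀ n : ℤ, ∫ t, fourier n t ∂ν = ((μ.real (A ∩ (⇑(e ^ n) ⁻¹' A)) / μ.real A : ℝ) : ℂ)) ∧
      μ.real A ≤ ν.real {0} := by
  obtain ⟨ν, hν, hc⟩ := exists_measure_integral_fourier_eq
    (c := fun n => μ.real (A ∩ (⇑(e ^ n) ⁻¹' A)) / μ.real A)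
    (by simp [div_self hpos.ne'])
    (fun n => by rw [measureReal_inter_preimage_zpow_neg h h' hA])
    (fun N z => by
      have h0 := div_nonneg (sum_correlation_nonneg h h' hA 0 (Finset.Ico (0 : ℤ) N) z) hpos.le
      refine h0.trans_eq ?_
      rw [← Complex.div_ofReal_re, Finset.sum_div]
      refine congrArg Complex.re (Finset.sum_congr rfl fun j _ => ?_)
      rw [Finset.sum_div]
      refine Finset.sum_congr rfl fun k _ => ?_
      push_cast; ring)
  refine ⟨ν, hν, hc, le_measureReal_singleton_zero ν hc fun N => ?_⟩
  have h0 := sum_correlation_nonneg h h' hA (μ.real A)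
    ((Finset.range N).map Nat.castEmbedding) (fun _ => 1)
  simp only [Finset.sum_map, Nat.castEmbedding_apply, map_one, mul_one, ← Complex.ofReal_sum,
    Complex.ofReal_re] at h0
  have h1 : ∀ x : ℝ, x - 2 * μ.real A * μ.real A + μ.real A ^ 2 = x - μ.real A ^ 2 :=
    fun x => by ring
  simp only [h1, Finset.sum_sub_distrib, Finset.sum_const, Finset.card_range, nsmul_eq_mul] at h0
  simp only [← Finset.sum_div]
  rw [le_div_iff₀ hpos]
  linarith

lemma ite_eq_sum_expi {q : ℕ} [NeZero q] (a : ZMod q) (n : ℕ) :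
    (if (n : ZMod q) = a then (1 : ℂ) else 0) =
      (q : ℂ)⁻¹ * ∑ j : ZMod q, expi ((j.val * n - j.val * a.val : ℝ) / q) := by
  have hq : (q : ℂ) ≠ 0 := by exact_mod_cast NeZero.ne q
  have h := AddChar.sum_mulShift ((n : ZMod q) - a) (ZMod.isPrimitive_stdAddChar q)
  have h1 : ∀ j : ZMod q, ZMod.stdAddChar (j * ((n : ZMod q) - a)) =
      expi ((j.val * n - j.val * a.val : ℝ) / q) := by
    intro j
    have : j * ((n : ZMod q) - a) = ((j.val * n - j.val * a.val : ℤ) : ZMod q) := by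
      push_cast
      simp only [ZMod.natCast_val, ZMod.cast_id', id]
      ring
    rw [this, ZMod.stdAddChar_coe, expi]
    congr 1
    push_cast; ring
  simp only [h1, ZMod.card, sub_eq_zero] at h
  rw [h]
  split_ifs
  · rw [inv_mul_cancel₀ hq]
  · simp

lemma sum_residueClass_mul_expi_isLittleO {q : ℕ} [NeZero q] (a : ZMod q) {h : Polynomial ℤ}
    (hdeg : h.natDegree ≠ 0) {θ : ℝ} (hθ : Irrational θ) :
    Tendsto (fun x : ℕ => (∑ n ∈ Finset.Ioc 0 x,
      (ArithmeticFunction.vonMangoldt.residueClass a n : ℂ) *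
        expi (θ * (h.eval (n : ℤ) : ℤ))) / x) atTop (nhds 0) := by
  obtain ⟨D, hD⟩ := Nat.exists_eq_succ_of_ne_zero hdeg
  let P : ZMod q → Polynomial ℝ := fun j => Polynomial.C θ * h.map (Int.castRingHom ℝ) +
    (Polynomial.C (j.val / q : ℝ) * Polynomial.X - Polynomial.C (j.val * a.val / q : ℝ))
  have hPdeg : ∀ j, (P j).natDegree ≤ D + 1 := by
    intro j
    refine (Polynomial.natDegree_add_le_of_degree_le (n := D + 1) ?_ ?_)
    · exact (Polynomial.natDegree_C_mul_le _ _).trans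
        (Polynomial.natDegree_map_le.trans hD.le)
    · refine (Polynomial.natDegree_sub_le _ _).trans (max_le ?_ (by simp))
      exact ((Polynomial.natDegree_C_mul_le _ _).trans Polynomial.natDegree_X_le).trans (by omega)
  have hcoeff : ∀ j, Irrational ((P j).coeff (D + 1)) := by
    intro j
    have hl : h.coeff (D + 1) ≠ 0 := by
      rw [← Nat.succ_eq_add_one, ← hD]
      exact Polynomial.leadingCoeff_ne_zero.mpr (by rintro rfl; simp at hdeg)
    have h1 : (P j).coeff (D + 1) = θ * (h.coeff (D + 1) : ℤ) +
        (((if 1 = D + 1 then (j.val / q : ℚ) else 0 : ℚ)) : ℝ) := by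
      simp only [P, Polynomial.coeff_add, Polynomial.coeff_C_mul, Polynomial.coeff_map,
        Polynomial.coeff_sub, Polynomial.coeff_X, Polynomial.coeff_C]
      rw [if_neg (Nat.succ_ne_zero D), sub_zero]
      by_cases h1D : 1 = D + 1
      · rw [if_pos h1D, if_pos h1D]; simp [-ZMod.natCast_val]
      · rw [if_neg h1D, if_neg h1D]; simp
    rw [h1]
    exact (hθ.mul_intCast hl).add_ratCast _
  have heval : ∀ j (n : ℕ), (P j).eval (n : ℝ) =
      θ * (h.eval (n : ℤ) : ℤ) + (j.val * n - j.val * a.val : ℝ) / q := by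
    intro j n
    have : (h.map (Int.castRingHom ℝ)).eval (n : ℝ) = ((h.eval (n : ℤ) : ℤ) : ℝ) := by
      simp
    simp only [P, Polynomial.eval_add, Polynomial.eval_mul, Polynomial.eval_C, this,
      Polynomial.eval_sub, Polynomial.eval_X]
    ring
  have hlim : Tendsto (fun x : ℕ => (q : ℂ)⁻¹ * ∑ j : ZMod q,
      (∑ n ∈ Finset.Ioc 0 x, (ArithmeticFunction.vonMangoldt n : ℂ) *
        expi ((P j).eval (n : ℝ))) / x) atTop (nhds ((q : ℂ)⁻¹ * ∑ j : ZMod q, 0)) :=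
    (tendsto_finsetSum _ fun j _ =>
      sum_vonMangoldt_mul_expi_isLittleO (hPdeg j) (hcoeff j)).const_mul _
  rw [Finset.sum_const_zero, mul_zero] at hlim
  refine hlim.congr fun x => ?_
  rw [← Finset.sum_div, Finset.sum_comm, ← mul_div_assoc, Finset.mul_sum]
  congr 1
  refine Finset.sum_congr rfl fun n _ => ?_
  have h1 : (ArithmeticFunction.vonMangoldt.residueClass a n : ℂ) =
      (ArithmeticFunction.vonMangoldt n : ℂ) * if (n : ZMod q) = a then (1 : ℂ) else 0 := by
    by_cases hn : (n : ZMod q) = a <;>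
      simp [ArithmeticFunction.vonMangoldt.residueClass, Set.indicator, hn]
  rw [h1, ite_eq_sum_expi, Finset.mul_sum, Finset.mul_sum, Finset.mul_sum, Finset.sum_mul]
  refine Finset.sum_congr rfl fun j _ => ?_
  rw [heval, expi_add]
  ring

lemma fourier_coe_eq_expi (n : ℤ) (θ : ℝ) : (fourier n (θ : UnitAddCircle) : ℂ) = expi (θ * n) := by
  rw [fourier_coe_apply, expi]
  congr 1
  push_cast; ring

lemma irrational_of_not_isOfFinAddOrder {θ : ℝ}
    (h : ¬ IsOfFinAddOrder (θ : UnitAddCircle)) : Irrational θ := by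
  rintro ⟨r, rfl⟩
  refine h (isOfFinAddOrder_iff_nsmul_eq_zero.mpr ⟨r.den, r.den_pos, ?_⟩)
  rw [← AddCircle.coe_nsmul, AddCircle.coe_eq_zero_iff]
  refine ⟨r.num, ?_⟩
  simp only [zsmul_eq_mul, nsmul_eq_mul, mul_one]
  rw [mul_comm]
  exact_mod_cast (Rat.mul_den_eq_num r).symm

/-- The average of the characters along a polynomial, weighted by von Mangoldt in a residue
class. -/
noncomputable def weightedFourier {q : ℕ} (a : ZMod q) (h : Polynomial ℤ) (x : ℕ)
    (t : UnitAddCircle) : ℂ :=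
  (∑ n ∈ Finset.Ioc 0 x, (ArithmeticFunction.vonMangoldt.residueClass a n : ℂ) *
    fourier (h.eval (n : ℤ)) t) /
      ((∑ n ∈ Finset.Ioc 0 x, ArithmeticFunction.vonMangoldt.residueClass a n : ℝ) : ℂ)

lemma norm_weightedFourier_le {q : ℕ} (a : ZMod q) (h : Polynomial ℤ) (x : ℕ)
    (t : UnitAddCircle) : ‖weightedFourier a h x t‖ ≤ 1 := by
  have h0 : 0 ≤ ∑ n ∈ Finset.Ioc 0 x, ArithmeticFunction.vonMangoldt.residueClass a n :=
    Finset.sum_nonneg fun n _ => ArithmeticFunction.vonMangoldt.residueClass_nonneg a n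
  rw [weightedFourier, norm_div, Complex.norm_real, Real.norm_of_nonneg h0]
  refine div_le_one_of_le₀ ((norm_sum_le _ _).trans (Finset.sum_le_sum fun n _ => ?_)) h0
  have : ‖(fourier (h.eval (n : ℤ)) t : ℂ)‖ = 1 := Circle.norm_coe _
  rw [norm_mul, this, mul_one, Complex.norm_real,
    Real.norm_of_nonneg (ArithmeticFunction.vonMangoldt.residueClass_nonneg a n)]

lemma tendsto_weightedFourier {q : ℕ} [NeZero q] {a : ZMod q} (ha : IsUnit a) {h : Polynomial ℤ}
    (hdeg : h.natDegree ≠ 0) {t : UnitAddCircle} (ht : ¬ IsOfFinAddOrder t) :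
    Tendsto (fun x => weightedFourier a h x t) atTop (nhds 0) := by
  obtain ⟨θ, rfl⟩ := QuotientAddGroup.mk_surjective t
  have hθ : Irrational θ := irrational_of_not_isOfFinAddOrder ht
  obtain ⟨c, hc, hev⟩ := exists_mul_le_sum_residueClass ha
  have h1 := (sum_residueClass_mul_expi_isLittleO a hdeg hθ).norm.const_mul c⁻¹
  rw [norm_zero, mul_zero] at h1
  refine squeeze_zero_norm' ?_ h1
  filter_upwards [hev, eventually_gt_atTop 0] with x hx hx0
  have hx0' : (0 : ℝ) < x := by exact_mod_cast hx0
  have h2 : weightedFourier a h x (θ : UnitAddCircle) = (∑ n ∈ Finset.Ioc 0 x,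
      (ArithmeticFunction.vonMangoldt.residueClass a n : ℂ) *
        expi (θ * (h.eval (n : ℤ) : ℤ))) /
      ((∑ n ∈ Finset.Ioc 0 x, ArithmeticFunction.vonMangoldt.residueClass a n : ℝ) : ℂ) := by
    simp only [weightedFourier, fourier_coe_eq_expi]
  change ‖weightedFourier a h x (θ : UnitAddCircle)‖ ≤ _
  rw [h2, norm_div, norm_div, Complex.norm_real, Complex.norm_natCast,
    Real.norm_of_nonneg ((by positivity : 0 ≤ c * (x : ℝ)).trans hx), inv_mul_eq_div,
    div_div, mul_comm (x : ℝ)]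
  exact div_le_div_of_nonneg_left (norm_nonneg _) (by positivity) hx

lemma weightedFourier_eq_one {q : ℕ} (a : ZMod q) {h : Polynomial ℤ}
    (hh : ∀ n : ℕ, (n : ZMod q) = a → (q : ℤ) ∣ h.eval (n : ℤ)) {x : ℕ}
    (hx : 0 < ∑ n ∈ Finset.Ioc 0 x, ArithmeticFunction.vonMangoldt.residueClass a n)
    {t : UnitAddCircle} (ht : q • t = 0) : weightedFourier a h x t = 1 := by
  have hx' : ((∑ n ∈ Finset.Ioc 0 x,
      ArithmeticFunction.vonMangoldt.residueClass a n : ℝ) : ℂ) ≠ 0 := by exact_mod_cast hx.ne'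
  rw [weightedFourier, div_eq_one_iff_eq hx', Complex.ofReal_sum]
  refine Finset.sum_congr rfl fun n _ => ?_
  by_cases hn : (n : ZMod q) = a
  · obtain ⟨k, hk⟩ := hh n hn
    have h0 : ((q : ℤ) * k) • t = 0 := by
      rw [mul_comm, mul_zsmul, natCast_zsmul, ht, zsmul_zero]
    rw [fourier_apply, hk, h0, AddCircle.toCircle_zero, Circle.coe_one, mul_one]
  · have : ArithmeticFunction.vonMangoldt.residueClass a n = 0 :=
      Set.indicator_of_notMem (by simpa using hn) _
    rw [this]; simp

lemma measurableSet_nsmul_eq_zero (q : ℕ) : MeasurableSet {t : UnitAddCircle | q • t = 0} :=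
  (isClosed_eq (continuous_nsmul q) continuous_const).measurableSet

lemma measurableSet_isOfFinAddOrder : MeasurableSet {t : UnitAddCircle | IsOfFinAddOrder t} := by
  have : {t : UnitAddCircle | IsOfFinAddOrder t} =
      ⋃ n : ℕ, {t : UnitAddCircle | (n + 1) • t = 0} := by
    ext t
    simp only [Set.mem_ofPred_eq, Set.mem_iUnion, isOfFinAddOrder_iff_nsmul_eq_zero]
    constructor
    · rintro ⟨n, hn, h⟩
      exact ⟨n - 1, by rwa [Nat.sub_add_cancel hn]⟩
    · rintro ⟨n, h⟩
      exact ⟨n + 1, n.succ_pos, h⟩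
  rw [this]
  exact MeasurableSet.iUnion fun n => measurableSet_nsmul_eq_zero (n + 1)

lemma exists_measureReal_torsion_diff_lt (ν : Measure UnitAddCircle) [IsFiniteMeasure ν] {δ : ℝ}
    (hδ : 0 < δ) : ∃ q : ℕ, 0 < q ∧
      ν.real ({t | IsOfFinAddOrder t} \ {t | q • t = 0}) < δ := by
  have hanti : Antitone fun Q : ℕ =>
      {t : UnitAddCircle | IsOfFinAddOrder t} \ {t | Q.factorial • t = 0} := by
    intro Q R hQR
    refine Set.sdiff_subset_sdiff_right fun t ht => ?_
    obtain ⟨k, hk⟩ := Nat.factorial_dvd_factorial hQR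
    simp only [Set.mem_ofPred_eq] at ht ⊢
    rw [hk, mul_nsmul, ht, nsmul_zero]
  have hempty : ⋂ Q : ℕ,
      ({t : UnitAddCircle | IsOfFinAddOrder t} \ {t | Q.factorial • t = 0}) = ∅ := by
    refine Set.eq_empty_of_forall_notMem fun t ht => ?_
    rw [Set.mem_iInter] at ht
    obtain ⟨n, hn, h⟩ := isOfFinAddOrder_iff_nsmul_eq_zero.mp (ht 0).1
    obtain ⟨k, hk⟩ := Nat.dvd_factorial hn le_rfl
    refine (ht n).2 ?_
    simp only [Set.mem_ofPred_eq]
    rw [hk, mul_nsmul, h, nsmul_zero]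
  have h := tendsto_measure_iInter_atTop (μ := ν)
    (fun Q : ℕ => (measurableSet_isOfFinAddOrder.diff
      (measurableSet_nsmul_eq_zero Q.factorial)).nullMeasurableSet) hanti
    ⟨0, measure_ne_top _ _⟩
  rw [hempty, measure_empty] at h
  have h2 := (ENNReal.tendsto_toReal ENNReal.zero_ne_top).comp h
  obtain ⟨Q, hQ⟩ := (h2.eventually_lt_const (by simpa using hδ)).exists
  exact ⟨Q.factorial, Q.factorial_pos, hQ⟩

lemma integral_re_weightedFourier (ν : Measure UnitAddCircle) [IsFiniteMeasure ν] {d : ℤ → ℝ}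
    (hd : ∀ n, ∫ t, fourier n t ∂ν = (d n : ℂ)) {q : ℕ} (a : ZMod q) (h : Polynomial ℤ) (x : ℕ) :
    ∫ t, (weightedFourier a h x t).re ∂ν =
      (∑ n ∈ Finset.Ioc 0 x, ArithmeticFunction.vonMangoldt.residueClass a n *
        d (h.eval (n : ℤ))) /
        ∑ n ∈ Finset.Ioc 0 x, ArithmeticFunction.vonMangoldt.residueClass a n := by
  have hint : ∀ m : ℤ, Integrable (fun t : UnitAddCircle => (fourier m t : ℂ)) ν := fun m =>
    (fourier m).continuous.integrable_of_hasCompactSupport (HasCompactSupport.of_compactSpace _)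
  have hsum : Integrable (fun t : UnitAddCircle => ∑ n ∈ Finset.Ioc 0 x,
      (ArithmeticFunction.vonMangoldt.residueClass a n : ℂ) * fourier (h.eval (n : ℤ)) t) ν :=
    integrable_finsetSum _ fun n _ => (hint _).const_mul _
  have hW : Integrable (fun t => weightedFourier a h x t) ν := hsum.div_const _
  have h1 : ∫ t, weightedFourier a h x t ∂ν =
      (((∑ n ∈ Finset.Ioc 0 x, ArithmeticFunction.vonMangoldt.residueClass a n *
        d (h.eval (n : ℤ))) /
        ∑ n ∈ Finset.Ioc 0 x, ArithmeticFunction.vonMangoldt.residueClass a n : ℝ) : ℂ) := by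
    simp only [weightedFourier]
    rw [integral_div, integral_finsetSum _ fun n _ => (hint _).const_mul _]
    push_cast
    congr 1
    refine Finset.sum_congr rfl fun n _ => ?_
    rw [integral_const_mul, hd]
  have h2 := integral_re hW
  simp only [RCLike.re_to_complex] at h2
  rw [h2, h1, Complex.ofReal_re]

lemma continuous_weightedFourier {q : ℕ} (a : ZMod q) (h : Polynomial ℤ) (x : ℕ) :
    Continuous (weightedFourier a h x) := by
  refine Continuous.div_const (continuous_finsetSum _ fun n _ => continuous_const.mul ?_) _
  exact (fourier (T := (1 : ℝ)) (h.eval (n : ℤ))).continuous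

/-- Weighted averages of the Fourier coefficients of a measure along a polynomial in a residue
class are bounded below by the mass at the origin, up to the mass of the torsion points
that are not annihilated by the modulus. -/
lemma eventually_mul_le_sum_residueClass_mul (ν : Measure UnitAddCircle) [IsProbabilityMeasure ν]
    {d : ℤ → ℝ} (hd : ∀ n, ∫ t, fourier n t ∂ν = (d n : ℂ)) {q : ℕ} [NeZero q] {a : ZMod q}
    (ha : IsUnit a) {h : Polynomial ℤ} (hdeg : h.natDegree ≠ 0)
    (hh : ∀ n : ℕ, (n : ZMod q) = a → (q : ℤ) ∣ h.eval (n : ℤ)) {δ : ℝ} (hδ : 0 < δ)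
    (hq : ν.real ({t | IsOfFinAddOrder t} \ {t | q • t = 0}) < δ) :
    ∀ᶠ x : ℕ in atTop, (ν.real {0} - 2 * δ) *
      ∑ n ∈ Finset.Ioc 0 x, ArithmeticFunction.vonMangoldt.residueClass a n ≤
      ∑ n ∈ Finset.Ioc 0 x, ArithmeticFunction.vonMangoldt.residueClass a n *
        d (h.eval (n : ℤ)) := by
  set B : Set UnitAddCircle := {t | IsOfFinAddOrder t} \ {t | q • t = 0} with hB
  have hBm : MeasurableSet B :=
    measurableSet_isOfFinAddOrder.diff (measurableSet_nsmul_eq_zero q)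
  set I : Set UnitAddCircle := {t | IsOfFinAddOrder t}ᶜ with hI
  have hIm : MeasurableSet I := measurableSet_isOfFinAddOrder.compl
  have hre : ∀ x t, |(weightedFourier a h x t).re| ≤ 1 := fun x t =>
    (Complex.abs_re_le_norm _).trans (norm_weightedFourier_le a h x t)
  have hcont : ∀ x, Continuous fun t => (weightedFourier a h x t).re := fun x =>
    Complex.continuous_re.comp (continuous_weightedFourier a h x)
  have hlim : Tendsto (fun x : ℕ => ∫ t, I.indicator (fun t => (weightedFourier a h x t).re) t ∂ν)
      atTop (nhds (∫ _, (0 : ℝ) ∂ν)) := by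
    refine tendsto_integral_of_dominated_convergence (fun _ => 1)
      (fun x => (hcont x).aestronglyMeasurable.indicator hIm) (integrable_const _)
      (fun x => Eventually.of_forall fun t => ?_) (Eventually.of_forall fun t => ?_)
    · exact (norm_indicator_le_norm_self _ _).trans (hre x t)
    · by_cases ht : t ∈ I
      · simp only [Set.indicator_of_mem ht]
        have h1 := (Complex.continuous_re.tendsto _).comp (tendsto_weightedFourier ha hdeg ht)
        rw [Complex.zero_re] at h1
        exact h1
      · simp only [Set.indicator_of_notMem ht]
        exact tendsto_const_nhds
  rw [integral_zero] at hlim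
  obtain ⟨c, hc, hev⟩ := exists_mul_le_sum_residueClass ha
  filter_upwards [hlim.eventually_const_lt (neg_lt_zero.mpr hδ), hev, eventually_gt_atTop 0]
    with x hx hcx hx0
  have hx0' : (0 : ℝ) < x := by exact_mod_cast hx0
  have hW : 0 < ∑ n ∈ Finset.Ioc 0 x, ArithmeticFunction.vonMangoldt.residueClass a n :=
    (by positivity : 0 < c * (x : ℝ)).trans_le hcx
  rw [← le_div_iff₀ hW, ← integral_re_weightedFourier ν hd]
  have hi0 : Integrable (({0} : Set UnitAddCircle).indicator (1 : UnitAddCircle → ℝ)) ν :=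
    (integrable_const (1 : ℝ)).indicator (measurableSet_singleton 0)
  have hiB : Integrable (B.indicator (1 : UnitAddCircle → ℝ)) ν :=
    (integrable_const (1 : ℝ)).indicator hBm
  have hiW : Integrable (fun t => (weightedFourier a h x t).re) ν :=
    (hcont x).integrable_of_hasCompactSupport (HasCompactSupport.of_compactSpace _)
  have hiI := hiW.indicator hIm
  have hi0B : Integrable (fun t => ({0} : Set UnitAddCircle).indicator (1 : UnitAddCircle → ℝ) t -
    B.indicator (1 : UnitAddCircle → ℝ) t) ν := hi0.sub hiB
  have hle : ∫ t, (({0} : Set UnitAddCircle).indicator (1 : UnitAddCircle → ℝ) t -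
      B.indicator (1 : UnitAddCircle → ℝ) t +
      I.indicator (fun t => (weightedFourier a h x t).re) t) ∂ν ≤
      ∫ t, (weightedFourier a h x t).re ∂ν := by
    refine integral_mono (hi0B.add hiI) hiW fun t => ?_
    have h0 : ({0} : Set UnitAddCircle).indicator (1 : UnitAddCircle → ℝ) t ≤ 1 :=
      Set.indicator_le_self' (fun _ _ => zero_le_one) t
    by_cases ht : IsOfFinAddOrder t
    · have htI : t ∉ I := fun h => h ht
      simp only [Set.indicator_of_notMem htI, add_zero]
      by_cases htq : q • t = 0
      · have htB : t ∉ B := fun h => h.2 htq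
        rw [Set.indicator_of_notMem htB, weightedFourier_eq_one a hh hW htq]
        simpa using h0
      · have htB : t ∈ B := ⟨ht, htq⟩
        rw [Set.indicator_of_mem htB]
        have := neg_le_of_abs_le (hre x t)
        have ht0 : t ∉ ({0} : Set UnitAddCircle) := by
          rintro rfl
          exact htq (nsmul_zero q)
        rw [Set.indicator_of_notMem ht0]
        simpa using this
    · have htI : t ∈ I := ht
      have htB : t ∉ B := fun h => ht h.1
      have ht0 : t ∉ ({0} : Set UnitAddCircle) := by
        rintro rfl
        exact ht IsOfFinAddOrder.zero
      simp only [Set.indicator_of_mem htI, Set.indicator_of_notMem htB,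
        Set.indicator_of_notMem ht0]
      simp
  rw [integral_add hi0B hiI, integral_sub hi0 hiB, integral_indicator_one hBm,
    integral_indicator_one (measurableSet_singleton 0)] at hle
  linarith

lemma exists_residueClass_eventually_mul_le_sum (ν : Measure UnitAddCircle)
    [IsProbabilityMeasure ν] {d : ℤ → ℝ} (hd : ∀ n, ∫ t, fourier n t ∂ν = (d n : ℂ))
    {g : Polynomial ℤ} (hg : g.eval 0 = 0) (hdeg : g.natDegree ≠ 0) {s : ℤ} (hs : IsUnit s)
    {δ : ℝ} (hδ : 0 < δ) :
    ∃ (q : ℕ) (_ : NeZero q) (a : ZMod q), IsUnit a ∧ ∀ᶠ x : ℕ in atTop, (ν.real {0} - δ) *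
      ∑ n ∈ Finset.Ioc 0 x, ArithmeticFunction.vonMangoldt.residueClass a n ≤
      ∑ n ∈ Finset.Ioc 0 x, ArithmeticFunction.vonMangoldt.residueClass a n *
        d (g.eval ((n : ℤ) + s)) := by
  obtain ⟨q, hq, hqδ⟩ := exists_measureReal_torsion_diff_lt ν (half_pos hδ)
  have : NeZero q := ⟨hq.ne'⟩
  have ha : IsUnit (-(s : ZMod q)) := (hs.map (Int.castRingHom (ZMod q))).neg
  refine ⟨q, this, -(s : ZMod q), ha, ?_⟩
  have hmain := eventually_mul_le_sum_residueClass_mul ν hd ha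
    (h := g.comp (Polynomial.X + Polynomial.C s))
    (by rw [Polynomial.natDegree_comp, Polynomial.natDegree_X_add_C, mul_one]; exact hdeg)
    (fun n hn => by
      have h1 : (q : ℤ) ∣ (n : ℤ) + s := by
        rw [← ZMod.intCast_zmod_eq_zero_iff_dvd]
        push_cast
        rw [hn, neg_add_cancel]
      have h2 := g.sub_dvd_eval_sub ((n : ℤ) + s) 0
      rw [hg, sub_zero, sub_zero] at h2
      rw [Polynomial.eval_comp, Polynomial.eval_add, Polynomial.eval_X, Polynomial.eval_C]
      exact h1.trans h2) (half_pos hδ) hqδ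
  simpa only [Polynomial.eval_comp, Polynomial.eval_add, Polynomial.eval_X, Polynomial.eval_C,
    mul_div_cancel₀ δ (two_ne_zero' ℝ)] using hmain

lemma hasPositiveLowerDensity_of_eventually_mul_le {E : Set ℕ} {κ : ℝ} (hκ : 0 < κ)
    (h : ∀ᶠ N : ℕ in atTop, κ * N ≤ (E ∩ Set.Icc 1 N).ncard) : HasPositiveLowerDensity E := by
  refine hκ.trans_le (le_liminf_of_le ?_ ?_)
  · refine isCoboundedUnder_ge_of_le atTop (x := 1) fun N => ?_
    refine div_le_one_of_le₀ ?_ (by positivity)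
    have h1 : (E ∩ Set.Icc 1 N).ncard ≤ (Set.Icc 1 N).ncard :=
      Set.ncard_le_ncard Set.inter_subset_right (Set.finite_Icc 1 N)
    have h2 : (Set.Icc 1 N).ncard = N := by
      rw [← Finset.coe_Icc, Set.ncard_coe_finset, Nat.card_Icc, Nat.add_sub_cancel]
    exact_mod_cast h1.trans h2.le
  · filter_upwards [h, eventually_gt_atTop 0] with N hN hN0
    rwa [le_div_iff₀ (by exact_mod_cast hN0)]

open scoped Classical in
lemma card_filter_prime_le (G : Set ℕ) (N : ℕ) :
    ((Finset.Ioc 0 (Nat.nth Nat.Prime N)).filter fun p => p.Prime ∧ p ∈ G).card ≤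
      ({n | Nat.nth Nat.Prime n ∈ G} ∩ Set.Icc 1 N).ncard + 1 := by
  set F := ({n | Nat.nth Nat.Prime n ∈ G} ∩ Set.Icc 1 N) with hF
  have hfin : F.Finite := (Set.finite_Icc 1 N).subset Set.inter_subset_right
  rw [Set.ncard_eq_toFinset_card F hfin]
  refine le_trans ?_ (Finset.card_insert_le 0 hfin.toFinset)
  refine Finset.card_le_card_of_injOn (Nat.count Nat.Prime) ?_ ?_
  · intro p hp
    simp only [Finset.coe_filter, Finset.mem_Ioc, Set.mem_ofPred_eq] at hp
    have hle : Nat.count Nat.Prime p ≤ N := by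
      rw [← Nat.count_nth_of_infinite Nat.infinite_setOfPred_prime N]
      exact Nat.count_monotone _ hp.1.2
    simp only [Finset.coe_insert, Set.Finite.coe_toFinset, Set.mem_insert_iff]
    rcases Nat.eq_zero_or_pos (Nat.count Nat.Prime p) with h0 | h0
    · exact Or.inl h0
    · refine Or.inr ⟨?_, h0, hle⟩
      rw [Set.mem_ofPred_eq, Nat.nth_count hp.2.1]
      exact hp.2.2
  · intro p hp r hr hpr
    simp only [Finset.coe_filter, Finset.mem_Ioc, Set.mem_ofPred_eq] at hp hr
    rw [← Nat.nth_count hp.2.1, hpr, Nat.nth_count hr.2.1]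

open scoped Classical in
lemma sum_indicator_vonMangoldt_le (G : Set ℕ) (x : ℕ) :
    ∑ n ∈ Finset.Ioc 0 x, G.indicator (fun n => ArithmeticFunction.vonMangoldt n) n ≤
      ((Finset.Ioc 0 x).filter fun p => p.Prime ∧ p ∈ G).card * Real.log x +
        (Chebyshev.psi x - Chebyshev.theta x) := by
  rw [Chebyshev.psi_sub_theta_eq_sum_not_prime, Nat.floor_natCast, Finset.card_filter,
    Finset.sum_filter]
  push_cast
  rw [Finset.sum_mul, ← Finset.sum_add_distrib]
  refine Finset.sum_le_sum fun n hn => ?_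
  rw [Finset.mem_Ioc] at hn
  have h0 := ArithmeticFunction.vonMangoldt_nonneg (n := n)
  have hlog : ArithmeticFunction.vonMangoldt n ≤ Real.log x :=
    ArithmeticFunction.vonMangoldt_le_log.trans
      (Real.log_le_log (by exact_mod_cast hn.1) (by exact_mod_cast hn.2))
  by_cases hG : n ∈ G <;> by_cases hp : n.Prime <;> simp [hG, hp, h0, hlog]

/-- A set containing a positive proportion of the primes, as measured by the von Mangoldt
function, corresponds to a set of indices of positive lower density. -/
theorem hasPositiveLowerDensity_setOf_nth_prime_mem {G : Set ℕ} {c : ℝ} (hc : 0 < c)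
    (h : ∀ᶠ x : ℕ in atTop, c * x ≤
      ∑ n ∈ Finset.Ioc 0 x, G.indicator (fun n => ArithmeticFunction.vonMangoldt n) n) :
    HasPositiveLowerDensity {n | Nat.nth Nat.Prime n ∈ G} := by
  classical
  obtain ⟨C, hC⟩ := Chebyshev.psi_sub_theta_le_mul_sqrt
  set K : ℝ := Real.log 4 + 1 with hK
  have hK0 : 0 < K := by
    have := Real.log_pos (show (1 : ℝ) < 4 by norm_num)
    linarith
  have hnth : Tendsto (fun N => Nat.nth Nat.Prime N) atTop atTop :=
    (Nat.nth_strictMono Nat.infinite_setOfPred_prime).tendsto_atTop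
  have hnthR : Tendsto (fun N => (Nat.nth Nat.Prime N : ℝ)) atTop atTop :=
    tendsto_natCast_atTop_atTop.comp hnth
  have hsqrt : ∀ᶠ y : ℝ in atTop, C * √y ≤ c / 2 * y := by
    filter_upwards [(Real.tendsto_sqrt_atTop).eventually_ge_atTop (C / (c / 2)),
      eventually_ge_atTop 0] with y hy hy0
    rw [div_le_iff₀ (by positivity)] at hy
    calc C * √y ≤ (√y * (c / 2)) * √y := by gcongr
      _ = c / 2 * (√y * √y) := by ring
      _ = c / 2 * y := by rw [Real.mul_self_sqrt hy0]
  refine hasPositiveLowerDensity_of_eventually_mul_le (κ := c / (4 * K)) (by positivity) ?_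
  filter_upwards [hnth.eventually h, hnthR.eventually hsqrt,
    hnthR.eventually (Chebyshev.eventually_primeCounting_le one_pos),
    hnthR.eventually_ge_atTop 2, tendsto_natCast_atTop_atTop.eventually_ge_atTop (4 * K / c)]
    with N h1 h2 h3 h4 h5
  set x := Nat.nth Nat.Prime N with hx
  have hlog : 0 < Real.log x := Real.log_pos (by linarith)
  rw [Nat.floor_natCast] at h3
  have hN : (N : ℝ) ≤ Nat.primeCounting x := by
    have : N ≤ Nat.primeCounting x := by
      conv_lhs => rw [← Nat.count_nth_of_infinite Nat.infinite_setOfPred_prime N]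
      exact Nat.count_monotone _ (Nat.le_succ _)
    exact_mod_cast this
  have h6 := hN.trans h3
  rw [le_div_iff₀ hlog] at h6
  have h7 := sum_indicator_vonMangoldt_le G x
  have h8 : ((((Finset.Ioc 0 x).filter fun p => p.Prime ∧ p ∈ G).card : ℕ) : ℝ) ≤
      (({n | Nat.nth Nat.Prime n ∈ G} ∩ Set.Icc 1 N).ncard : ℝ) + 1 := by
    exact_mod_cast card_filter_prime_le G N
  have h9 := mul_le_mul_of_nonneg_right h8 hlog.le
  set M : ℝ := (({n | Nat.nth Nat.Prime n ∈ G} ∩ Set.Icc 1 N).ncard : ℝ) with hM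
  have h10 : c / 2 * x ≤ (M + 1) * Real.log x := by
    have := hC x
    linarith
  have h11 : c / (2 * K) * N * Real.log x ≤ (M + 1) * Real.log x := by
    refine le_trans ?_ h10
    calc c / (2 * K) * N * Real.log x = c / (2 * K) * (N * Real.log x) := by ring
      _ ≤ c / (2 * K) * (K * x) := by gcongr
      _ = c / 2 * x := by field_simp
  have h12 : c / (2 * K) * N ≤ M + 1 := le_of_mul_le_mul_right h11 hlog
  have h13 : 1 ≤ c / (4 * K) * N := by
    rw [div_le_iff₀ hc] at h5
    rw [div_mul_eq_mul_div, le_div_iff₀ (by positivity)]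
    linarith
  have h14 : c / (2 * K) * N = c / (4 * K) * N + c / (4 * K) * N := by
    field_simp; ring
  linarith

lemma eventually_mul_le_sum_indicator {q : ℕ} [NeZero q] {a : ZMod q} (ha : IsUnit a)
    {f : ℕ → ℝ} (hf : ∀ n, f n ≤ 1) {r δ : ℝ} (hr : 0 ≤ r) (hδ : 0 < δ)
    (h : ∀ᶠ x : ℕ in atTop, (r - δ) *
      ∑ n ∈ Finset.Ioc 0 x, ArithmeticFunction.vonMangoldt.residueClass a n ≤
      ∑ n ∈ Finset.Ioc 0 x, ArithmeticFunction.vonMangoldt.residueClass a n * f n) :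
    ∃ c : ℝ, 0 < c ∧ ∀ᶠ x : ℕ in atTop, c * x ≤ ∑ n ∈ Finset.Ioc 0 x,
      {n | r - 2 * δ < f n}.indicator (fun n => ArithmeticFunction.vonMangoldt n) n := by
  obtain ⟨c, hc, hev⟩ := exists_mul_le_sum_residueClass ha
  refine ⟨δ * c / (1 + 2 * δ), by positivity, ?_⟩
  filter_upwards [h, hev] with x hx hcx
  set G : Set ℕ := {n | r - 2 * δ < f n} with hG
  set w := ArithmeticFunction.vonMangoldt.residueClass a with hw
  have hle : ∀ n, w n * f n ≤ (r - 2 * δ) * w n +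
      (1 + 2 * δ) * G.indicator (fun n => ArithmeticFunction.vonMangoldt n) n := by
    intro n
    have h0 : 0 ≤ w n := ArithmeticFunction.vonMangoldt.residueClass_nonneg a n
    have h1 : w n ≤ ArithmeticFunction.vonMangoldt n :=
      ArithmeticFunction.vonMangoldt.residueClass_le a n
    by_cases hn : n ∈ G
    · rw [Set.indicator_of_mem hn]
      have h2 : w n * f n ≤ w n := mul_le_of_le_one_right h0 (hf n)
      have h3 : (1 + 2 * δ) * w n ≤ (1 + 2 * δ) * ArithmeticFunction.vonMangoldt n := by gcongr
      nlinarith [mul_nonneg hr h0]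
    · rw [Set.indicator_of_notMem hn, mul_zero, add_zero, mul_comm]
      exact mul_le_mul_of_nonneg_right (not_lt.mp hn) h0
  have hsum := Finset.sum_le_sum fun n (_ : n ∈ Finset.Ioc 0 x) => hle n
  rw [Finset.sum_add_distrib, ← Finset.mul_sum, ← Finset.mul_sum] at hsum
  rw [div_mul_eq_mul_div, div_le_iff₀ (by positivity)]
  have := mul_le_mul_of_nonneg_left hcx hδ.le
  linarith

lemma hasPositiveLowerDensity_of_forall {p : ℕ → Prop} (h : ∀ n, p n) :
    HasPositiveLowerDensity {n | p n} := by
  refine hasPositiveLowerDensity_of_eventually_mul_le one_pos (Eventually.of_forall fun N => ?_)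
  rw [show {n | p n} = Set.univ from Set.eq_univ_of_forall h, Set.univ_inter, ← Finset.coe_Icc,
    Set.ncard_coe_finset, Nat.card_Icc, Nat.add_sub_cancel, one_mul]

/-- Single recurrence along a polynomial evaluated at primes shifted by a unit. -/
theorem hasPositiveLowerDensity_recurrence {X : Type*} [MeasurableSpace X] {μ : Measure X}
    [IsProbabilityMeasure μ] {e : Equiv.Perm X} (he : MeasurePreserving e μ μ)
    (he' : Measurable e.symm) {g : Polynomial ℤ} (hg : g.eval 0 = 0) {A : Set X}
    (hA : MeasurableSet A) {ε : ℝ} (hε : 0 < ε) {s : ℤ} (hs : IsUnit s) :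
    HasPositiveLowerDensity {n : ℕ | μ.real A ^ 2 - ε <
      μ.real (A ∩ zpreimage e e.symm (g.eval ((Nat.nth Nat.Prime n : ℤ) + s)) A)} := by
  set m := μ.real A with hm
  have hm1 : m ≤ 1 := measureReal_le_one
  have hall : (∀ n : ℕ, m ^ 2 - ε <
      μ.real (A ∩ zpreimage e e.symm (g.eval ((Nat.nth Nat.Prime n : ℤ) + s)) A)) →
      HasPositiveLowerDensity {n : ℕ | m ^ 2 - ε <
      μ.real (A ∩ zpreimage e e.symm (g.eval ((Nat.nth Nat.Prime n : ℤ) + s)) A)} :=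
    hasPositiveLowerDensity_of_forall
  have hm0 : 0 ≤ m := measureReal_nonneg
  rcases hm0.eq_or_lt with h0 | hpos
  · refine hall fun n => lt_of_lt_of_le ?_ measureReal_nonneg
    rw [← h0]
    linarith
  by_cases hdeg : g.natDegree = 0
  · refine hall fun n => ?_
    have hg0 : ∀ k, g.eval k = 0 := by
      intro k
      rw [Polynomial.eq_C_of_natDegree_eq_zero hdeg, Polynomial.eval_C] at hg ⊢
      exact hg
    rw [hg0, zpreimage_eq, zpow_zero]
    simp only [Equiv.Perm.coe_one, Set.preimage_id_eq, id, Set.inter_self]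
    nlinarith
  obtain ⟨ν, hν, hc, hatom⟩ := exists_spectralMeasure he he' hA hpos
  have hδ : 0 < ε / (2 * m) := by positivity
  obtain ⟨q, _, a, ha, hev⟩ := exists_residueClass_eventually_mul_le_sum ν hc hg hdeg hs hδ
  obtain ⟨c, hc0, hev'⟩ := eventually_mul_le_sum_indicator ha
    (f := fun n : ℕ => μ.real (A ∩ (⇑(e ^ (g.eval ((n : ℤ) + s))) ⁻¹' A)) / m)
    (fun n => div_le_one_of_le₀ (measureReal_mono Set.inter_subset_left) hpos.le)
    measureReal_nonneg hδ hev
  refine hasPositiveLowerDensity_setOf_nth_prime_mem (G := {n : ℕ | m ^ 2 - ε <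
      μ.real (A ∩ zpreimage e e.symm (g.eval ((n : ℤ) + s)) A)}) hc0 ?_
  filter_upwards [hev'] with x hx
  refine hx.trans (Finset.sum_le_sum fun n _ => ?_)
  refine Set.indicator_le_indicator_of_subset (fun k hk => ?_)
    (fun _ => ArithmeticFunction.vonMangoldt_nonneg) n
  simp only [Set.mem_ofPred_eq] at hk ⊢
  rw [lt_div_iff₀ hpos] at hk
  rw [zpreimage_eq]
  refine lt_of_le_of_lt ?_ hk
  have h1 : m * m ≤ ν.real {0} * m := mul_le_mul_of_nonneg_right hatom hpos.le
  have h2 : 2 * (ε / (2 * m)) * m = ε := by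
    field_simp
  nlinarith

theorem single_recurrence_along_shifted_primes
    {X : Type*} [MeasurableSpace X] (μ : Measure X) [IsProbabilityMeasure μ]
    (T S : X → X) (hT : Measurable T) (hS : Measurable S)
    (hTS : Function.LeftInverse S T) (hST : Function.RightInverse S T)
    (hErg : Ergodic T μ)
    (g : Polynomial ℤ) (hg : g.eval 0 = 0)
    (A : Set X) (hA : MeasurableSet A) (ε : ℝ) (hε : 0 < ε) :
    HasPositiveLowerDensity {n : ℕ |
      (μ (A ∩ zpreimage T S (g.eval (((Nat.nth Nat.Prime n : ℕ) : ℤ) - 1)) A)).toReal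
        > (μ A).toReal ^ 2 - ε} ∧
    HasPositiveLowerDensity {n : ℕ |
      (μ (A ∩ zpreimage T S (g.eval (((Nat.nth Nat.Prime n : ℕ) : ℤ) + 1)) A)).toReal
        > (μ A).toReal ^ 2 - ε} := by
  let e : Equiv.Perm X := ⟨T, S, hTS, hST⟩
  have he : MeasurePreserving e μ μ := hErg.toMeasurePreserving
  have h1 := hasPositiveLowerDensity_recurrence he hS hg hA hε isUnit_one.neg
  have h2 := hasPositiveLowerDensity_recurrence he hS hg hA hε isUnit_one
  simp only [← sub_eq_add_neg] at h1
  exact ⟨h1, h2⟩
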